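/- arXiv:2510.08862 — 5 statements merged into one kernel-verified Lean document; each statement's English description precedes it below -/
import Mathlib

section
/- There exist an absolute constant C > 0 and, for each ε ∈ (0, 1/2), a threshold N₀(ε) such that the following holds. Let N > N₀(ε) be an integer and let y be a real number with (4C·log N)^{1/(2ε)} ≤ y ≤ N. Let 𝒫 be a set of primes contained in [y, 2y] with |𝒫| ≥ C·y^{1−2ε}·log N / log y. For each prime p ∈ 𝒫, let R_p ⊆ ℤ/pℤ be an arithmetic progression of length at most p^{1/2−ε} + 1. Let A be the set of all integers n ∈ {0, 1, …, N} such that for every p ∈ 𝒫 the residue of n mod p lies in R_p. Then A is an arithmetic progression of integers of length at most (2y)^{1/2−ε} + 1. -/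
/-- `R ⊆ ℤ/pℤ` is an arithmetic progression with exactly `k` terms. -/
def IsAPZModLen (p : ℕ) (R : Set (ZMod p)) (k : ℕ) : Prop :=
  ∃ a d : ZMod p, R = (fun j : ℕ => a + (j : ZMod p) * d) '' {j : ℕ | j < k}

/-- `A ⊆ ℤ` is an arithmetic progression with exactly `k` terms
(the empty set being the case `k = 0`). -/
def IsIntAPLen (A : Set ℤ) (k : ℕ) : Prop :=
  ∃ a d : ℤ, A = (fun j : ℕ => a + (j : ℤ) * d) '' {j : ℕ | j < k}

open Finset in
/-- Distinct primes `p ≥ y` dividing a nonzero integer `D` number at most `log |D| / log y`. -/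
theorem card_mul_log_le_of_primes_dvd {S : Finset ℕ} {y B : ℝ} {D : ℤ} (hy : 0 < y)
    (hS : ∀ p ∈ S, p.Prime ∧ y ≤ (p : ℝ)) (hD : D ≠ 0) (hdvd : ∀ p ∈ S, (p : ℤ) ∣ D)
    (hB : |(D : ℝ)| ≤ B) : (#S : ℝ) * Real.log y ≤ Real.log B := by
  have hdiv : ∏ p ∈ S, p ∣ D.natAbs :=
    Finset.prod_primes_dvd _ (fun p hp => (hS p hp).1.prime)
      fun p hp => Int.natCast_dvd.1 (hdvd p hp)
  have hle : ∏ p ∈ S, p ≤ D.natAbs := Nat.le_of_dvd (Int.natAbs_pos.2 hD) hdiv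
  have hpow : y ^ #S ≤ B := by
    calc y ^ #S = ∏ _p ∈ S, y := by simp
      _ ≤ ∏ p ∈ S, (p : ℝ) := Finset.prod_le_prod (fun _ _ => hy.le) fun p hp => (hS p hp).2
      _ = ((∏ p ∈ S, p : ℕ) : ℝ) := by push_cast; rfl
      _ ≤ (D.natAbs : ℝ) := by exact_mod_cast hle
      _ = |(D : ℝ)| := by rw [Nat.cast_natAbs]; push_cast; rfl
      _ ≤ B := hB
  rw [← Real.log_pow]
  exact Real.log_le_log (by positivity) hpow

/-- An index function for a progression modulo `p`. -/
theorem IsAPZModLen.exists_index {p : ℕ} {R : Set (ZMod p)} {k : ℕ} (h : IsAPZModLen p R k) :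
    ∃ (a d : ZMod p) (J : ZMod p → ℤ), (∀ r ∈ R, 0 ≤ J r ∧ J r < k ∧ r = a + J r * d) ∧
      ∀ i : ℤ, 0 ≤ i → i < k → a + i * d ∈ R := by
  obtain ⟨a, d, rfl⟩ := h
  have hJ : ∀ r : ZMod p, ∃ j : ℤ, r ∈ (fun j : ℕ => a + (j : ZMod p) * d) '' {j : ℕ | j < k} →
      0 ≤ j ∧ j < k ∧ r = a + j * d := by
    intro r
    by_cases hr : r ∈ (fun j : ℕ => a + (j : ZMod p) * d) '' {j : ℕ | j < k}
    · obtain ⟨j, hj, rfl⟩ := hr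
      exact ⟨j, fun _ => ⟨by positivity, by exact_mod_cast hj, by simp⟩⟩
    · exact ⟨0, fun h => absurd h hr⟩
  choose J hJ using hJ
  refine ⟨a, d, J, hJ, fun i hi hik => ?_⟩
  lift i to ℕ using hi
  exact ⟨i, by exact_mod_cast hik, by simp⟩

/-- Modulo a prime `p ∤ b - a`, the ratio `(n - a) / (b - a)` of differences of elements of a
short progression is a fraction of small height. -/
theorem IsAPZModLen.exists_ratio {p : ℕ} {R : Set (ZMod p)} {k h : ℕ} (hR : IsAPZModLen p R k)
    (hk : k ≤ h + 1) {a b n : ℤ} (ha : (a : ZMod p) ∈ R) (hb : (b : ZMod p) ∈ R)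
    (hn : (n : ZMod p) ∈ R) (hp : ¬ (p : ℤ) ∣ b - a) :
    ∃ u v : ℤ, |u| ≤ h ∧ |v| ≤ h ∧ v ≠ 0 ∧ (p : ℤ) ∣ v * (n - a) - u * (b - a) := by
  obtain ⟨c, d, J, hJ, -⟩ := hR.exists_index
  obtain ⟨ha0, ha1, ha2⟩ := hJ _ ha
  obtain ⟨hb0, hb1, hb2⟩ := hJ _ hb
  obtain ⟨hn0, hn1, hn2⟩ := hJ _ hn
  refine ⟨J n - J a, J b - J a, ?_, ?_, ?_, ?_⟩
  · rw [abs_le]; constructor <;> omega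
  · rw [abs_le]; constructor <;> omega
  · intro h0
    refine hp ((ZMod.intCast_zmod_eq_zero_iff_dvd _ _).1 ?_)
    push_cast
    rw [ha2, hb2, show J b = J a by omega, sub_self]
  · refine (ZMod.intCast_zmod_eq_zero_iff_dvd _ _).1 ?_
    have e1 : (n : ZMod p) - a = (J n - J a) * d := by
      calc (n : ZMod p) - a = (c + J n * d) - (c + J a * d) := by rw [← hn2, ← ha2]
        _ = _ := by ring
    have e2 : (b : ZMod p) - a = (J b - J a) * d := by
      calc (b : ZMod p) - a = (c + J b * d) - (c + J a * d) := by rw [← hb2, ← ha2]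
        _ = _ := by ring
    push_cast
    rw [e1, e2]
    ring

/-- A nonempty set of integers has a greatest common divisor of its translates by `-a`,
which inherits divisibilities after scaling. -/
theorem exists_gcd_sub (A : Set ℤ) (a : ℤ) :
    ∃ g : ℤ, 0 ≤ g ∧ (∀ n ∈ A, g ∣ n - a) ∧
      ∀ e m : ℤ, (∀ n ∈ A, e ∣ m * (n - a)) → e ∣ m * g := by
  obtain ⟨g, hg⟩ := Int.subgroup_cyclic (AddSubgroup.closure ((fun n => n - a) '' A))
  have hmem : ∀ n ∈ A, g ∣ n - a := by
    intro n hn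
    have : n - a ∈ AddSubgroup.closure ((fun n => n - a) '' A) :=
      AddSubgroup.subset_closure ⟨n, hn, rfl⟩
    rw [hg, AddSubgroup.mem_closure_singleton] at this
    obtain ⟨z, hz⟩ := this
    exact ⟨z, by rw [← hz]; simp [mul_comm]⟩
  refine ⟨|g|, abs_nonneg g, fun n hn => (abs_dvd _ _).2 (hmem n hn), fun e m h => ?_⟩
  have key : ∀ x ∈ AddSubgroup.closure ((fun n => n - a) '' A), e ∣ m * x := by
    intro x hx
    induction hx using AddSubgroup.closure_induction with
    | mem x hx => obtain ⟨n, hn, rfl⟩ := hx; exact h n hn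
    | zero => simp
    | add x y _ _ hx hy => rw [mul_add]; exact dvd_add hx hy
    | neg x _ hx => rw [mul_neg]; exact (dvd_neg).2 hx
  have hgm : e ∣ m * g := key g (by rw [hg]; exact AddSubgroup.subset_closure rfl)
  rcases abs_choice g with h' | h' <;> rw [h']
  · exact hgm
  · rw [mul_neg]; exact (dvd_neg).2 hgm

/-- If a sieved set has all ratios of differences of small height, it is a short progression. -/
theorem exists_isIntAPLen_of_ratios {A : Set ℤ} {Ps : Finset ℕ} {R : (p : ℕ) → Set (ZMod p)}
    {N : ℤ} {h : ℕ} (hA : A = {n : ℤ | 0 ≤ n ∧ n ≤ N ∧ ∀ p ∈ Ps, (n : ZMod p) ∈ R p})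
    (hP : ∀ p ∈ Ps, p.Prime ∧ 2 * h * h < p)
    (hR : ∀ p ∈ Ps, ∃ k : ℕ, k ≤ h + 1 ∧ IsAPZModLen p (R p) k)
    {a b : ℤ} (ha : a ∈ A) (hb : b ∈ A) (hab : a < b) (hbd : ∀ n ∈ A, a ≤ n ∧ n ≤ b)
    (hratio : ∀ n ∈ A, ∃ s t : ℤ, |s| ≤ h ∧ |t| ≤ h ∧ t ≠ 0 ∧ t * (n - a) = s * (b - a))
    (hgood : ∃ p ∈ Ps, ¬ (p : ℤ) ∣ b - a) :
    ∃ k : ℕ, k ≤ h + 1 ∧ IsIntAPLen A k := by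
  obtain ⟨g, hg0, hgdvd, hgcd⟩ := exists_gcd_sub A a
  obtain ⟨M, hM⟩ := hgdvd b hb
  have hgpos : 0 < g := by
    rcases hg0.lt_or_eq with h' | h'
    · exact h'
    · rw [← h', zero_mul] at hM; omega
  have hMpos : 0 < M := by
    by_contra hcon
    have : g * M ≤ 0 := mul_nonpos_of_nonneg_of_nonpos hg0 (not_lt.1 hcon)
    omega
  have hmemR : ∀ n ∈ A, ∀ p ∈ Ps, (n : ZMod p) ∈ R p := by
    intro n hn; rw [hA] at hn; exact hn.2.2
  have hratio_mod : ∀ p ∈ Ps, ¬ (p : ℤ) ∣ b - a → ∀ n ∈ A, ∀ u v : ℤ, |u| ≤ h → |v| ≤ h →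
      (p : ℤ) ∣ v * (n - a) - u * (b - a) → v * (n - a) = u * (b - a) := by
    intro p hp hpd n hn u v hu hv hdvd
    obtain ⟨s, t, hs, ht, ht0, hst⟩ := hratio n hn
    have hd : (p : ℤ) ∣ (v * s - u * t) * (b - a) := by
      have : (v * s - u * t) * (b - a) = t * (v * (n - a) - u * (b - a)) := by
        linear_combination (-v) * hst
      rw [this]; exact hdvd.mul_left t
    have hd' : (p : ℤ) ∣ v * s - u * t :=
      ((Nat.prime_iff_prime_int.1 (hP p hp).1).dvd_or_dvd hd).resolve_right hpd
    have hlt : |v * s - u * t| < p := by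
      have h1 : |v * s| ≤ h * h := by rw [abs_mul]; gcongr
      have h2 : |u * t| ≤ h * h := by rw [abs_mul]; gcongr
      have h3 : (2 * h * h : ℤ) < p := by exact_mod_cast (hP p hp).2
      have := abs_sub (v * s) (u * t)
      linarith
    have hz := Int.eq_zero_of_abs_lt_dvd hd' hlt
    exact mul_left_cancel₀ ht0 (by linear_combination v * hst + (b - a) * hz)
  have hMv : ∀ p ∈ Ps, ¬ (p : ℤ) ∣ b - a → ∀ v : ℤ,
      (∀ n ∈ A, ∃ u : ℤ, |u| ≤ h ∧ |v| ≤ h ∧ (p : ℤ) ∣ v * (n - a) - u * (b - a)) →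
      M ∣ v := by
    intro p hp hpd v hv
    have : b - a ∣ v * g := by
      refine hgcd _ _ fun n hn => ?_
      obtain ⟨u, hu, hv, hdvd⟩ := hv n hn
      exact ⟨u, by rw [hratio_mod p hp hpd n hn u v hu hv hdvd, mul_comm]⟩
    rw [hM, mul_comm v] at this
    exact (mul_dvd_mul_iff_left hgpos.ne').1 this
  have hlocal : ∀ p ∈ Ps, ¬ (p : ℤ) ∣ b - a →
      M ≤ h ∧ ∀ i : ℤ, 0 ≤ i → i ≤ M → ((a + i * g : ℤ) : ZMod p) ∈ R p := by
    intro p hp hpd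
    have : Fact p.Prime := ⟨(hP p hp).1⟩
    obtain ⟨k, hk, hRp⟩ := hR p hp
    obtain ⟨c, d, J, hJ, hJ'⟩ := hRp.exists_index
    obtain ⟨ha0, ha1, ha2⟩ := hJ _ (hmemR a ha p hp)
    obtain ⟨hb0, hb1, hb2⟩ := hJ _ (hmemR b hb p hp)
    have hdiff : ∀ n ∈ A, ((n : ZMod p) - a) = ((J n - J a : ℤ) : ZMod p) * d := by
      intro n hn
      obtain ⟨-, -, hn2⟩ := hJ _ (hmemR n hn p hp)
      calc (n : ZMod p) - a = (c + J n * d) - (c + J a * d) := by rw [← hn2, ← ha2]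
        _ = _ := by push_cast; ring
    have hvabs : |J b - J a| ≤ h := by rw [abs_le]; constructor <;> omega
    have hv0 : J b - J a ≠ 0 := by
      intro h0
      refine hpd ((ZMod.intCast_zmod_eq_zero_iff_dvd _ _).1 ?_)
      push_cast
      rw [hdiff b hb, h0]; simp
    obtain ⟨w, hw⟩ := hMv p hp hpd (J b - J a) (fun n hn => by
      obtain ⟨hn0, hn1, -⟩ := hJ _ (hmemR n hn p hp)
      refine ⟨J n - J a, by rw [abs_le]; constructor <;> omega, hvabs, ?_⟩
      refine (ZMod.intCast_zmod_eq_zero_iff_dvd _ _).1 ?_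
      rw [Int.cast_sub, Int.cast_mul, Int.cast_mul, Int.cast_sub n, Int.cast_sub b, hdiff n hn,
        hdiff b hb]
      ring)
    have hMh : M ≤ h := by
      have h1 : M ≤ |J b - J a| := Int.le_of_dvd (abs_pos.2 hv0) ((dvd_abs _ _).2 ⟨w, hw⟩)
      exact h1.trans hvabs
    have hMp : (M : ZMod p) ≠ 0 := by
      intro h0
      exact hpd (hM ▸ ((ZMod.intCast_zmod_eq_zero_iff_dvd _ _).1 h0).mul_left g)
    have hgw : (g : ZMod p) = w * d := by
      refine mul_left_cancel₀ hMp ?_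
      have h1 := hdiff b hb
      rw [hw, ← Int.cast_sub, hM] at h1
      push_cast at h1
      linear_combination h1
    refine ⟨hMh, fun i hi0 hiM => ?_⟩
    have hi : ((a + i * g : ℤ) : ZMod p) = c + ((J a + i * w : ℤ) : ZMod p) * d := by
      push_cast
      rw [hgw]
      linear_combination ha2
    rw [hi]
    refine hJ' _ ?_ ?_
    · rcases le_total 0 w with hw0 | hw0
      · nlinarith [mul_nonneg hi0 hw0]
      · nlinarith [mul_nonneg (sub_nonneg.2 hiM) (neg_nonneg.2 hw0)]
    · rcases le_total 0 w with hw0 | hw0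
      · nlinarith [mul_nonneg (sub_nonneg.2 hiM) hw0]
      · nlinarith [mul_nonneg hi0 (neg_nonneg.2 hw0)]
  obtain ⟨q, hq, hqd⟩ := hgood
  have hMh := (hlocal q hq hqd).1
  have hMp : ∀ p ∈ Ps, M < p := by
    intro p hp
    have h3 : (2 * h * h : ℤ) < p := by exact_mod_cast (hP p hp).2
    have : (h : ℤ) ≤ h * h := by exact_mod_cast Nat.le_mul_self h
    nlinarith
  refine ⟨M.toNat + 1, by omega, a, g, Set.Subset.antisymm (fun n hn => ?_) ?_⟩
  · obtain ⟨i, hi⟩ := hgdvd n hn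
    have hbn := hbd n hn
    have hi0 : 0 ≤ i := by by_contra hc; nlinarith
    have hiM : i ≤ M := by by_contra hc; nlinarith
    refine ⟨i.toNat, by simp only [Set.mem_ofPred_eq]; omega, ?_⟩
    simp only [Int.toNat_of_nonneg hi0]
    linear_combination -hi
  · rintro _ ⟨j, hj, rfl⟩
    have hjM : (j : ℤ) ≤ M := by simp only [Set.mem_ofPred_eq] at hj; omega
    have ha' := ha
    have hb' := hb
    rw [hA] at ha' hb' ⊢
    have h1 : 0 ≤ (j : ℤ) * g := by positivity
    have h2 : (j : ℤ) * g ≤ b - a := by rw [hM, mul_comm]; gcongr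
    refine ⟨by dsimp only; linarith [ha'.1], by dsimp only; linarith [hb'.2.1], fun p hp => ?_⟩
    by_cases hpd : (p : ℤ) ∣ b - a
    · have hpM : ¬ (p : ℤ) ∣ M := fun hc => by
        have := Int.le_of_dvd hMpos hc
        have := hMp p hp
        omega
      have hpg : (p : ℤ) ∣ g := by
        rw [hM] at hpd
        exact ((Nat.prime_iff_prime_int.1 (hP p hp).1).dvd_or_dvd hpd).resolve_right hpM
      have : (g : ZMod p) = 0 := (ZMod.intCast_zmod_eq_zero_iff_dvd _ _).2 hpg
      simpa [this] using ha'.2.2 p hp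
    · exact (hlocal p hp hpd).2 j (by positivity) hjM

open Finset in
/-- If many primes `p ∈ S` see `(n - a) / (b - a)` as a fraction of height at most `h`,
then it is such a fraction. -/
theorem exists_ratio_of_card {S : Finset ℕ} {y : ℝ} {N h : ℕ} {μ : ℝ} {a b n : ℤ} (hy : 1 < y)
    (hS : ∀ p ∈ S, p.Prime ∧ y ≤ (p : ℝ)) (hhN : 2 * h ≤ N)
    (hna : |n - a| ≤ N) (hba : |b - a| ≤ N)
    (hloc : ∀ p ∈ S, ∃ u v : ℤ, |u| ≤ h ∧ |v| ≤ h ∧ v ≠ 0 ∧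
      (p : ℤ) ∣ v * (n - a) - u * (b - a))
    (hμ : 2 * Real.log N < μ * Real.log y) (hcard : (2 * h + 1) ^ 2 * μ ≤ (#S : ℝ)) :
    ∃ s t : ℤ, |s| ≤ h ∧ |t| ≤ h ∧ t ≠ 0 ∧ t * (n - a) = s * (b - a) := by
  classical
  have hloc' : ∀ p : ℕ, ∃ w : ℤ × ℤ, p ∈ S → |w.1| ≤ h ∧ |w.2| ≤ h ∧ w.2 ≠ 0 ∧
      (p : ℤ) ∣ w.2 * (n - a) - w.1 * (b - a) := by
    intro p
    by_cases hp : p ∈ S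
    · obtain ⟨u, v, huv⟩ := hloc p hp
      exact ⟨(u, v), fun _ => huv⟩
    · exact ⟨0, fun hc => absurd hc hp⟩
  choose f hf using hloc'
  have hcardT : #(Icc (-h : ℤ) h ×ˢ Icc (-h : ℤ) h) = (2 * h + 1) ^ 2 := by
    have hI : #(Icc (-h : ℤ) h) = 2 * h + 1 := by rw [Int.card_Icc]; omega
    rw [card_product, hI, sq]
  obtain ⟨⟨u, v⟩, -, huv⟩ := exists_le_card_fiber_of_nsmul_le_card_of_maps_to
    (s := S) (t := Icc (-h : ℤ) h ×ˢ Icc (-h : ℤ) h) (f := f) (b := μ)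
    (fun p hp => by
      obtain ⟨h1, h2, -⟩ := hf p hp
      exact mem_product.2 ⟨mem_Icc.2 (abs_le.1 h1), mem_Icc.2 (abs_le.1 h2)⟩)
    ⟨(0, 0), by simp⟩
    (by rw [hcardT, nsmul_eq_mul]; push_cast; exact hcard)
  have hlogy := Real.log_pos hy
  have hlogN : 0 ≤ Real.log N := Real.log_natCast_nonneg N
  have hμ0 : 0 < μ := by
    by_contra hc
    nlinarith
  have hfib : ∀ p ∈ S.filter (fun p => f p = (u, v)), |u| ≤ h ∧ |v| ≤ h ∧ v ≠ 0 ∧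
      (p : ℤ) ∣ v * (n - a) - u * (b - a) := by
    intro p hp
    obtain ⟨hpS, hpf⟩ := mem_filter.1 hp
    simpa [hpf] using hf p hpS
  obtain ⟨q, hq⟩ : (S.filter (fun p => f p = (u, v))).Nonempty := by
    rw [← card_pos]
    exact_mod_cast hμ0.trans_le huv
  obtain ⟨hu, hv, hv0, -⟩ := hfib q hq
  refine ⟨u, v, hu, hv, hv0, ?_⟩
  by_contra hne
  have hDle : |v * (n - a) - u * (b - a)| ≤ (N : ℤ) ^ 2 := by
    have h1 : |v * (n - a)| ≤ h * N := by rw [abs_mul]; gcongr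
    have h2 : |u * (b - a)| ≤ h * N := by rw [abs_mul]; gcongr
    have h3 : (2 * h : ℤ) ≤ N := by exact_mod_cast hhN
    have h4 := abs_sub (v * (n - a)) (u * (b - a))
    nlinarith [Nat.cast_nonneg (α := ℤ) N]
  have := card_mul_log_le_of_primes_dvd (S := S.filter (fun p => f p = (u, v)))
    (B := (N : ℝ) ^ 2) (by linarith) (fun p hp => hS p (mem_filter.1 hp).1)
    (sub_ne_zero.2 hne) (fun p hp => (hfib p hp).2.2.2) (by exact_mod_cast hDle)
  rw [Real.log_pow] at this
  push_cast at this
  nlinarith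

theorem stmt0 :
    ∃ C : ℝ, 0 < C ∧ ∀ ε : ℝ, ε ∈ Set.Ioo (0 : ℝ) (1/2) → ∃ N₀ : ℕ,
      ∀ N : ℕ, N₀ < N → ∀ y : ℝ,
        (4 * C * Real.log N) ^ (1 / (2 * ε)) ≤ y → y ≤ N →
        ∀ Ps : Finset ℕ,
          (∀ p ∈ Ps, Nat.Prime p ∧ y ≤ (p : ℝ) ∧ (p : ℝ) ≤ 2 * y) →
          C * y ^ (1 - 2 * ε) * Real.log N / Real.log y ≤ (Ps.card : ℝ) →
          ∀ R : (p : ℕ) → Set (ZMod p),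
            (∀ p ∈ Ps, ∃ k : ℕ, (k : ℝ) ≤ (p : ℝ) ^ ((1 : ℝ)/2 - ε) + 1 ∧
              IsAPZModLen p (R p) k) →
            ∀ A : Set ℤ,
              A = {n : ℤ | 0 ≤ n ∧ n ≤ (N : ℤ) ∧ ∀ p ∈ Ps, (n : ZMod p) ∈ R p} →
              ∃ k : ℕ, (k : ℝ) ≤ (2 * y) ^ ((1 : ℝ)/2 - ε) + 1 ∧ IsIntAPLen A k := by
  refine ⟨100, by norm_num, fun ε hε => ⟨2, fun N hN y hy hyN Ps hPs hcard R hR A hA => ?_⟩⟩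
  obtain ⟨hε0, hε1⟩ := hε
  have hN3 : (3 : ℝ) ≤ N := by exact_mod_cast hN
  have hlogN : 1 ≤ Real.log N := by
    rw [Real.le_log_iff_exp_le (by linarith)]
    linarith [Real.exp_one_lt_d9]
  have hbase : (1 : ℝ) ≤ 4 * 100 * Real.log N := by linarith
  have hy1 : 4 ≤ y := by
    refine le_trans ?_ hy
    calc (4 : ℝ) ≤ 4 * 100 * Real.log N := by linarith
      _ = (4 * 100 * Real.log N) ^ (1 : ℝ) := (Real.rpow_one _).symm
      _ ≤ _ := Real.rpow_le_rpow_of_exponent_le hbase (by rw [le_div_iff₀] <;> linarith)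
  have hy0 : 0 < y := by linarith
  have hyε : 400 ≤ y ^ (2 * ε) := by
    calc (400 : ℝ) ≤ 4 * 100 * Real.log N := by linarith
      _ = ((4 * 100 * Real.log N) ^ (1 / (2 * ε))) ^ (2 * ε) := by
        rw [← Real.rpow_mul (by linarith), one_div_mul_cancel (by positivity), Real.rpow_one]
      _ ≤ _ := Real.rpow_le_rpow (by positivity) hy (by positivity)
  set Y := y ^ (1 - 2 * ε) with hY
  have hYmul : Y * y ^ (2 * ε) = y := by
    rw [hY, ← Real.rpow_add hy0]; simp
  have hY1 : 1 ≤ Y := Real.one_le_rpow (by linarith) (by linarith)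
  set H := (2 * y) ^ ((1 : ℝ) / 2 - ε) with hH
  have hH1 : 1 ≤ H := Real.one_le_rpow (by linarith) (by linarith)
  have hHsq : H ^ 2 ≤ 2 * Y := by
    rw [hH, ← Real.rpow_natCast, ← Real.rpow_mul (by linarith),
      show ((1 : ℝ) / 2 - ε) * (2 : ℕ) = 1 - 2 * ε by push_cast; ring,
      Real.mul_rpow (by norm_num) hy0.le]
    gcongr
    calc (2 : ℝ) ^ (1 - 2 * ε) ≤ 2 ^ (1 : ℝ) :=
          Real.rpow_le_rpow_of_exponent_le (by norm_num) (by linarith)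
      _ = 2 := Real.rpow_one 2
  have hYy : 400 * Y ≤ y := by nlinarith
  set h := ⌊H⌋₊ with hh
  have hhH : (h : ℝ) ≤ H := Nat.floor_le (by linarith)
  have hlogy : 0 < Real.log y := Real.log_pos (by linarith)
  have hprime : ∀ p ∈ Ps, p.Prime ∧ y ≤ (p : ℝ) := fun p hp => ⟨(hPs p hp).1, (hPs p hp).2.1⟩
  have hPs' : ∀ p ∈ Ps, p.Prime ∧ 2 * h * h < p := by
    refine fun p hp => ⟨(hPs p hp).1, ?_⟩
    have h1 : (2 * h * h : ℝ) ≤ 2 * H ^ 2 := by nlinarith [Nat.cast_nonneg (α := ℝ) h]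
    have h2 : (2 * h * h : ℝ) < p := by linarith [(hPs p hp).2.1]
    exact_mod_cast h2
  have hR' : ∀ p ∈ Ps, ∃ k : ℕ, k ≤ h + 1 ∧ IsAPZModLen p (R p) k := by
    intro p hp
    obtain ⟨k, hk, hRk⟩ := hR p hp
    refine ⟨k, ?_, hRk⟩
    have h1 : (p : ℝ) ^ ((1 : ℝ) / 2 - ε) ≤ H :=
      Real.rpow_le_rpow (by positivity) (hPs p hp).2.2 (by linarith)
    rw [hh, ← Nat.floor_add_one (by linarith)]
    exact Nat.le_floor (by linarith)
  suffices ∃ k : ℕ, k ≤ h + 1 ∧ IsIntAPLen A k by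
    obtain ⟨k, hk, hAk⟩ := this
    have : (k : ℝ) ≤ h + 1 := by exact_mod_cast hk
    exact ⟨k, by linarith, hAk⟩
  have hAN : ∀ n ∈ A, 0 ≤ n ∧ n ≤ (N : ℤ) := by
    intro n hn; rw [hA] at hn; exact ⟨hn.1, hn.2.1⟩
  have hAR : ∀ n ∈ A, ∀ p ∈ Ps, (n : ZMod p) ∈ R p := by
    intro n hn; rw [hA] at hn; exact hn.2.2
  rcases A.eq_empty_or_nonempty with rfl | hne
  · exact ⟨0, by omega, 0, 0, by simp⟩
  have hfin : A.Finite := (Set.finite_Icc (0 : ℤ) N).subset fun n hn => hAN n hn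
  obtain ⟨a, ha, hamin⟩ := Set.exists_min_image A id hfin hne
  obtain ⟨b, hb, hbmax⟩ := Set.exists_max_image A id hfin hne
  simp only [id] at hamin hbmax
  rcases (hamin b hb).lt_or_eq with hab | rfl
  swap
  · refine ⟨1, by omega, a, 0, ?_⟩
    have : A = {a} := Set.eq_singleton_iff_unique_mem.2
      ⟨ha, fun n hn => le_antisymm (hbmax n hn) (hamin n hn)⟩
    rw [this]
    ext x
    simp [eq_comm]
  have hba : |b - a| ≤ N := by
    have := hAN a ha; have := hAN b hb
    rw [abs_le]; constructor <;> omega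
  have hbaR : |((b - a : ℤ) : ℝ)| ≤ N := by exact_mod_cast hba
  set L := Real.log N / Real.log y with hL
  have hL1 : 1 ≤ L := (one_le_div hlogy).2 (Real.log_le_log hy0 hyN)
  have hLmul : L * Real.log y = Real.log N := div_mul_cancel₀ _ hlogy.ne'
  set S := Ps.filter fun p : ℕ => ¬ (p : ℤ) ∣ b - a with hS
  have hScard : 99 * Y * L ≤ (S.card : ℝ) := by
    have h1 : ((Ps.filter fun p : ℕ => (p : ℤ) ∣ b - a).card : ℝ) * Real.log y ≤ Real.log N :=
      card_mul_log_le_of_primes_dvd hy0 (fun p hp => hprime p (Finset.mem_filter.1 hp).1)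
        (sub_ne_zero.2 hab.ne') (fun p hp => (Finset.mem_filter.1 hp).2) hbaR
    have h2 : ((Ps.filter fun p : ℕ => (p : ℤ) ∣ b - a).card : ℝ) ≤ L := (le_div_iff₀ hlogy).2 h1
    have h3 : ((Ps.filter fun p : ℕ => (p : ℤ) ∣ b - a).card : ℝ) + S.card = Ps.card := by
      exact_mod_cast Finset.card_filter_add_card_filter_not (s := Ps) fun p : ℕ => (p : ℤ) ∣ b - a
    have h4 : 100 * Y * L ≤ Ps.card := by rw [hL, ← mul_div_assoc]; exact hcard
    nlinarith
  refine exists_isIntAPLen_of_ratios hA hPs' hR' ha hb hab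
    (fun n hn => ⟨hamin n hn, hbmax n hn⟩) (fun n hn => ?_) ?_
  · refine exists_ratio_of_card (S := S) (N := N) (μ := 3 * L) (by linarith : 1 < y)
      (fun p hp => hprime p (Finset.mem_filter.1 hp).1) ?_ ?_ hba (fun p hp => ?_) ?_ ?_
    · have : (2 * h : ℝ) ≤ N := by nlinarith
      exact_mod_cast this
    · have := hAN a ha; have := hAN n hn
      rw [abs_le]; constructor <;> omega
    · obtain ⟨hpP, hpd⟩ := Finset.mem_filter.1 hp
      obtain ⟨k, hk, hRk⟩ := hR' p hpP
      exact hRk.exists_ratio hk (hAR a ha p hpP) (hAR b hb p hpP) (hAR n hn p hpP) hpd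
    · rw [mul_assoc, hLmul]; linarith
    · have h1 : (2 * h + 1 : ℝ) ^ 2 ≤ 18 * Y := by
        nlinarith [Nat.cast_nonneg (α := ℝ) h]
      nlinarith [mul_nonneg (show 0 ≤ Y by linarith) (show 0 ≤ L by linarith)]
  · have h1 : 0 < S.card := by
      have : (0 : ℝ) < S.card := lt_of_lt_of_le (by positivity) hScard
      exact_mod_cast this
    obtain ⟨p, hp⟩ := Finset.card_pos.1 h1
    exact ⟨p, Finset.mem_filter.1 hp⟩
end

section
/- There exists an absolute constant C > 0 such that for each ε ∈ (0, 1/2) and each η > 0 there is a threshold N₁(ε, η) with the following property. Let N > N₁(ε, η) be an integer, let y be a real number with (4C·log N)^{1/(2ε)} ≤ y ≤ N, and let 𝒫 be the set of ALL primes in [y, 2y]; assume |𝒫| ≥ C·y^{1−2ε}·log N / log y. For each prime p ∈ 𝒫, let R_p ⊆ ℤ/pℤ be an arithmetic progression of length at most p^{1/2−ε} + 1, and let A be the set of all integers n ∈ {0, 1, …, N} such that for every p ∈ 𝒫 the residue of n mod p lies in R_p. Then A is an arithmetic progression of integers of length at most (1 + η)·y^{1/2−ε}. -/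
section PrimesInShortIntervals

open MeasureTheory FourierTransform

/-- The compactly supported continuous function `1 - |x| + sin (2π|x|) / (2π)` on `[-1, 1]`. -/
noncomputable def selbergWeight (x : ℝ) : ℝ :=
  if |x| ≤ 1 then 1 - |x| + Real.sin (2 * Real.pi * |x|) / (2 * Real.pi) else 0

/-- The cosine transform of `selbergWeight`: the function
`sin² (π t) / ((π t)² (1 - t²))`, which is nonpositive outside `[-1, 1]`. -/
noncomputable def selbergMinorant (t : ℝ) : ℝ :=
  2 * ∫ x in (0 : ℝ)..1, selbergWeight x * Real.cos (2 * Real.pi * t * x)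

theorem continuous_selbergWeight : Continuous selbergWeight := by
  unfold selbergWeight
  refine Continuous.if_le (by fun_prop) (by fun_prop) (by fun_prop) (by fun_prop) ?_
  intro x hx
  rw [hx]; simp

theorem selbergWeight_neg (x : ℝ) : selbergWeight (-x) = selbergWeight x := by
  simp [selbergWeight]

theorem selbergWeight_zero : selbergWeight 0 = 1 := by simp [selbergWeight]

theorem selbergWeight_of_one_lt {x : ℝ} (hx : 1 < |x|) : selbergWeight x = 0 := by
  simp [selbergWeight, not_le.2 hx]

theorem selbergWeight_of_mem_Icc {x : ℝ} (h0 : 0 ≤ x) (h1 : x ≤ 1) :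
    selbergWeight x = 1 - x + Real.sin (2 * Real.pi * x) / (2 * Real.pi) := by
  simp [selbergWeight, abs_of_nonneg h0, h1]

theorem abs_selbergWeight_le (x : ℝ) : |selbergWeight x| ≤ 2 := by
  unfold selbergWeight
  split_ifs with h
  · have h1 : |Real.sin (2 * Real.pi * |x|) / (2 * Real.pi)| ≤ 1 := by
      rw [abs_div, abs_of_pos Real.two_pi_pos, div_le_one Real.two_pi_pos]
      have := Real.abs_sin_le_one (2 * Real.pi * |x|)
      linarith [Real.pi_gt_three]
    have h2 := abs_le.1 h1
    have h3 := abs_nonneg x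
    rw [abs_le]
    constructor <;> linarith
  · simp

theorem integrable_selbergWeight : Integrable selbergWeight := by
  refine continuous_selbergWeight.integrable_of_hasCompactSupport ?_
  refine HasCompactSupport.intro (isCompact_Icc (a := (-1 : ℝ)) (b := 1)) ?_
  intro x hx
  apply selbergWeight_of_one_lt
  by_contra! h
  exact hx (abs_le.1 h)

theorem fourier_selbergWeight (t : ℝ) :
    𝓕 (fun x => (selbergWeight x : ℂ)) t = (selbergMinorant t : ℂ) := by
  rw [Real.fourier_real_eq_integral_exp_smul]
  set f : ℝ → ℂ := fun x =>
    Complex.exp (↑(-2 * Real.pi * x * t) * Complex.I) • (selbergWeight x : ℂ) with hf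
  have hfc : Continuous f := by
    have := continuous_selbergWeight
    fun_prop
  have h1 : ∫ x, f x = ∫ x in (-1 : ℝ)..1, f x := by
    rw [intervalIntegral.integral_of_le (by norm_num), ← integral_Icc_eq_integral_Ioc,
      setIntegral_eq_integral_of_forall_compl_eq_zero]
    intro x hx
    have : selbergWeight x = 0 := by
      apply selbergWeight_of_one_lt
      by_contra! h
      exact hx (abs_le.1 h)
    simp [hf, this]
  have h2 : ∫ x in (-1 : ℝ)..0, f x = ∫ x in (0 : ℝ)..1, f (-x) := by
    rw [intervalIntegral.integral_comp_neg]; simp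
  have h3 : IntervalIntegrable (fun x => f (-x)) volume 0 1 :=
    (hfc.comp continuous_neg).intervalIntegrable 0 1
  rw [h1, ← intervalIntegral.integral_add_adjacent_intervals
    (hfc.intervalIntegrable (-1) 0) (hfc.intervalIntegrable 0 1), h2,
    ← intervalIntegral.integral_add h3 (hfc.intervalIntegrable 0 1)]
  unfold selbergMinorant
  rw [Complex.ofReal_mul, ← intervalIntegral.integral_ofReal,
    ← intervalIntegral.integral_const_mul]
  apply intervalIntegral.integral_congr
  intro x _
  simp only [hf, selbergWeight_neg, smul_eq_mul]
  push_cast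
  rw [Complex.cos]
  have e1 : -2 * (Real.pi : ℂ) * -x * t * Complex.I = 2 * Real.pi * t * x * Complex.I := by ring
  have e2 : -2 * (Real.pi : ℂ) * x * t * Complex.I = -(2 * Real.pi * t * x) * Complex.I := by ring
  rw [e1, e2]
  ring

theorem continuous_selbergMinorant : Continuous selbergMinorant := by
  unfold selbergMinorant
  refine continuous_const.mul ?_
  apply intervalIntegral.continuous_parametric_intervalIntegral_of_continuous'
  have := continuous_selbergWeight
  fun_prop

theorem abs_selbergMinorant_le (t : ℝ) : |selbergMinorant t| ≤ 4 := by
  have := intervalIntegral.norm_integral_le_of_norm_le_const (a := (0 : ℝ)) (b := 1) (C := 2)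
    (f := fun x => selbergWeight x * Real.cos (2 * Real.pi * t * x)) (by
      intro x _
      rw [Real.norm_eq_abs, abs_mul]
      have h1 := abs_selbergWeight_le x
      have h2 := Real.abs_cos_le_one (2 * Real.pi * t * x)
      have h3 := abs_nonneg (selbergWeight x)
      nlinarith [abs_nonneg (Real.cos (2 * Real.pi * t * x))])
  rw [Real.norm_eq_abs] at this
  unfold selbergMinorant
  rw [abs_mul, abs_two]
  norm_num at this
  linarith

theorem selbergMinorant_eq {t : ℝ} (h0 : t ≠ 0) (h1 : 1 + t ≠ 0) (h2 : 1 - t ≠ 0) :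
    selbergMinorant t = Real.sin (Real.pi * t) ^ 2 / ((Real.pi * t) ^ 2 * ((1 + t) * (1 - t))) := by
  have hpi := Real.pi_ne_zero
  set F : ℝ → ℝ := fun x => (1 - x) * (Real.sin (2 * Real.pi * t * x) / (2 * Real.pi * t))
    - Real.cos (2 * Real.pi * t * x) / (2 * Real.pi * t) ^ 2
    + 1 / (2 * Real.pi) * (-Real.cos (2 * Real.pi * (1 + t) * x) / (2 * (2 * Real.pi * (1 + t)))
      - Real.cos (2 * Real.pi * (1 - t) * x) / (2 * (2 * Real.pi * (1 - t)))) with hF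
  have hderiv : ∀ x ∈ Set.uIcc (0 : ℝ) 1, HasDerivAt F
      ((1 - x + Real.sin (2 * Real.pi * x) / (2 * Real.pi)) * Real.cos (2 * Real.pi * t * x)) x := by
    intro x _
    have hl : ∀ c : ℝ, HasDerivAt (fun x : ℝ => c * x) c x := fun c => by
      simpa using (hasDerivAt_id x).const_mul c
    have hs := (hl (2 * Real.pi * t)).sin
    have hc := (hl (2 * Real.pi * t)).cos
    have hc1 := (hl (2 * Real.pi * (1 + t))).cos
    have hc2 := (hl (2 * Real.pi * (1 - t))).cos
    have key := ((((hasDerivAt_id x).const_sub 1).mul (hs.div_const (2 * Real.pi * t))).sub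
      (hc.div_const ((2 * Real.pi * t) ^ 2))).add
      (((hc1.neg.div_const (2 * (2 * Real.pi * (1 + t)))).sub
        (hc2.div_const (2 * (2 * Real.pi * (1 - t))))).const_mul (1 / (2 * Real.pi)))
    refine key.congr_deriv ?_
    have es : Real.sin (2 * Real.pi * (1 + t) * x) = Real.sin (2 * Real.pi * x)
        * Real.cos (2 * Real.pi * t * x) + Real.cos (2 * Real.pi * x)
        * Real.sin (2 * Real.pi * t * x) := by rw [← Real.sin_add]; congr 1; ring
    have ed : Real.sin (2 * Real.pi * (1 - t) * x) = Real.sin (2 * Real.pi * x)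
        * Real.cos (2 * Real.pi * t * x) - Real.cos (2 * Real.pi * x)
        * Real.sin (2 * Real.pi * t * x) := by rw [← Real.sin_sub]; congr 1; ring
    rw [es, ed]
    simp only [id]
    field_simp
    ring
  have hint := intervalIntegral.integral_eq_sub_of_hasDerivAt hderiv
    (Continuous.intervalIntegrable (by fun_prop) _ _)
  have hcongr : ∫ x in (0 : ℝ)..1, selbergWeight x * Real.cos (2 * Real.pi * t * x) = F 1 - F 0 := by
    rw [← hint]
    apply intervalIntegral.integral_congr
    intro x hx
    rw [Set.uIcc_of_le zero_le_one] at hx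
    simp only [selbergWeight_of_mem_Icc hx.1 hx.2]
  unfold selbergMinorant
  rw [hcongr]
  have c1 : Real.cos (2 * Real.pi * (1 + t)) = Real.cos (2 * (Real.pi * t)) := by
    rw [← Real.cos_add_two_pi (2 * (Real.pi * t))]; congr 1; ring
  have c2 : Real.cos (2 * Real.pi * (1 - t)) = Real.cos (2 * (Real.pi * t)) := by
    rw [← Real.cos_two_pi_sub (2 * (Real.pi * t))]; congr 1; ring
  have c3 : Real.cos (2 * Real.pi * t) = Real.cos (2 * (Real.pi * t)) := by congr 1; ring
  simp only [hF, mul_one, mul_zero, Real.cos_zero, Real.sin_zero, c1, c2, c3, Real.cos_two_mul,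
    Real.cos_sq']
  field_simp
  ring

theorem selbergMinorant_nonpos {t : ℝ} (ht : 1 < |t|) : selbergMinorant t ≤ 0 := by
  have h : 1 < t ^ 2 := by rw [← sq_abs]; nlinarith
  have h0 : t ≠ 0 := by rintro rfl; norm_num at h
  have h1 : 1 + t ≠ 0 := by intro h'; nlinarith
  have h2 : 1 - t ≠ 0 := by intro h'; nlinarith
  rw [selbergMinorant_eq h0 h1 h2]
  apply div_nonpos_of_nonneg_of_nonpos (sq_nonneg _)
  apply mul_nonpos_of_nonneg_of_nonpos (sq_nonneg _)
  nlinarith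

theorem abs_selbergMinorant_le_inv (t : ℝ) : |selbergMinorant t| ≤ 20 * (1 + t ^ 2)⁻¹ := by
  rw [← div_eq_mul_inv, le_div_iff₀ (by positivity)]
  rcases le_or_gt (t ^ 2) 4 with h | h
  · have := abs_selbergMinorant_le t
    nlinarith [abs_nonneg (selbergMinorant t)]
  · have h0 : t ≠ 0 := by rintro rfl; norm_num at h
    have h1 : 1 + t ≠ 0 := by intro h'; nlinarith
    have h2 : 1 - t ≠ 0 := by intro h'; nlinarith
    rw [selbergMinorant_eq h0 h1 h2, abs_div, abs_of_nonneg (sq_nonneg _), abs_mul,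
      abs_of_nonneg (sq_nonneg (Real.pi * t)), abs_of_nonpos (by nlinarith : (1 + t) * (1 - t) ≤ 0),
      div_mul_eq_mul_div, div_le_iff₀ (by
        have := Real.pi_pos
        apply mul_pos (by positivity); nlinarith)]
    have hs := Real.sin_sq_le_one (Real.pi * t)
    have hp : 1 ≤ Real.pi ^ 2 := by nlinarith [Real.pi_gt_three]
    have h3 : t ^ 2 * (t ^ 2 - 1) ≤ (Real.pi * t) ^ 2 * -((1 + t) * (1 - t)) := by
      have : 0 ≤ t ^ 2 * (t ^ 2 - 1) := mul_nonneg (sq_nonneg _) (by linarith)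
      nlinarith
    nlinarith

theorem integrable_selbergMinorant : Integrable selbergMinorant := by
  refine (integrable_inv_one_add_sq.const_mul 20).mono'
    continuous_selbergMinorant.aestronglyMeasurable ?_
  filter_upwards with t
  exact abs_selbergMinorant_le_inv t

theorem integral_selbergMinorant : ∫ t, selbergMinorant t = 1 := by
  have hF : 𝓕 (fun x => (selbergWeight x : ℂ)) = fun t => (selbergMinorant t : ℂ) :=
    funext fourier_selbergWeight
  have h := Continuous.fourierInv_fourier_eq (f := fun x => (selbergWeight x : ℂ))
    (Complex.continuous_ofReal.comp continuous_selbergWeight) integrable_selbergWeight.ofReal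
    (by rw [hF]; exact integrable_selbergMinorant.ofReal)
  have h0 := congrFun h 0
  rw [hF, Real.fourierInv_eq'] at h0
  simp only [inner_zero_right, mul_zero, Complex.ofReal_zero, zero_mul, Complex.exp_zero, one_smul,
    selbergWeight_zero] at h0
  rw [integral_complex_ofReal] at h0
  exact_mod_cast h0

open ArithmeticFunction in
theorem hasSum_vonMangoldt_mul_selbergMinorant {σ : ℝ} (hσ : 1 < σ) (T u : ℝ) :
    HasSum (fun n : ℕ => ((vonMangoldt n * (n : ℝ) ^ (-σ)
        * selbergMinorant (T * (Real.log n - u)) : ℝ) : ℂ))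
      (∫ x : ℝ, selbergWeight x * Complex.exp ((2 * Real.pi * T * u * x : ℝ) * Complex.I)
        * LSeries (fun n => (vonMangoldt n : ℂ))
            (σ + (2 * Real.pi * T * x : ℝ) * Complex.I)) := by
  set F : ℕ → ℝ → ℂ := fun n x =>
    selbergWeight x * Complex.exp ((2 * Real.pi * T * u * x : ℝ) * Complex.I)
      * LSeries.term (fun n => (vonMangoldt n : ℂ)) (σ + (2 * Real.pi * T * x : ℝ) * Complex.I) n
    with hF
  have hnorm : ∀ n x, ‖F n x‖ =
      |selbergWeight x| * ‖LSeries.term (fun n => (vonMangoldt n : ℂ)) σ n‖ := by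
    intro n x
    simp only [hF, norm_mul, Complex.norm_exp_ofReal_mul_I, mul_one, Complex.norm_real,
      Real.norm_eq_abs, LSeries.norm_term_eq]
    simp
  have hcont : ∀ n, Continuous (F n) := by
    intro n
    have hw := continuous_selbergWeight
    rcases Nat.eq_zero_or_pos n with rfl | hn
    · simp only [hF, LSeries.term_zero, mul_zero]; fun_prop
    · simp only [hF, LSeries.term_of_ne_zero hn.ne']
      have hn' : (n : ℂ) ≠ 0 := by exact_mod_cast hn.ne'
      have : Continuous fun x : ℝ => (n : ℂ) ^ ((σ : ℂ) + (2 * Real.pi * T * x : ℝ) * Complex.I) :=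
        Continuous.const_cpow (by fun_prop) (Or.inl hn')
      refine Continuous.mul (by fun_prop) (Continuous.div (by fun_prop) this fun x => ?_)
      simp [Complex.cpow_eq_zero_iff, hn']
  have hint : ∀ n, Integrable (F n) := by
    intro n
    refine (integrable_selbergWeight.abs.mul_const
      ‖LSeries.term (fun n => (vonMangoldt n : ℂ)) σ n‖).mono'
      (hcont n).aestronglyMeasurable ?_
    filter_upwards with x using (hnorm n x).le
  have hsum : Summable fun n => ∫ x, ‖F n x‖ := by
    simp_rw [hnorm, integral_mul_const]
    exact (LSeriesSummable_vonMangoldt (s := σ) (by simpa using hσ)).norm.mul_left _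
  have key := hasSum_integral_of_summable_integral_norm hint hsum
  have hterm : (fun n : ℕ => ((vonMangoldt n * (n : ℝ) ^ (-σ)
      * selbergMinorant (T * (Real.log n - u)) : ℝ) : ℂ)) = fun n => ∫ x, F n x := by
    funext n
    rcases Nat.eq_zero_or_pos n with rfl | hn
    · simp [hF]
    · have hn0 : (0 : ℝ) < n := by exact_mod_cast hn
      have hn' : (n : ℂ) ≠ 0 := by exact_mod_cast hn.ne'
      rw [Complex.ofReal_mul, ← fourier_selbergWeight, Real.fourier_real_eq_integral_exp_smul,
        ← integral_const_mul]
      congr 1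
      funext x
      simp only [hF, LSeries.term_of_ne_zero hn.ne', smul_eq_mul]
      rw [Complex.cpow_def_of_ne_zero hn', Real.rpow_def_of_pos hn0,
        div_eq_mul_inv, ← Complex.exp_neg]
      push_cast
      have e : Complex.exp (2 * Real.pi * T * u * x * Complex.I)
          * Complex.exp (-(Complex.log n * (σ + 2 * Real.pi * T * x * Complex.I)))
          = Complex.exp (Complex.log n * -σ)
            * Complex.exp (-2 * Real.pi * x * (T * (Complex.log n - u)) * Complex.I) := by
        rw [← Complex.exp_add, ← Complex.exp_add]; congr 1; ring
      linear_combination (-(vonMangoldt n : ℂ) * selbergWeight x) * e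
  rw [hterm]
  simp only [hF, tsum_mul_left] at key
  exact key

theorem integral_selbergWeight_div {σ : ℝ} (hσ : 1 < σ) (T u : ℝ) :
    ∫ x : ℝ, selbergWeight x * Complex.exp ((2 * Real.pi * T * u * x : ℝ) * Complex.I)
        * (1 / (σ + (2 * Real.pi * T * x : ℝ) * Complex.I - 1))
      = ((∫ t in Set.Ioi (0 : ℝ), Real.exp (-((σ - 1) * t)) * selbergMinorant (T * (t - u)) : ℝ)
        : ℂ) := by
  set f : ℝ → ℝ → ℂ := fun x t =>
    selbergWeight x * Complex.exp ((2 * Real.pi * T * u * x : ℝ) * Complex.I)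
      * Complex.exp (-(σ + (2 * Real.pi * T * x : ℝ) * Complex.I - 1) * t) with hf
  have hw := continuous_selbergWeight
  have hfi : Integrable (Function.uncurry f)
      ((volume : Measure ℝ).prod (volume.restrict (Set.Ioi 0))) := by
    have h1 : Integrable (fun t : ℝ => Real.exp (-(σ - 1) * t)) (volume.restrict (Set.Ioi 0)) :=
      exp_neg_integrableOn_Ioi 0 (by linarith)
    refine (integrable_selbergWeight.abs.mul_prod h1).mono' ?_ ?_
    · apply Continuous.aestronglyMeasurable
      simp only [hf, Function.uncurry_def]
      fun_prop
    · filter_upwards with z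
      simp only [hf, Function.uncurry_def, norm_mul, Complex.norm_exp_ofReal_mul_I, mul_one,
        Complex.norm_real, Real.norm_eq_abs]
      rw [Complex.norm_exp]
      simp
  have hswap := integral_integral_swap hfi
  have hleft : ∀ x : ℝ, ∫ t in Set.Ioi (0 : ℝ), f x t =
      selbergWeight x * Complex.exp ((2 * Real.pi * T * u * x : ℝ) * Complex.I)
        * (1 / (σ + (2 * Real.pi * T * x : ℝ) * Complex.I - 1)) := by
    intro x
    simp only [hf]
    rw [integral_const_mul, integral_exp_mul_complex_Ioi (by simp; linarith)]
    congr 1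
    simp only [Complex.ofReal_zero, mul_zero, Complex.exp_zero, neg_div_neg_eq]
  have hright : ∀ t : ℝ, ∫ x : ℝ, f x t =
      ((Real.exp (-((σ - 1) * t)) * selbergMinorant (T * (t - u)) : ℝ) : ℂ) := by
    intro t
    rw [Complex.ofReal_mul, ← fourier_selbergWeight, Real.fourier_real_eq_integral_exp_smul,
        ← integral_const_mul]
    congr 1
    funext x
    simp only [hf, smul_eq_mul]
    push_cast
    have e : Complex.exp (2 * Real.pi * T * u * x * Complex.I)
          * Complex.exp (-(σ + 2 * Real.pi * T * x * Complex.I - 1) * t)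
          = Complex.exp (-((σ - 1) * t))
            * Complex.exp (-2 * Real.pi * x * (T * (t - u)) * Complex.I) := by
      rw [← Complex.exp_add, ← Complex.exp_add]; congr 1; ring
    linear_combination (selbergWeight x : ℂ) * e
  simp_rw [hleft, hright] at hswap
  rw [hswap, integral_complex_ofReal]

open ArithmeticFunction Filter Topology in
theorem exists_vonMangoldt_continuous_remainder : ∃ G : ℂ → ℂ,
    ContinuousOn G {s | 1 ≤ s.re} ∧ ∀ s : ℂ, 1 < s.re →
      LSeries (fun n => (vonMangoldt n : ℂ)) s = G s + 1 / (s - 1) := by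
  refine ⟨vonMangoldt.LFunctionResidueClassAux (1 : ZMod 1),
    vonMangoldt.continuousOn_LFunctionResidueClassAux 1, fun s hs => ?_⟩
  have h := vonMangoldt.eqOn_LFunctionResidueClassAux (q := 1) (a := 1) isUnit_one hs
  have hr : (fun n => ((vonMangoldt.residueClass (1 : ZMod 1) n : ℝ) : ℂ))
      = fun n => (vonMangoldt n : ℂ) := by
    funext n
    have : ((n : ZMod 1)) = 1 := Subsingleton.elim _ _
    simp [vonMangoldt.residueClass, this]
  rw [h, hr]
  simp

/-- The integers `n` with `|T * (log n - u)| ≤ 1` all lie in this interval. -/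
noncomputable def logWindow (T u : ℝ) : Finset ℕ :=
  Finset.Icc ⌈Real.exp (u - 1 / T)⌉₊ ⌊Real.exp (u + 1 / T)⌋₊

theorem mem_logWindow {T u : ℝ} {n : ℕ} :
    n ∈ logWindow T u ↔ Real.exp (u - 1 / T) ≤ n ∧ (n : ℝ) ≤ Real.exp (u + 1 / T) := by
  rw [logWindow, Finset.mem_Icc, Nat.ceil_le, Nat.le_floor_iff (Real.exp_pos _).le]

theorem one_lt_abs_of_notMem_logWindow {T u : ℝ} (hT : 0 < T) {n : ℕ} (hn : 0 < n)
    (h : n ∉ logWindow T u) : 1 < |T * (Real.log n - u)| := by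
  by_contra! hle
  have hn0 : (0 : ℝ) < n := by exact_mod_cast hn
  rw [abs_mul, abs_of_pos hT, mul_comm, ← le_div_iff₀ hT, abs_le] at hle
  refine h (mem_logWindow.2 ⟨?_, ?_⟩)
  · rw [← Real.le_log_iff_exp_le hn0]; linarith
  · rw [← Real.log_le_iff_le_exp hn0]; linarith

open ArithmeticFunction in
theorem re_integral_le_sum_logWindow {G : ℂ → ℂ} (hGc : ContinuousOn G {s | 1 ≤ s.re})
    (hG : ∀ s : ℂ, 1 < s.re → LSeries (fun n => (vonMangoldt n : ℂ)) s = G s + 1 / (s - 1))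
    {σ T : ℝ} (hσ : 1 < σ) (hT : 0 < T) (u : ℝ) :
    (∫ x : ℝ, selbergWeight x * Complex.exp ((2 * Real.pi * T * u * x : ℝ) * Complex.I)
        * G (σ + (2 * Real.pi * T * x : ℝ) * Complex.I)).re
      + ∫ t in Set.Ioi (0 : ℝ), Real.exp (-((σ - 1) * t)) * selbergMinorant (T * (t - u))
      ≤ 4 * ∑ n ∈ logWindow T u, vonMangoldt n * (n : ℝ) ^ (-σ) := by
  have hs := hasSum_vonMangoldt_mul_selbergMinorant hσ T u
  have hw := continuous_selbergWeight
  have hre : ∀ x : ℝ, ((σ : ℂ) + (2 * Real.pi * T * x : ℝ) * Complex.I).re = σ := by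
    intro x; simp
  have hcs : ∀ g : ℝ → ℂ, Continuous g → Integrable fun x : ℝ =>
      selbergWeight x * Complex.exp ((2 * Real.pi * T * u * x : ℝ) * Complex.I) * g x := by
    intro g hg
    refine Continuous.integrable_of_hasCompactSupport (by fun_prop) ?_
    refine HasCompactSupport.intro (isCompact_Icc (a := (-1 : ℝ)) (b := 1)) fun x hx => ?_
    rw [selbergWeight_of_one_lt (by by_contra! h; exact hx (abs_le.1 h))]
    simp
  have hi1 := hcs (fun x => G (σ + (2 * Real.pi * T * x : ℝ) * Complex.I))
    (hGc.comp_continuous (by fun_prop) fun x => by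
      rw [Set.mem_ofPred_eq, hre]; exact hσ.le)
  have hi2 := hcs (fun x => 1 / (σ + (2 * Real.pi * T * x : ℝ) * Complex.I - 1))
    (Continuous.div (by fun_prop) (by fun_prop) fun x h => by
      have := congrArg Complex.re h
      rw [Complex.sub_re, hre, Complex.one_re, Complex.zero_re] at this
      linarith)
  have heq : (∫ x : ℝ, selbergWeight x * Complex.exp ((2 * Real.pi * T * u * x : ℝ) * Complex.I)
        * LSeries (fun n => (vonMangoldt n : ℂ)) (σ + (2 * Real.pi * T * x : ℝ) * Complex.I))
      = (∫ x : ℝ, selbergWeight x * Complex.exp ((2 * Real.pi * T * u * x : ℝ) * Complex.I)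
        * G (σ + (2 * Real.pi * T * x : ℝ) * Complex.I))
        + ((∫ t in Set.Ioi (0 : ℝ), Real.exp (-((σ - 1) * t)) * selbergMinorant (T * (t - u)) : ℝ)
        : ℂ) := by
    rw [← integral_selbergWeight_div hσ, ← integral_add hi1 hi2]
    congr 1
    funext x
    rw [hG _ (by rw [hre]; exact hσ)]
    ring
  rw [heq] at hs
  have hsr := ((Complex.hasSum_iff _ _).1 hs).1
  simp only [Complex.ofReal_re, Complex.add_re] at hsr
  have hfin : HasSum (fun n => if n ∈ logWindow T u then
      4 * (vonMangoldt n * (n : ℝ) ^ (-σ)) else 0)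
      (∑ n ∈ logWindow T u, if n ∈ logWindow T u then
        4 * (vonMangoldt n * (n : ℝ) ^ (-σ)) else 0) :=
    hasSum_sum_of_ne_finset_zero fun n hn => by simp [hn]
  have hle := hasSum_le (fun n => ?_) hsr hfin
  · rw [Finset.mul_sum]
    refine hle.trans_eq (Finset.sum_congr rfl fun n hn => by simp [hn])
  · have ha : 0 ≤ vonMangoldt n * (n : ℝ) ^ (-σ) :=
      mul_nonneg vonMangoldt_nonneg (Real.rpow_nonneg (Nat.cast_nonneg n) _)
    split_ifs with h
    · have := le_of_abs_le (abs_selbergMinorant_le (T * (Real.log n - u)))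
      nlinarith
    · rcases Nat.eq_zero_or_pos n with rfl | hn
      · simp
      · exact mul_nonpos_of_nonneg_of_nonpos ha
          (selbergMinorant_nonpos (one_lt_abs_of_notMem_logWindow hT hn h))

open ArithmeticFunction Filter Topology in
theorem re_integral_le_sum_logWindow_one {G : ℂ → ℂ} (hGc : ContinuousOn G {s | 1 ≤ s.re})
    (hG : ∀ s : ℂ, 1 < s.re → LSeries (fun n => (vonMangoldt n : ℂ)) s = G s + 1 / (s - 1))
    {T : ℝ} (hT : 0 < T) (u : ℝ) :
    (∫ x : ℝ, selbergWeight x * Complex.exp ((2 * Real.pi * T * u * x : ℝ) * Complex.I)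
        * G (1 + (2 * Real.pi * T * x : ℝ) * Complex.I)).re
      + ∫ t in Set.Ioi (0 : ℝ), selbergMinorant (T * (t - u))
      ≤ 4 * ∑ n ∈ logWindow T u, vonMangoldt n / n := by
  have hw := continuous_selbergWeight
  have hre : ∀ σ x : ℝ, ((σ : ℂ) + (2 * Real.pi * T * x : ℝ) * Complex.I).re = σ := by
    intro σ x; simp
  have hlim : ∀ᶠ σ : ℝ in 𝓝[>] 1, σ ∈ Set.Ioc (1 : ℝ) 2 := Ioc_mem_nhdsGT (by norm_num)
  obtain ⟨M, hM⟩ : ∃ M : ℝ, ∀ σ ∈ Set.Icc (1 : ℝ) 2, ∀ x ∈ Set.Icc (-1 : ℝ) 1,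
      ‖G (σ + (2 * Real.pi * T * x : ℝ) * Complex.I)‖ ≤ M := by
    have hc : ContinuousOn (fun z : ℝ × ℝ => G (z.1 + (2 * Real.pi * T * z.2 : ℝ) * Complex.I))
        (Set.Icc (1 : ℝ) 2 ×ˢ Set.Icc (-1 : ℝ) 1) := by
      refine hGc.comp (Continuous.continuousOn (by fun_prop)) fun z hz => ?_
      rw [Set.mem_ofPred_eq, hre]
      exact hz.1.1
    obtain ⟨M, hM⟩ := (isCompact_Icc.prod isCompact_Icc).exists_bound_of_continuousOn hc
    exact ⟨M, fun σ hσ x hx => hM (σ, x) ⟨hσ, hx⟩⟩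
  have h1 : Tendsto (fun σ : ℝ => ∫ x : ℝ, selbergWeight x
        * Complex.exp ((2 * Real.pi * T * u * x : ℝ) * Complex.I)
        * G (σ + (2 * Real.pi * T * x : ℝ) * Complex.I)) (𝓝[>] 1)
      (𝓝 (∫ x : ℝ, selbergWeight x * Complex.exp ((2 * Real.pi * T * u * x : ℝ) * Complex.I)
        * G (1 + (2 * Real.pi * T * x : ℝ) * Complex.I))) := by
    refine tendsto_integral_filter_of_dominated_convergence (fun x => |selbergWeight x| * M)
      ?_ ?_ (integrable_selbergWeight.abs.mul_const M) ?_
    · filter_upwards [hlim] with σ hσ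
      apply Continuous.aestronglyMeasurable
      refine Continuous.mul (by fun_prop) (hGc.comp_continuous (by fun_prop) fun x => ?_)
      rw [Set.mem_ofPred_eq, hre]
      exact hσ.1.le
    · filter_upwards [hlim] with σ hσ
      filter_upwards with x
      rw [norm_mul, norm_mul, Complex.norm_exp_ofReal_mul_I, mul_one, Complex.norm_real,
        Real.norm_eq_abs]
      by_cases hx : |x| ≤ 1
      · exact mul_le_mul_of_nonneg_left (hM σ ⟨hσ.1.le, hσ.2⟩ x (abs_le.1 hx)) (abs_nonneg _)
      · rw [selbergWeight_of_one_lt (not_le.1 hx)]; simp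
    · filter_upwards with x
      refine Tendsto.const_mul _ ?_
      have hmem : (1 : ℂ) + (2 * Real.pi * T * x : ℝ) * Complex.I ∈ {s : ℂ | 1 ≤ s.re} := by
        simp
      refine (hGc _ hmem).tendsto.comp (tendsto_nhdsWithin_iff.2 ⟨?_, ?_⟩)
      · have : Continuous fun σ : ℝ => (σ : ℂ) + (2 * Real.pi * T * x : ℝ) * Complex.I := by
          fun_prop
        have := (this.tendsto 1).mono_left (nhdsWithin_le_nhds (s := Set.Ioi 1))
        simpa using this
      · filter_upwards [hlim] with σ hσ
        exact hσ.1.le.trans_eq (hre σ x).symm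
  have hgi : Integrable (fun t => selbergMinorant (T * (t - u))) :=
    (integrable_selbergMinorant.comp_mul_left' hT.ne').comp_sub_right u
  have h2 : Tendsto (fun σ : ℝ => ∫ t in Set.Ioi (0 : ℝ),
        Real.exp (-((σ - 1) * t)) * selbergMinorant (T * (t - u))) (𝓝[>] 1)
      (𝓝 (∫ t in Set.Ioi (0 : ℝ), selbergMinorant (T * (t - u)))) := by
    have hφ := continuous_selbergMinorant
    refine tendsto_integral_filter_of_dominated_convergence
      (fun t => |selbergMinorant (T * (t - u))|) ?_ ?_ hgi.abs.integrableOn ?_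
    · filter_upwards with σ
      exact Continuous.aestronglyMeasurable (by fun_prop)
    · filter_upwards [hlim] with σ hσ
      filter_upwards [ae_restrict_mem measurableSet_Ioi] with t ht
      rw [Real.norm_eq_abs, abs_mul, Real.abs_exp]
      refine mul_le_of_le_one_left (abs_nonneg _) (Real.exp_le_one_iff.2 ?_)
      have : 0 ≤ (σ - 1) * t := mul_nonneg (by linarith [hσ.1]) (le_of_lt ht)
      linarith
    · filter_upwards with t
      have : Continuous fun σ : ℝ =>
          Real.exp (-((σ - 1) * t)) * selbergMinorant (T * (t - u)) := by fun_prop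
      have := (this.tendsto 1).mono_left (nhdsWithin_le_nhds (s := Set.Ioi 1))
      simpa using this
  have h3 : Tendsto (fun σ : ℝ => 4 * ∑ n ∈ logWindow T u, vonMangoldt n * (n : ℝ) ^ (-σ))
      (𝓝[>] 1) (𝓝 (4 * ∑ n ∈ logWindow T u, vonMangoldt n / n)) := by
    refine Tendsto.const_mul _ (tendsto_finsetSum _ fun n hn => ?_)
    rw [div_eq_mul_inv, ← Real.rpow_neg_one]
    refine Tendsto.const_mul _ ?_
    have hn0 : (n : ℝ) ≠ 0 := ((Real.exp_pos _).trans_le (mem_logWindow.1 hn).1).ne'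
    have : Continuous fun σ : ℝ => (n : ℝ) ^ (-σ) :=
      continuous_const.rpow (by fun_prop) fun _ => Or.inl hn0
    exact (this.tendsto 1).mono_left nhdsWithin_le_nhds
  refine le_of_tendsto_of_tendsto
    (((Complex.continuous_re.tendsto _).comp h1).add h2) h3 ?_
  filter_upwards [hlim] with σ hσ
  exact re_integral_le_sum_logWindow hGc hG hσ.1 hT u

open ArithmeticFunction Filter Topology in
/-- Logarithmic windows of fixed length `2 / T` carry a positive proportion of the mass of the
von Mangoldt function. -/
theorem eventually_le_sum_logWindow {T : ℝ} (hT : 0 < T) :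
    ∀ᶠ u : ℝ in atTop, 1 / (8 * T) ≤ ∑ n ∈ logWindow T u, vonMangoldt n / n := by
  obtain ⟨G, hGc, hG⟩ := exists_vonMangoldt_continuous_remainder
  have h1 : Tendsto (fun u : ℝ => ∫ x : ℝ, selbergWeight x
        * Complex.exp ((2 * Real.pi * T * u * x : ℝ) * Complex.I)
        * G (1 + (2 * Real.pi * T * x : ℝ) * Complex.I)) atTop (𝓝 0) := by
    have hrl := Real.tendsto_integral_exp_smul_cocompact
      (fun x : ℝ => selbergWeight x * G (1 + (2 * Real.pi * T * x : ℝ) * Complex.I))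
    have hu : Tendsto (fun u : ℝ => -(T * u)) atTop (cocompact ℝ) :=
      (tendsto_neg_atTop_atBot.comp (tendsto_id.const_mul_atTop hT)).mono_right
        atBot_le_cocompact
    refine (hrl.comp hu).congr fun u => ?_
    simp only [Function.comp]
    congr 1
    funext x
    rw [Circle.smul_def, Real.fourierChar_apply, smul_eq_mul]
    have : (2 * Real.pi * -(x * -(T * u)) : ℝ) = 2 * Real.pi * T * u * x := by ring
    rw [this]
    ring
  have h2 : Tendsto (fun u : ℝ => ∫ t in Set.Ioi (0 : ℝ), selbergMinorant (T * (t - u)))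
      atTop (𝓝 (1 / T)) := by
    have hgi : Integrable (fun t => selbergMinorant (T * t)) :=
      integrable_selbergMinorant.comp_mul_left' hT.ne'
    have htot : ∫ t, selbergMinorant (T * t) = 1 / T := by
      rw [Measure.integral_comp_mul_left, integral_selbergMinorant, abs_of_pos (inv_pos.2 hT)]
      simp
    have hlim : Tendsto (fun u : ℝ => ∫ t in Set.Ioi (-u), selbergMinorant (T * t)) atTop
        (𝓝 (∫ t, selbergMinorant (T * t))) :=
      (aecover_Ioi tendsto_neg_atTop_atBot).integral_tendsto_of_countably_generated hgi
    rw [← htot]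
    refine hlim.congr fun u => ?_
    have := (measurePreserving_sub_right volume u).setIntegral_preimage_emb
      (MeasurableEquiv.subRight u).measurableEmbedding (fun t => selbergMinorant (T * t))
      (Set.Ioi (-u))
    rw [← this, Set.preimage_sub_const_Ioi, neg_add_cancel]
  have h3 := ((Complex.continuous_re.tendsto _).comp h1).add h2
  have hpos : 1 / (2 * T) < Complex.re 0 + 1 / T := by
    rw [Complex.zero_re, zero_add]
    exact one_div_lt_one_div_of_lt hT (by linarith)
  filter_upwards [h3.eventually (lt_mem_nhds hpos)] with u hu
  have h4 := re_integral_le_sum_logWindow_one hGc hG hT u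
  simp only [Function.comp] at hu
  have h5 : 1 / (2 * T) = 4 * (1 / (8 * T)) := by field_simp; norm_num
  linarith

open ArithmeticFunction Filter Topology in
/-- For fixed `δ > 0` and `θ < 1`, the interval `[y, (1 + δ) y]` contains more than `y ^ θ` primes
once `y` is large. -/
theorem eventually_rpow_lt_card_primes {δ θ : ℝ} (hδ : 0 < δ) (hθ : θ < 1) :
    ∀ᶠ y : ℝ in atTop,
      y ^ θ < ((Finset.Icc ⌈y⌉₊ ⌊(1 + δ) * y⌋₊).filter Nat.Prime).card := by
  have hlog : 0 < Real.log (1 + δ) := Real.log_pos (by linarith)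
  set T : ℝ := 2 / Real.log (1 + δ) with hT
  have hT0 : 0 < T := by positivity
  set c : ℝ := 1 / (8 * T) with hc
  have hc0 : 0 < c := by positivity
  set θ' : ℝ := max θ (1 / 2) with hθ'
  have hθ'1 : θ' < 1 := max_lt hθ (by norm_num)
  have hθ'0 : 0 < θ' := lt_max_of_lt_right (by norm_num)
  set κ : ℝ := (1 - θ') / 2 with hκ
  have hκ0 : 0 < κ := by rw [hκ]; linarith
  have hX : Tendsto (fun y : ℝ => (1 + δ) * y) atTop atTop :=
    tendsto_id.const_mul_atTop (by linarith)
  have hu : Tendsto (fun y : ℝ => Real.log y + 1 / T) atTop atTop :=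
    tendsto_atTop_add_const_right _ _ Real.tendsto_log_atTop
  filter_upwards [eventually_ge_atTop 1, hu.eventually (eventually_le_sum_logWindow hT0),
    ((tendsto_rpow_atTop hκ0).comp hX).eventually (eventually_gt_atTop (3 * (1 + δ) / (c * κ)))]
    with y hy1 hsum hlarge
  have hy0 : 0 < y := by linarith
  set X : ℝ := (1 + δ) * y with hXdef
  have hyX : y ≤ X := by rw [hXdef]; nlinarith
  have hX1 : 1 ≤ X := hy1.trans hyX
  have hX0 : 0 < X := by linarith
  have hlogX : 0 ≤ Real.log X := Real.log_nonneg hX1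
  have hwin : logWindow T (Real.log y + 1 / T) = Finset.Icc ⌈y⌉₊ ⌊X⌋₊ := by
    have e1 : Real.log y + 1 / T - 1 / T = Real.log y := by ring
    have e2 : Real.log y + 1 / T + 1 / T = Real.log X := by
      rw [hXdef, Real.log_mul (by linarith) hy0.ne', hT]
      field_simp
      ring
    rw [logWindow, e1, e2, Real.exp_log hy0, Real.exp_log hX0]
  rw [hwin] at hsum
  set S := Finset.Icc ⌈y⌉₊ ⌊X⌋₊ with hS
  by_contra! hcard
  have h1 : c * y ≤ ∑ n ∈ S, vonMangoldt n := by
    refine (mul_le_mul_of_nonneg_right hsum hy0.le).trans ?_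
    rw [Finset.sum_mul]
    refine Finset.sum_le_sum fun n hn => ?_
    have hn : y ≤ n := Nat.ceil_le.1 (Finset.mem_Icc.1 hn).1
    rw [div_mul_eq_mul_div, div_le_iff₀ (by linarith)]
    exact mul_le_mul_of_nonneg_left hn vonMangoldt_nonneg
  have h2 : ∑ n ∈ S with n.Prime, vonMangoldt n ≤ (S.filter Nat.Prime).card * Real.log X := by
    rw [← nsmul_eq_mul]
    refine Finset.sum_le_card_nsmul _ _ _ fun n hn => ?_
    rw [Finset.mem_filter, Finset.mem_Icc, Nat.le_floor_iff hX0.le] at hn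
    rw [vonMangoldt_apply_prime hn.2]
    exact Real.log_le_log (by exact_mod_cast hn.2.pos) hn.1.2
  have h3 : ∑ n ∈ S with ¬ n.Prime, vonMangoldt n ≤ 2 * √X * Real.log X := by
    refine le_trans ?_ (Chebyshev.psi_sub_theta_le hX1)
    rw [Chebyshev.psi_sub_theta_eq_sum_not_prime]
    refine Finset.sum_le_sum_of_subset_of_nonneg ?_ fun _ _ _ => vonMangoldt_nonneg
    refine Finset.filter_subset_filter _ fun n hn => ?_
    rw [Finset.mem_Icc, Nat.ceil_le] at hn
    refine Finset.mem_Ioc.2 ⟨?_, hn.2⟩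
    have : (0 : ℝ) < n := by linarith [hn.1]
    exact_mod_cast this
  rw [← Finset.sum_filter_add_sum_filter_not S Nat.Prime] at h1
  have h4 : (S.filter Nat.Prime).card ≤ X ^ θ' :=
    hcard.trans ((Real.rpow_le_rpow_of_exponent_le hy1 (le_max_left _ _)).trans
      (Real.rpow_le_rpow hy0.le hyX hθ'0.le))
  have h5 : √X ≤ X ^ θ' := by
    rw [Real.sqrt_eq_rpow]
    exact Real.rpow_le_rpow_of_exponent_le hX1 (le_max_right _ _)
  have h6 : Real.log X ≤ X ^ κ / κ := Real.log_le_rpow_div hX0.le hκ0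
  have h7 : c * y ≤ 3 * X ^ θ' * (X ^ κ / κ) := by
    have hp : 0 ≤ X ^ θ' := Real.rpow_nonneg hX0.le _
    have : c * y ≤ 3 * X ^ θ' * Real.log X := by nlinarith
    exact this.trans (mul_le_mul_of_nonneg_left h6 (by positivity))
  have h8 : X = X ^ θ' * X ^ κ * X ^ κ := by
    rw [← Real.rpow_add hX0, ← Real.rpow_add hX0]
    have : θ' + κ + κ = 1 := by rw [hκ]; ring
    rw [this, Real.rpow_one]
  simp only [Function.comp] at hlarge
  rw [div_lt_iff₀ (by positivity)] at hlarge
  have hpp : 0 < X ^ θ' * X ^ κ := by positivity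
  have h9 : c * X ≤ (1 + δ) * (3 * X ^ θ' * (X ^ κ / κ)) := by
    rw [hXdef] at *; nlinarith
  have h10 : c * κ * X ≤ 3 * (1 + δ) * (X ^ θ' * X ^ κ) := by
    have := mul_le_mul_of_nonneg_right h9 hκ0.le
    have e : (1 + δ) * (3 * X ^ θ' * (X ^ κ / κ)) * κ = 3 * (1 + δ) * (X ^ θ' * X ^ κ) := by
      field_simp
    rw [e] at this
    linarith
  have h11 := mul_lt_mul_of_pos_right hlarge hpp
  have h12 : X ^ κ * (c * κ) * (X ^ θ' * X ^ κ) = c * κ * X := by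
    conv_rhs => rw [h8]
    ring
  linarith

end PrimesInShortIntervals

theorem card_mul_log_le_log_of_forall_dvd {Q : Finset ℕ} {y : ℝ} (hy : 1 ≤ y)
    (hQ : ∀ p ∈ Q, p.Prime ∧ y ≤ p) {m : ℤ} (hm : m ≠ 0) (hdvd : ∀ p ∈ Q, (p : ℤ) ∣ m) :
    Q.card * Real.log y ≤ Real.log |(m : ℝ)| := by
  have h1 : ∏ p ∈ Q, p ∣ m.natAbs :=
    Finset.prod_primes_dvd _ (fun p hp => (hQ p hp).1.prime)
      fun p hp => Int.natCast_dvd.1 (hdvd p hp)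
  have h2 : ∏ p ∈ Q, p ≤ m.natAbs := Nat.le_of_dvd (Int.natAbs_pos.2 hm) h1
  have h3 : y ^ Q.card ≤ ∏ p ∈ Q, (p : ℝ) := by
    rw [← Finset.prod_const]
    exact Finset.prod_le_prod (fun _ _ => by linarith) fun p hp => (hQ p hp).2
  have h4 : (∏ p ∈ Q, (p : ℝ)) ≤ |(m : ℝ)| := by
    have h5 : ∏ p ∈ Q, (p : ℝ) ≤ (m.natAbs : ℝ) := by
      rw [← Nat.cast_prod]
      exact Nat.cast_le.2 h2
    rwa [Nat.cast_natAbs, Int.cast_abs] at h5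
  rw [← Real.log_pow]
  exact Real.log_le_log (by positivity) (h3.trans h4)

/-- If two integers `u, v` have residues `r p • d p`, `s p • d p` with small coefficients for many
primes `p`, then the coefficients are proportional to `u` and `v` in `ℤ`. -/
theorem mul_eq_mul_of_many_primes {Q : Finset ℕ} {y M : ℝ} {K N : ℕ} {u v : ℤ}
    {r s : ℕ → ℤ} {d : (p : ℕ) → ZMod p} (hy : 1 < y)
    (hprime : ∀ p ∈ Q, p.Prime ∧ y ≤ p) (hK : ∀ p ∈ Q, 2 * K ^ 2 < p)
    (hpv : ∀ p ∈ Q, ¬ (p : ℤ) ∣ v) (hr : ∀ p ∈ Q, |r p| ≤ K) (hs : ∀ p ∈ Q, |s p| ≤ K)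
    (hur : ∀ p ∈ Q, (u : ZMod p) = r p * d p) (hvs : ∀ p ∈ Q, (v : ZMod p) = s p * d p)
    (huN : |u| ≤ N) (hvN : |v| ≤ N) (hM0 : 0 ≤ M) (hcard : (2 * K + 1 : ℝ) ^ 2 * M < Q.card)
    (hM : Real.log (2 * N * K) ≤ M * Real.log y) :
    ∀ p ∈ Q, r p * v = s p * u := by
  have hs0 : ∀ p ∈ Q, s p ≠ 0 := fun p hp h => hpv p hp <| by
    rw [← CharP.intCast_eq_zero_iff (ZMod p) p, hvs p hp, h]; simp
  set t : Finset (ℤ × ℤ) := Finset.Icc (-K : ℤ) K ×ˢ Finset.Icc (-K : ℤ) K with ht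
  have htc : (t.card : ℝ) = (2 * K + 1) ^ 2 := by
    rw [ht, Finset.card_product, Int.card_Icc]
    have : ((K : ℤ) + 1 - -K).toNat = 2 * K + 1 := by omega
    rw [this]; push_cast; ring
  obtain ⟨⟨r₀, s₀⟩, hmem, hlt⟩ := Finset.exists_lt_card_fiber_of_nsmul_lt_card_of_maps_to
    (s := Q) (t := t) (f := fun p => (r p, s p)) (b := M)
    (fun p hp => Finset.mem_product.2
      ⟨Finset.mem_Icc.2 (abs_le.1 (hr p hp)), Finset.mem_Icc.2 (abs_le.1 (hs p hp))⟩)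
    (by rw [nsmul_eq_mul, htc]; exact hcard)
  set Q' := Q.filter fun p => (r p, s p) = (r₀, s₀) with hQ'
  have hQ'mem : ∀ p ∈ Q', p ∈ Q ∧ r p = r₀ ∧ s p = s₀ := fun p hp => by
    simpa [hQ'] using hp
  rw [ht, Finset.mem_product, Finset.mem_Icc, Finset.mem_Icc, ← abs_le, ← abs_le] at hmem
  obtain ⟨hr₀, hs₀⟩ := hmem
  simp only at hr₀ hs₀
  obtain ⟨q, hq⟩ : Q'.Nonempty := by
    rw [← Finset.card_pos]
    have : (0 : ℝ) < Q'.card := hM0.trans_lt hlt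
    exact_mod_cast this
  have hs₀0 : s₀ ≠ 0 := by
    obtain ⟨h1, -, h3⟩ := hQ'mem q hq
    rw [← h3]; exact hs0 q h1
  have huv : u * s₀ - v * r₀ = 0 := by
    by_contra hne
    have h1 := card_mul_log_le_log_of_forall_dvd hy.le
      (fun p hp => hprime p (hQ'mem p hp).1) hne (fun p hp => by
        obtain ⟨h1, h2, h3⟩ := hQ'mem p hp
        rw [← CharP.intCast_eq_zero_iff (ZMod p) p]
        push_cast
        rw [hur p h1, hvs p h1, h2, h3]
        ring)
    have h2 : |((u * s₀ - v * r₀ : ℤ) : ℝ)| ≤ 2 * N * K := by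
      have : |u * s₀ - v * r₀| ≤ 2 * N * K := by
        have a1 : |u * s₀| ≤ N * K := by
          rw [abs_mul]; exact mul_le_mul huN hs₀ (abs_nonneg _) (by positivity)
        have a2 : |v * r₀| ≤ N * K := by
          rw [abs_mul]; exact mul_le_mul hvN hr₀ (abs_nonneg _) (by positivity)
        have := abs_sub (u * s₀) (v * r₀)
        linarith
      exact_mod_cast this
    have h3 : Real.log |((u * s₀ - v * r₀ : ℤ) : ℝ)| ≤ Real.log (2 * N * K) :=
      Real.log_le_log (abs_pos.2 (by exact_mod_cast hne)) h2
    have h4 := mul_lt_mul_of_pos_right hlt (Real.log_pos hy)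
    linarith
  intro p hp
  have hdvd : (p : ℤ) ∣ r₀ * s p - s₀ * r p := by
    have : Fact p.Prime := ⟨(hprime p hp).1⟩
    rw [← CharP.intCast_eq_zero_iff (ZMod p) p]
    have hd : d p ≠ 0 := fun h => hpv p hp <| by
      rw [← CharP.intCast_eq_zero_iff (ZMod p) p, hvs p hp, h, mul_zero]
    have h1 : (u : ZMod p) * s₀ - v * r₀ = 0 := by exact_mod_cast congrArg (Int.cast (R := ZMod p)) huv
    rw [hur p hp, hvs p hp] at h1
    push_cast
    refine (mul_eq_zero.1 (?_ : ((r₀ : ZMod p) * s p - s₀ * r p) * d p = 0)).resolve_right hd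
    linear_combination -h1
  have hzero : r₀ * s p - s₀ * r p = 0 := by
    refine Int.eq_zero_of_abs_lt_dvd hdvd ?_
    have a1 : |r₀ * s p| ≤ K * K := by
      rw [abs_mul]; exact mul_le_mul hr₀ (hs p hp) (abs_nonneg _) (by positivity)
    have a2 : |s₀ * r p| ≤ K * K := by
      rw [abs_mul]; exact mul_le_mul hs₀ (hr p hp) (abs_nonneg _) (by positivity)
    have a3 := abs_sub (r₀ * s p) (s₀ * r p)
    have a4 : (2 * K ^ 2 : ℤ) < p := by exact_mod_cast hK p hp
    nlinarith
  refine mul_left_cancel₀ hs₀0 ?_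
  linear_combination (-v) * hzero - s p * huv

/-- If the members of `A` have proportional indices at every prime of `Q`, and `A` is cut out by
progressions modulo primes, then `A` is a progression between its extreme elements. -/
theorem isIntAPLen_of_proportional {A : Set ℤ} {N : ℕ} {Ps : Finset ℕ} {R : (p : ℕ) → Set (ZMod p)}
    (hA : A = {n : ℤ | 0 ≤ n ∧ n ≤ (N : ℤ) ∧ ∀ p ∈ Ps, (n : ZMod p) ∈ R p})
    {k : ℕ → ℕ} {a d : (p : ℕ) → ZMod p} (hprime : ∀ p ∈ Ps, p.Prime)
    (hR : ∀ p ∈ Ps, R p = (fun j : ℕ => a p + (j : ZMod p) * d p) '' {j : ℕ | j < k p})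
    (hkp : ∀ p ∈ Ps, ∀ q ∈ Ps, k q ≤ p) {x₀ x₁ : ℤ} (hx₀ : x₀ ∈ A) (hx₁ : x₁ ∈ A) (hlt : x₀ < x₁)
    (hmin : ∀ x ∈ A, x₀ ≤ x) (hmax : ∀ x ∈ A, x ≤ x₁)
    {j : (p : ℕ) → ℤ → ℕ} (hj : ∀ p ∈ Ps, ∀ x ∈ A, j p x < k p)
    (hjx : ∀ p ∈ Ps, ∀ x ∈ A, (x : ZMod p) = a p + (j p x : ZMod p) * d p)
    (hex : ∃ p ∈ Ps, ¬ (p : ℤ) ∣ x₁ - x₀)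
    (hprop : ∀ p ∈ Ps, ¬ (p : ℤ) ∣ x₁ - x₀ → ∀ x ∈ A,
      ((j p x : ℤ) - j p x₀) * (x₁ - x₀) = ((j p x₁ : ℤ) - j p x₀) * (x - x₀)) :
    ∃ l : ℕ, IsIntAPLen A l ∧ ∀ p ∈ Ps, ¬ (p : ℤ) ∣ x₁ - x₀ → l ≤ k p := by
  have hAfin : A.Finite := (Set.finite_Icc x₀ x₁).subset fun x hx => ⟨hmin x hx, hmax x hx⟩
  set g : ℤ := hAfin.toFinset.gcd fun x => x - x₀ with hg
  have hgdvd : ∀ x ∈ A, g ∣ x - x₀ := fun x hx => Finset.gcd_dvd (hAfin.mem_toFinset.2 hx)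
  obtain ⟨t₁, ht₁⟩ := hgdvd x₁ hx₁
  have hg0 : g ≠ 0 := by rintro h; rw [h, zero_mul] at ht₁; linarith
  have hgpos : 0 < g := lt_of_le_of_ne
    (Int.nonneg_of_normalize_eq_self Finset.normalize_gcd) hg0.symm
  have ht₁pos : 0 < t₁ := by
    have : 0 < g * t₁ := by rw [← ht₁]; linarith
    exact pos_of_mul_pos_right this hgpos.le
  have hm : ∀ p ∈ Ps, ¬ (p : ℤ) ∣ x₁ - x₀ → ∃ m : ℤ, m ≠ 0 ∧ (j p x₁ : ℤ) - j p x₀ = m * t₁ := by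
    intro p hp hpn
    have h1 : x₁ - x₀ ∣ hAfin.toFinset.gcd fun x => ((j p x₁ : ℤ) - j p x₀) * (x - x₀) :=
      Finset.dvd_gcd fun x hx =>
        ⟨(j p x : ℤ) - j p x₀, by
          rw [← hprop p hp hpn x (hAfin.mem_toFinset.1 hx)]; ring⟩
    rw [Finset.gcd_mul_left, ← hg] at h1
    have h2 : x₁ - x₀ ∣ ((j p x₁ : ℤ) - j p x₀) * g :=
      h1.trans (mul_dvd_mul_right (normalize_associated _).dvd _)
    obtain ⟨m, hm⟩ := h2
    have h3 : (j p x₁ : ℤ) - j p x₀ = m * t₁ := by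
      refine mul_right_cancel₀ hg0 ?_
      rw [hm, ht₁]; ring
    refine ⟨m, ?_, h3⟩
    rintro rfl
    rw [zero_mul] at h3
    apply hpn
    rw [← CharP.intCast_eq_zero_iff (ZMod p) p]
    have h4 : j p x₁ = j p x₀ := by omega
    push_cast
    rw [hjx p hp x₁ hx₁, hjx p hp x₀ hx₀, h4, sub_self]
  have hlen : ∀ p ∈ Ps, ¬ (p : ℤ) ∣ x₁ - x₀ → t₁ < k p := by
    intro p hp hpn
    obtain ⟨m, hm0, hm⟩ := hm p hp hpn
    have h1 : t₁ ≤ |m * t₁| := by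
      rw [abs_mul, abs_of_pos ht₁pos]
      exact le_mul_of_one_le_left ht₁pos.le (Int.one_le_abs hm0)
    have h2 := hj p hp x₁ hx₁
    have h3 := hj p hp x₀ hx₀
    rw [← hm] at h1
    have h4 : |(j p x₁ : ℤ) - j p x₀| < k p := by rw [abs_lt]; omega
    linarith
  have hbad : ∀ p ∈ Ps, (p : ℤ) ∣ x₁ - x₀ → (p : ℤ) ∣ g := by
    intro p hp hpd
    obtain ⟨q, hq, hqn⟩ := hex
    have h1 := hlen q hq hqn
    have h2 := hkp p hp q hq
    rw [ht₁] at hpd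
    refine ((Nat.prime_iff_prime_int.1 (hprime p hp)).dvd_or_dvd hpd).resolve_right fun h => ?_
    have := Int.le_of_dvd ht₁pos h
    omega
  obtain ⟨hx₀0, -, hx₀R⟩ : 0 ≤ x₀ ∧ x₀ ≤ (N : ℤ) ∧ ∀ p ∈ Ps, (x₀ : ZMod p) ∈ R p := by
    rw [hA] at hx₀; exact hx₀
  obtain ⟨-, hx₁N, -⟩ : 0 ≤ x₁ ∧ x₁ ≤ (N : ℤ) ∧ ∀ p ∈ Ps, (x₁ : ZMod p) ∈ R p := by
    rw [hA] at hx₁; exact hx₁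
  refine ⟨t₁.toNat + 1, ⟨x₀, g, ?_⟩, fun p hp hpn => ?_⟩
  · ext x
    simp only [Set.mem_image, Set.mem_ofPred_eq]
    constructor
    · intro hx
      obtain ⟨t, ht⟩ := hgdvd x hx
      have h1 : 0 ≤ t := by
        have : 0 ≤ g * t := by rw [← ht]; linarith [hmin x hx]
        exact nonneg_of_mul_nonneg_right this hgpos
      have h2 : t ≤ t₁ := by
        have : g * t ≤ g * t₁ := by rw [← ht, ← ht₁]; linarith [hmax x hx]
        exact le_of_mul_le_mul_left this hgpos
      refine ⟨t.toNat, by omega, ?_⟩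
      rw [Int.toNat_of_nonneg h1]
      linarith
    · rintro ⟨i, hi, rfl⟩
      have hi1 : (i : ℤ) ≤ t₁ := by omega
      have h1 : (i : ℤ) * g ≤ t₁ * g := mul_le_mul_of_nonneg_right hi1 hgpos.le
      have h0 : 0 ≤ (i : ℤ) * g := by positivity
      rw [hA]
      refine ⟨by linarith, by linarith, fun p hp => ?_⟩
      by_cases hpd : (p : ℤ) ∣ x₁ - x₀
      · have : ((g : ℤ) : ZMod p) = 0 := (CharP.intCast_eq_zero_iff (ZMod p) p _).2 (hbad p hp hpd)
        push_cast
        rw [this, mul_zero, add_zero]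
        exact hx₀R p hp
      · obtain ⟨m, hm0, hm⟩ := hm p hp hpd
        have : Fact p.Prime := ⟨hprime p hp⟩
        have ht₁0 : ((t₁ : ℤ) : ZMod p) ≠ 0 := fun h => hpd <| by
          rw [ht₁]
          exact ((CharP.intCast_eq_zero_iff (ZMod p) p _).1 h).mul_left g
        have hgm : (g : ZMod p) = m * d p := by
          refine mul_right_cancel₀ ht₁0 ?_
          have e1 : (x₁ : ZMod p) - x₀ = g * t₁ := by exact_mod_cast congrArg (Int.cast (R := ZMod p)) ht₁
          have e2 : (j p x₁ : ZMod p) - j p x₀ = m * t₁ := by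
            exact_mod_cast congrArg (Int.cast (R := ZMod p)) hm
          rw [hjx p hp x₁ hx₁, hjx p hp x₀ hx₀] at e1
          linear_combination (-1) * e1 + d p * e2
        have hj0 := hj p hp x₀ hx₀
        have hj1 := hj p hp x₁ hx₁
        have hbound : 0 ≤ (j p x₀ : ℤ) + m * i ∧ (j p x₀ : ℤ) + m * i < k p := by
          rcases lt_or_gt_of_ne hm0 with hneg | hpos
          · have b1 : m * t₁ ≤ m * i := mul_le_mul_of_nonpos_left hi1 hneg.le
            have b2 : m * i ≤ 0 := mul_nonpos_of_nonpos_of_nonneg hneg.le (by positivity)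
            omega
          · have b1 : m * i ≤ m * t₁ := mul_le_mul_of_nonneg_left hi1 hpos.le
            have b2 : 0 ≤ m * i := mul_nonneg hpos.le (by positivity)
            omega
        rw [hR p hp]
        refine ⟨((j p x₀ : ℤ) + m * i).toNat, ?_, ?_⟩
        · rw [Set.mem_ofPred_eq]; omega
        · have e : ((((j p x₀ : ℤ) + m * i).toNat : ℕ) : ZMod p) = j p x₀ + m * i := by
            have := congrArg (Int.cast (R := ZMod p)) (Int.toNat_of_nonneg hbound.1)
            push_cast at this
            exact_mod_cast this
          simp only
          rw [e]
          push_cast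
          rw [hgm, hjx p hp x₀ hx₀]
          ring
  · have := hlen p hp hpn
    omega

theorem isIntAPLen_of_many_primes {A : Set ℤ} {N K : ℕ} {Ps : Finset ℕ} {y M : ℝ}
    {R : (p : ℕ) → Set (ZMod p)}
    (hA : A = {n : ℤ | 0 ≤ n ∧ n ≤ (N : ℤ) ∧ ∀ p ∈ Ps, (n : ZMod p) ∈ R p})
    {k : ℕ → ℕ} (hy : 1 < y) (hprime : ∀ p ∈ Ps, p.Prime ∧ y ≤ p)
    (hR : ∀ p ∈ Ps, IsAPZModLen p (R p) (k p)) (hkK : ∀ p ∈ Ps, k p ≤ K + 1)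
    (hKp : ∀ p ∈ Ps, K < p) (hK2 : ∀ p ∈ Ps, 2 * K ^ 2 < p)
    {x₀ x₁ : ℤ} (hx₀ : x₀ ∈ A) (hx₁ : x₁ ∈ A) (hlt : x₀ < x₁)
    (hmin : ∀ x ∈ A, x₀ ≤ x) (hmax : ∀ x ∈ A, x ≤ x₁) (hM0 : 0 ≤ M)
    (hcard : (2 * K + 1 : ℝ) ^ 2 * M < (Ps.filter fun p : ℕ => ¬ (p : ℤ) ∣ x₁ - x₀).card)
    (hM : Real.log (2 * N * K) ≤ M * Real.log y) :
    ∃ l : ℕ, IsIntAPLen A l ∧ ∀ p ∈ Ps, ¬ (p : ℤ) ∣ x₁ - x₀ → l ≤ k p := by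
  choose! a d hRe using hR
  have hmemA : ∀ x ∈ A, 0 ≤ x ∧ x ≤ (N : ℤ) ∧ ∀ p ∈ Ps, (x : ZMod p) ∈ R p := fun x hx => by
    rw [hA] at hx; exact hx
  have hidx : ∀ p ∈ Ps, ∀ x ∈ A, ∃ j : ℕ, j < k p ∧ (x : ZMod p) = a p + (j : ZMod p) * d p := by
    intro p hp x hx
    have h := (hmemA x hx).2.2 p hp
    rw [hRe p hp] at h
    obtain ⟨j, hj, hjx⟩ := h
    exact ⟨j, hj, hjx.symm⟩
  choose! j hj hjx using hidx
  set Q := Ps.filter fun p : ℕ => ¬ (p : ℤ) ∣ x₁ - x₀ with hQ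
  have hQP : ∀ p ∈ Q, p ∈ Ps ∧ ¬ (p : ℤ) ∣ x₁ - x₀ := fun p hp => Finset.mem_filter.1 hp
  have hdiff : ∀ x ∈ A, ∀ p ∈ Q, |(j p x : ℤ) - j p x₀| ≤ K := by
    intro x hx p hp
    have h1 := hj p (hQP p hp).1 x hx
    have h2 := hj p (hQP p hp).1 x₀ hx₀
    have h3 := hkK p (hQP p hp).1
    rw [abs_le]; omega
  have hcast : ∀ x ∈ A, ∀ p ∈ Q,
      ((x - x₀ : ℤ) : ZMod p) = ((j p x : ℤ) - j p x₀ : ℤ) * d p := by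
    intro x hx p hp
    push_cast
    rw [hjx p (hQP p hp).1 x hx, hjx p (hQP p hp).1 x₀ hx₀]
    ring
  have hN : ∀ x ∈ A, |x - x₀| ≤ N := by
    intro x hx
    have h1 := hmemA x hx
    have h2 := hmemA x₀ hx₀
    rw [abs_le]; omega
  refine isIntAPLen_of_proportional hA (fun p hp => (hprime p hp).1) hRe
    (fun p hp q hq => (hkK q hq).trans (hKp p hp)) hx₀ hx₁ hlt hmin hmax hj hjx ?_ ?_
  · have : 0 < Q.card := by
      have : (0 : ℝ) < Q.card := lt_of_le_of_lt (by positivity) hcard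
      exact_mod_cast this
    obtain ⟨p, hp⟩ := Finset.card_pos.1 this
    exact ⟨p, hQP p hp⟩
  · intro p hp hpn x hx
    exact mul_eq_mul_of_many_primes (Q := Q) (r := fun p => (j p x : ℤ) - j p x₀)
      (s := fun p => (j p x₁ : ℤ) - j p x₀) hy
      (fun p hp => hprime p (hQP p hp).1) (fun p hp => hK2 p (hQP p hp).1)
      (fun p hp => (hQP p hp).2) (hdiff x hx) (hdiff x₁ hx₁) (hcast x hx) (hcast x₁ hx₁)
      (hN x hx) (hN x₁ hx₁) hM0 hcard hM p (Finset.mem_filter.2 ⟨hp, hpn⟩)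

theorem card_mul_log_le_log_of_dvd {Q : Finset ℕ} {y : ℝ} {N : ℕ} (hy : 1 ≤ y)
    (hQ : ∀ p ∈ Q, p.Prime ∧ y ≤ p) {m : ℤ} (hm : 0 < m) (hmN : m ≤ N)
    (hdvd : ∀ p ∈ Q, (p : ℤ) ∣ m) : Q.card * Real.log y ≤ Real.log N := by
  refine (card_mul_log_le_log_of_forall_dvd hy hQ hm.ne' hdvd).trans ?_
  have h1 : (0 : ℝ) < m := by exact_mod_cast hm
  rw [abs_of_pos h1]
  exact Real.log_le_log h1 (by exact_mod_cast hmN)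

theorem exists_prime_le_of_many {Ps : Finset ℕ} {y δ : ℝ} {N : ℕ} (hy : 1 < y) (hδ : δ ≤ 1)
    (hPs : ∀ p : ℕ, p ∈ Ps ↔ Nat.Prime p ∧ y ≤ (p : ℝ) ∧ (p : ℝ) ≤ 2 * y) {m : ℤ} (hm : 0 < m)
    (hmN : m ≤ N)
    (hmany : Real.log N <
      ((Finset.Icc ⌈y⌉₊ ⌊(1 + δ) * y⌋₊).filter Nat.Prime).card * Real.log y) :
    ∃ p ∈ Ps, ¬ (p : ℤ) ∣ m ∧ (p : ℝ) ≤ (1 + δ) * y := by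
  have hmem : ∀ p ∈ (Finset.Icc ⌈y⌉₊ ⌊(1 + δ) * y⌋₊).filter Nat.Prime,
      p.Prime ∧ y ≤ p ∧ (p : ℝ) ≤ (1 + δ) * y := by
    intro p hp
    rw [Finset.mem_filter, Finset.mem_Icc] at hp
    refine ⟨hp.2, Nat.ceil_le.1 hp.1.1, (Nat.le_floor_iff' hp.2.ne_zero).1 hp.1.2⟩
  by_contra! hno
  refine hmany.not_ge (card_mul_log_le_log_of_dvd hy.le
    (fun p hp => ⟨(hmem p hp).1, (hmem p hp).2.1⟩) hm hmN fun p hp => ?_)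
  obtain ⟨h1, h2, h3⟩ := hmem p hp
  by_contra hnd
  exact (hno p ((hPs p).2 ⟨h1, h2, h3.trans (by nlinarith)⟩) hnd).not_ge h3

theorem isIntAPLen_of_sieve {ε δ y : ℝ} {N : ℕ} (hε : ε ∈ Set.Ioo (0 : ℝ) (1 / 2))
    (hδ1 : δ ≤ 1) (hy : 3 ≤ y) (hN : 3 ≤ N) (hyN : y ≤ N)
    (hlog : 400 * Real.log N ≤ y ^ (2 * ε))
    (hshort : y ^ (2 * ε) < ((Finset.Icc ⌈y⌉₊ ⌊(1 + δ) * y⌋₊).filter Nat.Prime).card)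
    {Ps : Finset ℕ} (hPs : ∀ p : ℕ, p ∈ Ps ↔ Nat.Prime p ∧ y ≤ (p : ℝ) ∧ (p : ℝ) ≤ 2 * y)
    (hcard : 100 * y ^ (1 - 2 * ε) * Real.log N / Real.log y ≤ (Ps.card : ℝ))
    {R : (p : ℕ) → Set (ZMod p)}
    (hR : ∀ p ∈ Ps, ∃ k : ℕ, (k : ℝ) ≤ (p : ℝ) ^ ((1 : ℝ) / 2 - ε) + 1 ∧ IsAPZModLen p (R p) k)
    {A : Set ℤ} (hA : A = {n : ℤ | 0 ≤ n ∧ n ≤ (N : ℤ) ∧ ∀ p ∈ Ps, (n : ZMod p) ∈ R p})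
    {x₀ x₁ : ℤ} (hx₀ : x₀ ∈ A) (hx₁ : x₁ ∈ A) (hlt : x₀ < x₁)
    (hmin : ∀ x ∈ A, x₀ ≤ x) (hmax : ∀ x ∈ A, x ≤ x₁) :
    ∃ l : ℕ, (l : ℝ) ≤ ((1 + δ) * y) ^ ((1 : ℝ) / 2 - ε) + 1 ∧ IsIntAPLen A l := by
  obtain ⟨hε0, hε1⟩ := hε
  choose! k hk hRk using hR
  have hy0 : 0 < y := by linarith
  have hNR : (3 : ℝ) ≤ N := by exact_mod_cast hN
  have hl1 : 1 ≤ Real.log y := by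
    rw [Real.le_log_iff_exp_le hy0]; linarith [Real.exp_one_lt_d9]
  have hL1 : 1 ≤ Real.log N := by
    rw [Real.le_log_iff_exp_le (by linarith)]; linarith [Real.exp_one_lt_d9]
  set L := Real.log N
  set l := Real.log y
  have hα : 0 ≤ (1 : ℝ) / 2 - ε := by linarith
  set z := (2 * y) ^ ((1 : ℝ) / 2 - ε) with hz
  have hz1 : 1 ≤ z := Real.one_le_rpow (by linarith) hα
  set W := y ^ (1 - 2 * ε) with hW
  have hW1 : 1 ≤ W := Real.one_le_rpow (by linarith) (by linarith)
  have hzsq : z ^ 2 ≤ 2 * W := by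
    have h1 : z ^ 2 = 2 ^ (1 - 2 * ε) * W := by
      rw [hz, ← Real.rpow_natCast, ← Real.rpow_mul (by positivity), hW,
        ← Real.mul_rpow (by norm_num) hy0.le]
      congr 1; push_cast; ring
    have h2 : (2 : ℝ) ^ (1 - 2 * ε) ≤ 2 ^ (1 : ℝ) :=
      Real.rpow_le_rpow_of_exponent_le (by norm_num) (by linarith)
    rw [Real.rpow_one] at h2
    rw [h1]; exact mul_le_mul_of_nonneg_right h2 (by linarith)
  have hWy : W * y ^ (2 * ε) = y := by
    rw [hW, ← Real.rpow_add hy0]; simp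
  set K := ⌊z⌋₊ with hK
  have hK1 : 1 ≤ K := Nat.le_floor (by exact_mod_cast hz1)
  have hK1R : (1 : ℝ) ≤ K := by exact_mod_cast hK1
  have hKz : (K : ℝ) ≤ z := Nat.floor_le (by linarith)
  have hKsq : (K : ℝ) ^ 2 ≤ 2 * W := by nlinarith
  have hKy : 2 * (K : ℝ) ^ 2 < y := by
    have : W * 400 ≤ W * y ^ (2 * ε) := mul_le_mul_of_nonneg_left (by linarith) (by linarith)
    linarith
  have hprime : ∀ p ∈ Ps, p.Prime ∧ y ≤ p := fun p hp => ⟨((hPs p).1 hp).1, ((hPs p).1 hp).2.1⟩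
  have hK2 : ∀ p ∈ Ps, 2 * K ^ 2 < p := fun p hp => by
    have := hKy.trans_le (hprime p hp).2
    exact_mod_cast this
  have hkK : ∀ p ∈ Ps, k p ≤ K + 1 := fun p hp => by
    rw [hK, ← Nat.floor_add_one (by linarith)]
    refine Nat.le_floor ((hk p hp).trans ?_)
    rw [hz]
    gcongr
    exact ((hPs p).1 hp).2.2
  have hv : 0 < x₁ - x₀ := by linarith
  have hvN : x₁ - x₀ ≤ N := by
    rw [hA] at hx₀ hx₁
    linarith [hx₀.1, hx₁.2.1]
  have hbad : ((Ps.filter fun p : ℕ => (p : ℤ) ∣ x₁ - x₀).card : ℝ) * l ≤ L :=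
    card_mul_log_le_log_of_dvd (by linarith)
      (fun p hp => hprime p (Finset.mem_filter.1 hp).1) hv hvN
      fun p hp => (Finset.mem_filter.1 hp).2
  have hsplit : ((Ps.filter fun p : ℕ => (p : ℤ) ∣ x₁ - x₀).card : ℝ)
      + (Ps.filter fun p : ℕ => ¬ (p : ℤ) ∣ x₁ - x₀).card = Ps.card := by
    exact_mod_cast Finset.card_filter_add_card_filter_not (s := Ps) fun p : ℕ => (p : ℤ) ∣ x₁ - x₀
  have hgood : (2 * K + 1 : ℝ) ^ 2 * (3 * L / l)
      < (Ps.filter fun p : ℕ => ¬ (p : ℤ) ∣ x₁ - x₀).card := by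
    rw [mul_div_assoc', div_lt_iff₀ (by linarith)]
    rw [div_le_iff₀ (by linarith), ← hsplit, add_mul] at hcard
    have h1 : (2 * K + 1 : ℝ) ^ 2 ≤ 18 * W := by nlinarith
    have h2 : (2 * K + 1 : ℝ) ^ 2 * (3 * L) ≤ 18 * W * (3 * L) :=
      mul_le_mul_of_nonneg_right h1 (by linarith)
    have h3 : L ≤ W * L := le_mul_of_one_le_left (by linarith) hW1
    linarith
  have hM : Real.log (2 * N * K) ≤ 3 * L / l * l := by
    rw [div_mul_cancel₀ _ (by linarith)]
    have : 3 * L = Real.log (N ^ 3) := by rw [Real.log_pow]; rfl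
    rw [this]
    refine Real.log_le_log (by positivity) ?_
    have h1 : (K : ℝ) ≤ N := by nlinarith
    nlinarith [mul_le_mul_of_nonneg_left h1 (by positivity : (0 : ℝ) ≤ 2 * N), sq_nonneg (N : ℝ)]
  obtain ⟨len, hlen, hlenk⟩ := isIntAPLen_of_many_primes hA (by linarith) hprime hRk hkK
    (fun p hp => by nlinarith [hK2 p hp]) hK2 hx₀ hx₁ hlt hmin hmax
    (by positivity) hgood hM
  obtain ⟨p, hp, hpn, hpy⟩ := exists_prime_le_of_many (by linarith) hδ1 hPs hv hvN
    (by nlinarith : L < _ * l)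
  refine ⟨len, ?_, hlen⟩
  have h1 : (len : ℝ) ≤ k p := by exact_mod_cast hlenk p hp hpn
  refine (h1.trans (hk p hp)).trans ?_
  gcongr

theorem stmt1 :
    ∃ C : ℝ, 0 < C ∧ ∀ ε : ℝ, ε ∈ Set.Ioo (0 : ℝ) (1/2) → ∀ η : ℝ, 0 < η → ∃ N₁ : ℕ,
      ∀ N : ℕ, N₁ < N → ∀ y : ℝ,
        (4 * C * Real.log N) ^ (1 / (2 * ε)) ≤ y → y ≤ N →
        ∀ Ps : Finset ℕ,
          (∀ p : ℕ, p ∈ Ps ↔ Nat.Prime p ∧ y ≤ (p : ℝ) ∧ (p : ℝ) ≤ 2 * y) →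
          C * y ^ (1 - 2 * ε) * Real.log N / Real.log y ≤ (Ps.card : ℝ) →
          ∀ R : (p : ℕ) → Set (ZMod p),
            (∀ p ∈ Ps, ∃ k : ℕ, (k : ℝ) ≤ (p : ℝ) ^ ((1 : ℝ)/2 - ε) + 1 ∧
              IsAPZModLen p (R p) k) →
            ∀ A : Set ℤ,
              A = {n : ℤ | 0 ≤ n ∧ n ≤ (N : ℤ) ∧ ∀ p ∈ Ps, (n : ZMod p) ∈ R p} →
              ∃ k : ℕ, (k : ℝ) ≤ (1 + η) * y ^ ((1 : ℝ)/2 - ε) ∧ IsIntAPLen A k := by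
  refine ⟨100, by norm_num, fun ε hε η hη => ?_⟩
  have hε0 : 0 < ε := hε.1
  have hε1 : ε < 1 / 2 := hε.2
  set δ : ℝ := min 1 (η / 2) with hδ
  have hδ0 : 0 < δ := lt_min one_pos (by linarith)
  have hα : 0 < (1 : ℝ) / 2 - ε := by linarith
  have hlarge : ∀ᶠ y : ℝ in Filter.atTop, 3 ≤ y ∧ 2 / η ≤ y ^ ((1 : ℝ) / 2 - ε) ∧
      y ^ (2 * ε) < ((Finset.Icc ⌈y⌉₊ ⌊(1 + δ) * y⌋₊).filter Nat.Prime).card :=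
    (Filter.eventually_ge_atTop 3).and
      (((tendsto_rpow_atTop hα).eventually_ge_atTop _).and
        (eventually_rpow_lt_card_primes hδ0 (by linarith)))
  obtain ⟨Y₀, hY₀⟩ := Filter.eventually_atTop.1 hlarge
  have htend : Filter.Tendsto (fun N : ℕ => (4 * 100 * Real.log N) ^ (1 / (2 * ε)))
      Filter.atTop Filter.atTop :=
    (tendsto_rpow_atTop (by positivity)).comp
      ((Real.tendsto_log_atTop.comp tendsto_natCast_atTop_atTop).const_mul_atTop (by norm_num))
  obtain ⟨N₁, hN₁⟩ := Filter.eventually_atTop.1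
    ((htend.eventually_ge_atTop Y₀).and (Filter.eventually_ge_atTop 3))
  refine ⟨N₁, fun N hN y hyl hyN Ps hPs hcard R hR A hA => ?_⟩
  obtain ⟨hYN, hN3⟩ := hN₁ N hN.le
  obtain ⟨hy3, hyη, hshort⟩ := hY₀ y (hYN.trans hyl)
  have hy0 : 0 ≤ y := by linarith
  have hη1 : 1 ≤ η / 2 * y ^ ((1 : ℝ) / 2 - ε) := by
    rw [div_le_iff₀ hη] at hyη
    linarith
  have hlog0 : 0 ≤ Real.log N := Real.log_natCast_nonneg N
  have hlog : 400 * Real.log N ≤ y ^ (2 * ε) := by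
    have h1 := Real.rpow_le_rpow (by positivity) hyl (by positivity : 0 ≤ 2 * ε)
    rw [← Real.rpow_mul (by positivity), one_div_mul_cancel (by positivity), Real.rpow_one] at h1
    linarith
  have hAsub : A ⊆ Set.Icc 0 (N : ℤ) := fun x hx => by rw [hA] at hx; exact ⟨hx.1, hx.2.1⟩
  have hAfin : A.Finite := (Set.finite_Icc _ _).subset hAsub
  have hpos : 1 ≤ (1 + η) * y ^ ((1 : ℝ) / 2 - ε) := by
    nlinarith [Real.rpow_nonneg hy0 ((1 : ℝ) / 2 - ε)]
  rcases A.eq_empty_or_nonempty with hAe | hAne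
  · exact ⟨0, by push_cast; linarith, 0, 0, by simp [hAe]⟩
  obtain ⟨x₀, hx₀, hmin⟩ := hAfin.exists_minimalFor id A hAne
  obtain ⟨x₁, hx₁, hmax⟩ := hAfin.exists_maximalFor id A hAne
  replace hmin : ∀ x ∈ A, x₀ ≤ x := fun x hx => by
    rcases le_total x₀ x with h | h
    exacts [h, hmin hx h]
  replace hmax : ∀ x ∈ A, x ≤ x₁ := fun x hx => by
    rcases le_total x x₁ with h | h
    exacts [h, hmax hx h]
  rcases (hmin x₁ hx₁).eq_or_lt with heq | hlt
  · refine ⟨1, by simpa using hpos, x₀, 0, ?_⟩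
    ext x
    simp only [Set.mem_image, Set.mem_ofPred_eq, mul_zero, add_zero]
    constructor
    · intro hx
      exact ⟨0, one_pos, le_antisymm (hmin x hx) ((hmax x hx).trans heq.ge)⟩
    · rintro ⟨_, _, rfl⟩
      exact hx₀
  · obtain ⟨l, hl, hAl⟩ := isIntAPLen_of_sieve hε (min_le_left _ _) hy3 hN3 hyN hlog hshort hPs
      hcard hR hA hx₀ hx₁ hlt hmin hmax
    refine ⟨l, hl.trans ?_, hAl⟩
    rw [Real.mul_rpow (by linarith) hy0]
    have h1 : (1 + δ) ^ ((1 : ℝ) / 2 - ε) ≤ 1 + η / 2 :=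
      calc (1 + δ) ^ ((1 : ℝ) / 2 - ε) ≤ (1 + δ) ^ (1 : ℝ) :=
            Real.rpow_le_rpow_of_exponent_le (by linarith) (by linarith)
        _ ≤ 1 + η / 2 := by rw [Real.rpow_one]; linarith [min_le_right 1 (η / 2)]
    have h2 := mul_le_mul_of_nonneg_right h1 (Real.rpow_nonneg hy0 ((1 : ℝ) / 2 - ε))
    linarith
end

section
/- For each ε ∈ (0, 1) there is a threshold N₀(ε) such that the following holds. Let N > N₀(ε) be an integer and let y be a real number with (16·log N)^{1/ε} ≤ y ≤ N. Let 𝒫 be a set of primes in [y, 2y] with |𝒫| ≥ 4·(2y)^{1−ε}·log N / log y. For each prime p ∈ 𝒫, let I_p ⊆ ℤ/pℤ be the image mod p of an interval of integers of cardinality at most p^{1−ε} + 1. Let A be the set of all integers n ∈ {0, 1, …, N} such that for every p ∈ 𝒫 the residue of n mod p lies in I_p. Then A is a set of consecutive integers of cardinality at most p₀^{1−ε} + 1, where p₀ = min{p : p ∈ 𝒫}. -/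
/-- `I ⊆ ℤ/pℤ` is the image mod `p` of an interval of integers of cardinality `k`. -/
def IsZModIntervalLen (p : ℕ) (I : Set (ZMod p)) (k : ℕ) : Prop :=
  ∃ a : ℤ, I = (fun j : ℕ => ((a + j : ℤ) : ZMod p)) '' {j : ℕ | j < k}

/-- A nonzero integer of absolute value at most `M` has few prime divisors that are at least `y`. -/
lemma card_primes_dvd_mul_log_le {P : Finset ℕ} {y M : ℝ} {t : ℤ} (hy : 1 < y)
    (hP : ∀ p ∈ P, p.Prime ∧ y ≤ (p : ℝ)) (hdvd : ∀ p ∈ P, (p : ℤ) ∣ t) (ht : t ≠ 0)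
    (htM : |(t : ℝ)| ≤ M) : (P.card : ℝ) * Real.log y ≤ Real.log M := by
  have hprod : ∏ p ∈ P, p ∣ t.natAbs :=
    Finset.prod_primes_dvd _ (fun p hp => (hP p hp).1.prime)
      fun p hp => Int.natCast_dvd.mp (hdvd p hp)
  have hle : ((∏ p ∈ P, p : ℕ) : ℝ) ≤ |(t : ℝ)| := by
    rw [← Int.cast_abs, Int.abs_eq_natAbs, Int.cast_natCast]
    exact_mod_cast Nat.le_of_dvd (Int.natAbs_pos.mpr ht) hprod
  have hpow : y ^ P.card ≤ M := by
    calc y ^ P.card = ∏ _p ∈ P, y := by simp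
      _ ≤ ∏ p ∈ P, (p : ℝ) :=
        Finset.prod_le_prod (fun _ _ => by linarith) fun p hp => (hP p hp).2
      _ ≤ M := by push_cast at hle; linarith
  rw [← Real.log_pow]
  exact Real.log_le_log (by positivity) hpow

/-- If `d` lies within `K` of a multiple of each prime in a set `P` but not within `K` of `0`,
then `P` is small. -/
lemma card_mul_log_le_of_near_multiples {P : Finset ℕ} {y M : ℝ} {d : ℤ} {K : ℕ} (hy : 1 < y)
    (hP : ∀ p ∈ P, p.Prime ∧ y ≤ (p : ℝ))
    (hnear : ∀ p ∈ P, ∃ j : ℤ, |j| ≤ K ∧ (p : ℤ) ∣ d - j) (hd : ¬ |d| ≤ K)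
    (hM : ∀ j : ℤ, |j| ≤ K → |((d - j : ℤ) : ℝ)| ≤ M) :
    (P.card : ℝ) * Real.log y ≤ (2 * K + 1) * Real.log M := by
  classical
  set S : Finset ℤ := Finset.Icc (-(K : ℤ)) K with hS
  have hcover : P ⊆ S.biUnion fun j => P.filter fun p : ℕ => (p : ℤ) ∣ d - j := by
    intro p hp
    obtain ⟨j, hj, hpj⟩ := hnear p hp
    exact Finset.mem_biUnion.mpr
      ⟨j, Finset.mem_Icc.mpr (abs_le.mp hj), Finset.mem_filter.mpr ⟨hp, hpj⟩⟩
  have hcard : (P.card : ℝ) ≤ ∑ j ∈ S, ((P.filter fun p : ℕ => (p : ℤ) ∣ d - j).card : ℝ) := by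
    exact_mod_cast (Finset.card_le_card hcover).trans Finset.card_biUnion_le
  calc (P.card : ℝ) * Real.log y
      ≤ (∑ j ∈ S, ((P.filter fun p : ℕ => (p : ℤ) ∣ d - j).card : ℝ)) * Real.log y :=
        mul_le_mul_of_nonneg_right hcard (Real.log_pos hy).le
    _ = ∑ j ∈ S, ((P.filter fun p : ℕ => (p : ℤ) ∣ d - j).card : ℝ) * Real.log y :=
        Finset.sum_mul ..
    _ ≤ ∑ _j ∈ S, Real.log M := by
        refine Finset.sum_le_sum fun j hj => ?_
        have hjK : |j| ≤ K := abs_le.mpr (Finset.mem_Icc.mp hj)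
        refine card_primes_dvd_mul_log_le (t := d - j) hy
          (fun p hp => hP p (Finset.mem_filter.mp hp).1)
          (fun p hp => (Finset.mem_filter.mp hp).2) (fun h => hd ?_) (hM j hjK)
        rwa [sub_eq_zero.mp h]
    _ = (2 * K + 1) * Real.log M := by
        have hc : ((S.card : ℤ) : ℝ) = 2 * K + 1 := by
          rw [hS, Int.card_Icc, Int.toNat_of_nonneg (by omega)]
          push_cast
          ring
        rw [Int.cast_natCast] at hc
        rw [Finset.sum_const, nsmul_eq_mul, hc]

/-- A bounded order-connected set of integers of diameter less than `k` is a half-open interval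
with at most `k` elements. -/
lemma exists_eq_Ico_of_ordConnected {A : Set ℤ} {b c : ℤ} {k : ℕ}
    (hb : ∀ n ∈ A, b ≤ n) (hc : ∀ n ∈ A, n ≤ c) (hA : A.OrdConnected)
    (hdiam : ∀ n ∈ A, ∀ m ∈ A, m - n < k) :
    ∃ a : ℤ, ∃ l : ℕ, l ≤ k ∧ A = {n : ℤ | a ≤ n ∧ n < a + l} := by
  rcases A.eq_empty_or_nonempty with rfl | ⟨n₀, hn₀⟩
  · exact ⟨0, 0, Nat.zero_le _, by ext n; simp⟩
  obtain ⟨u, huA, hu⟩ := Int.exists_least_of_bdd (P := (· ∈ A)) ⟨b, hb⟩ ⟨n₀, hn₀⟩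
  obtain ⟨v, hvA, hv⟩ := Int.exists_greatest_of_bdd (P := (· ∈ A)) ⟨c, hc⟩ ⟨n₀, hn₀⟩
  have huv := hu v hvA
  have hk := hdiam u huA v hvA
  refine ⟨u, (v - u + 1).toNat, by omega, ?_⟩
  ext n
  refine ⟨fun hn => ?_, fun ⟨h₁, h₂⟩ => hA.out huA hvA ⟨h₁, by omega⟩⟩
  have h₁ := hu n hn
  have h₂ := hv n hn
  exact ⟨h₁, by omega⟩

theorem stmt2 :
    ∀ ε : ℝ, ε ∈ Set.Ioo (0 : ℝ) 1 → ∃ N₀ : ℕ,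
      ∀ N : ℕ, N₀ < N → ∀ y : ℝ,
        (16 * Real.log N) ^ (1 / ε) ≤ y → y ≤ N →
        ∀ Ps : Finset ℕ,
          (∀ p ∈ Ps, Nat.Prime p ∧ y ≤ (p : ℝ) ∧ (p : ℝ) ≤ 2 * y) →
          4 * (2 * y) ^ (1 - ε) * Real.log N / Real.log y ≤ (Ps.card : ℝ) →
          ∀ I : (p : ℕ) → Set (ZMod p),
            (∀ p ∈ Ps, ∃ k : ℕ, (k : ℝ) ≤ (p : ℝ) ^ (1 - ε) + 1 ∧
              IsZModIntervalLen p (I p) k) →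
            ∀ A : Set ℤ,
              A = {n : ℤ | 0 ≤ n ∧ n ≤ (N : ℤ) ∧ ∀ p ∈ Ps, (n : ZMod p) ∈ I p} →
              ∀ p₀ : ℕ, p₀ ∈ Ps → (∀ p ∈ Ps, p₀ ≤ p) →
                ∃ a : ℤ, ∃ k : ℕ, (k : ℝ) ≤ (p₀ : ℝ) ^ (1 - ε) + 1 ∧
                  A = {n : ℤ | a ≤ n ∧ n < a + k} := by
  rintro ε ⟨hε0, hε1⟩
  refine ⟨27, fun N hN y hy hyN Ps hPs hcard I hI A hA p₀ hp₀ _ => ?_⟩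
  have hNR : (27 : ℝ) < N := by exact_mod_cast hN
  have hlog3 : 1 < Real.log 3 := by
    rw [Real.lt_log_iff_exp_lt (by norm_num)]
    linarith [Real.exp_one_lt_d9]
  have hlogN : 3 * Real.log 3 < Real.log N := by
    have h := Real.log_lt_log (by norm_num) hNR
    rwa [show (27 : ℝ) = 3 ^ 3 by norm_num, Real.log_pow, Nat.cast_ofNat] at h
  have hy1 : 1 < y :=
    (Real.one_lt_rpow (by linarith) (by positivity)).trans_le hy
  have hyε : 16 * Real.log N ≤ y ^ ε := by
    have h := Real.rpow_le_rpow (by positivity) hy hε0.le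
    rwa [← Real.rpow_mul (by linarith), one_div_mul_cancel hε0.ne', Real.rpow_one] at h
  set L : ℝ := (2 * y) ^ (1 - ε) with hL
  have hL1 : 1 ≤ L := Real.one_le_rpow (by linarith) (by linarith)
  have hLy : 2 * L < y := by
    have h₁ : L * (2 * y) ^ ε = 2 * y := by
      rw [hL, ← Real.rpow_add (by linarith)]
      simp
    have h₂ : y ^ ε ≤ (2 * y) ^ ε := Real.rpow_le_rpow (by linarith) (by linarith) hε0.le
    nlinarith
  set K : ℕ := ⌊L⌋₊ with hK
  have hKL : (K : ℝ) ≤ L := Nat.floor_le (by linarith)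
  choose! k hk a ha using hI
  have hmem : ∀ n ∈ A, ∀ p ∈ Ps, ∃ i : ℕ, i < k p ∧ (p : ℤ) ∣ n - (a p + i) := by
    intro n hn p hp
    rw [hA] at hn
    have h := hn.2.2 p hp
    rw [ha p hp] at h
    obtain ⟨i, hi, hin⟩ := h
    exact ⟨i, hi, (ZMod.intCast_eq_intCast_iff_dvd_sub _ _ _).mp hin⟩
  have hkK : ∀ p ∈ Ps, k p ≤ K + 1 := by
    intro p hp
    have h : (p : ℝ) ^ (1 - ε) ≤ L :=
      Real.rpow_le_rpow (by positivity) (hPs p hp).2.2 (by linarith)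
    have h₁ := hk p hp
    rw [hK, ← Nat.floor_add_one (by linarith)]
    exact Nat.le_floor (by linarith)
  have hKp : ∀ p ∈ Ps, 2 * K < p := by
    intro p hp
    have h := (hPs p hp).2.1
    have : (2 * K : ℝ) < p := by linarith
    exact_mod_cast this
  have hdiff : ∀ n ∈ A, ∀ m ∈ A, n ≤ m → m - n ≤ K := by
    intro n hn m hm hnm
    by_contra hcon
    have hnA := hn
    have hmA := hm
    rw [hA] at hnA hmA
    have hdN : m - n ≤ N := by linarith [hnA.1, hmA.2.1]
    have hbound := card_mul_log_le_of_near_multiples (P := Ps) (M := 3 * N) (d := m - n) (K := K)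
      hy1 (fun p hp => ⟨(hPs p hp).1, (hPs p hp).2.1⟩) ?_
      (by rwa [abs_of_nonneg (by linarith)]) ?_
    · rw [Real.log_mul (by norm_num) (by linarith)] at hbound
      rw [div_le_iff₀ (Real.log_pos hy1)] at hcard
      nlinarith
    · intro p hp
      obtain ⟨i, hi, hin⟩ := hmem n hn p hp
      obtain ⟨j, hj, hjm⟩ := hmem m hm p hp
      have := hkK p hp
      refine ⟨j - i, abs_le.mpr ⟨by omega, by omega⟩, ?_⟩
      rw [show m - n - ((j : ℤ) - i) = (m - (a p + j)) - (n - (a p + i)) by ring]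
      exact dvd_sub hjm hin
    · intro j hj
      have hjR : |(j : ℝ)| ≤ K := by exact_mod_cast hj
      have hdR : ((m - n : ℤ) : ℝ) ≤ N := by exact_mod_cast hdN
      have hd0 : (0 : ℝ) ≤ ((m - n : ℤ) : ℝ) := by exact_mod_cast sub_nonneg.mpr hnm
      rw [Int.cast_sub (m - n) j]
      rw [abs_le] at hjR ⊢
      constructor <;> linarith
  have hlift : ∀ n ∈ A, ∀ m ∈ A, n ≤ m → ∀ p ∈ Ps,
      ∃ i j : ℕ, j < k p ∧ (p : ℤ) ∣ n - (a p + i) ∧ m - n = j - i := by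
    intro n hn m hm hnm p hp
    obtain ⟨i, hi, hin⟩ := hmem n hn p hp
    obtain ⟨j, hj, hjm⟩ := hmem m hm p hp
    refine ⟨i, j, hj, hin, ?_⟩
    have hdvd : (p : ℤ) ∣ (m - n) - (j - i) := by
      rw [show m - n - ((j : ℤ) - i) = (m - (a p + j)) - (n - (a p + i)) by ring]
      exact dvd_sub hjm hin
    have h₁ := hdiff n hn m hm hnm
    have h₂ := hkK p hp
    have h₃ := hKp p hp
    have := Int.eq_zero_of_abs_lt_dvd hdvd (abs_lt.mpr ⟨by omega, by omega⟩)
    omega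
  have hconn : A.OrdConnected := by
    refine ⟨fun n hn m hm x ⟨hnx, hxm⟩ => ?_⟩
    have hnA := hn
    have hmA := hm
    rw [hA] at hnA hmA ⊢
    refine ⟨hnA.1.trans hnx, hxm.trans hmA.2.1, fun p hp => ?_⟩
    obtain ⟨i, j, hj, hin, hij⟩ := hlift n hn m hm (hnx.trans hxm) p hp
    rw [ha p hp]
    refine ⟨i + (x - n).toNat, ?_, ?_⟩
    · change i + (x - n).toNat < k p
      omega
    · refine (ZMod.intCast_eq_intCast_iff_dvd_sub _ _ _).mpr ?_
      convert hin using 1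
      push_cast
      rw [Int.toNat_of_nonneg (by linarith)]
      ring
  obtain ⟨b, l, hl, hAl⟩ := exists_eq_Ico_of_ordConnected (A := A) (b := 0) (c := N) (k := k p₀)
    (fun n hn => by rw [hA] at hn; exact hn.1) (fun n hn => by rw [hA] at hn; exact hn.2.1) hconn
    fun n hn m hm => by
      rcases le_total n m with h | h
      · obtain ⟨i, j, hj, -, hij⟩ := hlift n hn m hm h p₀ hp₀
        omega
      · obtain ⟨i, j, hj, -⟩ := hlift m hm n hn h p₀ hp₀
        omega
  exact ⟨b, l, (Nat.cast_le.mpr hl).trans (hk p₀ hp₀), hAl⟩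
end

section
/- There exists an absolute constant c > 0 and, for each ε ∈ (0, 1/2), a threshold N₀(ε), such that the following holds. Let k be a positive integer, let N > N₀(ε) be an integer, and let y be a real number with (log N)^{1/ε} ≤ y ≤ N. For each prime p ∈ [y, 2y], let R_p^{(1)}, …, R_p^{(k)} ⊆ ℤ/pℤ be arithmetic progressions each of length at most p^{1/2−ε}, and set R_p = R_p^{(1)} ∪ ⋯ ∪ R_p^{(k)}. Let A be the set of all integers n ∈ {0, 1, …, N} such that for every prime p ∈ [y, 2y] the residue of n mod p lies in R_p. Then A is contained in a union of k arithmetic progressions of integers, each of length at most exp(exp(c·k·log k / ε))·y^{1/2−ε}. -/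
theorem card_filter_prime_dvd_le_log (P : Finset ℕ) (hP : ∀ p ∈ P, p.Prime) {W : ℤ} (hW : W ≠ 0)
    {X : ℕ} (hX : W.natAbs ≤ X) : (P.filter fun p : ℕ => (p : ℤ) ∣ W).card ≤ Nat.log 2 X := by
  have hW' : W.natAbs ≠ 0 := Int.natAbs_ne_zero.mpr hW
  have hsub : (P.filter fun p : ℕ => (p : ℤ) ∣ W) ⊆ W.natAbs.primeFactors := by
    intro p hp
    rw [Finset.mem_filter] at hp
    exact Nat.mem_primeFactors.mpr ⟨hP p hp.1, Int.natCast_dvd.mp hp.2, hW'⟩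
  refine (Finset.card_le_card hsub).trans ?_
  refine Nat.le_log_of_pow_le one_lt_two ?_
  calc 2 ^ W.natAbs.primeFactors.card ≤ ∏ p ∈ W.natAbs.primeFactors, p :=
        Finset.pow_card_le_prod _ _ _ fun p hp => (Nat.prime_of_mem_primeFactors hp).two_le
    _ ≤ W.natAbs := Nat.le_of_dvd (Nat.pos_of_ne_zero hW') (Nat.prod_primeFactors_dvd _)
    _ ≤ X := hX

/-- The largest distance between two elements of `B`. -/
def maxDist (B : Finset ℤ) : ℕ := (B ×ˢ B).sup fun x => (x.1 - x.2).natAbs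

/-- The greatest common divisor of all differences of elements of `B`. -/
def diffGcd (B : Finset ℤ) : ℕ := (B ×ˢ B).gcd fun x => (x.1 - x.2).natAbs

theorem natAbs_sub_le_maxDist {B : Finset ℤ} {x y : ℤ} (hx : x ∈ B) (hy : y ∈ B) :
    (x - y).natAbs ≤ maxDist B :=
  Finset.le_sup (f := fun x : ℤ × ℤ => (x.1 - x.2).natAbs) (Finset.mk_mem_product hx hy)

theorem maxDist_le_iff {B : Finset ℤ} {d : ℕ} :
    maxDist B ≤ d ↔ ∀ x ∈ B, ∀ y ∈ B, (x - y).natAbs ≤ d := by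
  rw [maxDist, Finset.sup_le_iff]
  exact ⟨fun h x hx y hy => h _ (Finset.mk_mem_product hx hy),
    fun h x hx => h _ (Finset.mem_product.mp hx).1 _ (Finset.mem_product.mp hx).2⟩

theorem diffGcd_dvd_natAbs_sub {B : Finset ℤ} {x y : ℤ} (hx : x ∈ B) (hy : y ∈ B) :
    diffGcd B ∣ (x - y).natAbs :=
  Finset.gcd_dvd (f := fun x : ℤ × ℤ => (x.1 - x.2).natAbs) (Finset.mk_mem_product hx hy)

theorem maxDist_mono {B C : Finset ℤ} (h : B ⊆ C) : maxDist B ≤ maxDist C :=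
  maxDist_le_iff.mpr fun _ hx _ hy => natAbs_sub_le_maxDist (h hx) (h hy)

theorem diffGcd_anti {B C : Finset ℤ} (h : B ⊆ C) : diffGcd C ∣ diffGcd B :=
  Finset.gcd_mono (Finset.product_subset_product h h)

theorem maxDist_eq_zero {B : Finset ℤ} (h : B.card ≤ 1) : maxDist B = 0 := by
  refine Nat.le_zero.mp (maxDist_le_iff.mpr fun x hx y hy => ?_)
  rw [Finset.card_le_one.mp h x hx y hy]
  simp

theorem diffGcd_pos {B : Finset ℤ} (h : 1 < B.card) : 0 < diffGcd B := by
  obtain ⟨x, hx, y, hy, hxy⟩ := Finset.one_lt_card.mp h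
  exact Nat.pos_of_dvd_of_pos (diffGcd_dvd_natAbs_sub hx hy) (by omega)

theorem maxDist_pos {B : Finset ℤ} (h : 1 < B.card) : 0 < maxDist B := by
  obtain ⟨x, hx, y, hy, hxy⟩ := Finset.one_lt_card.mp h
  have := natAbs_sub_le_maxDist hx hy
  omega

theorem diffGcd_le_maxDist {B : Finset ℤ} (h : 1 < B.card) : diffGcd B ≤ maxDist B := by
  obtain ⟨x, hx, y, hy, hxy⟩ := Finset.one_lt_card.mp h
  exact (Nat.le_of_dvd (by omega) (diffGcd_dvd_natAbs_sub hx hy)).trans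
    (natAbs_sub_le_maxDist hx hy)

/-- If the parametrising indices `j` are proportional to the elements of `B`, then `B` lies in an
arithmetic progression at most as long as the range of the indices. -/
theorem maxDist_le_diffGcd_mul_of_proportional {B : Finset ℤ} {L : ℕ} {j : ℤ → ℕ}
    (hj : ∀ n ∈ B, j n < L) {x y : ℤ} (hx : x ∈ B) (hy : y ∈ B) (hjxy : j y ≠ j x)
    (h : ∀ s ∈ B, ((j s : ℤ) - j x) * (y - x) = ((j y : ℤ) - j x) * (s - x)) :
    maxDist B ≤ diffGcd B * (L - 1) := by
  have hδ : (j y : ℤ) - j x ≠ 0 := sub_ne_zero.mpr (by exact_mod_cast hjxy)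
  have hst : ∀ s ∈ B, ∀ t ∈ B,
      ((j y : ℤ) - j x) * (s - t) = ((j s : ℤ) - j t) * (y - x) := by
    intro s hs t ht
    linear_combination (h t ht) - (h s hs)
  have habs : ∀ s ∈ B, ∀ t ∈ B, ((j y : ℤ) - j x).natAbs * (s - t).natAbs =
      ((j s : ℤ) - j t).natAbs * (y - x).natAbs := by
    intro s hs t ht
    rw [← Int.natAbs_mul, ← Int.natAbs_mul, hst s hs t ht]
  have hdvd : (y - x).natAbs ∣ ((j y : ℤ) - j x).natAbs * diffGcd B := by
    have h1 : (y - x).natAbs ∣ (B ×ˢ B).gcd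
        fun z => ((j y : ℤ) - j x).natAbs * (z.1 - z.2).natAbs := by
      refine Finset.dvd_gcd fun z hz => ?_
      rw [Finset.mem_product] at hz
      rw [habs _ hz.1 _ hz.2]
      exact Dvd.intro_left _ rfl
    rwa [Finset.gcd_mul_left, normalize_eq] at h1
  have hg : 0 < diffGcd B :=
    diffGcd_pos (Finset.one_lt_card.mpr ⟨x, hx, y, hy, fun h => hjxy (by rw [h])⟩)
  have hle := Nat.le_of_dvd (Nat.mul_pos (Int.natAbs_pos.mpr hδ) hg) hdvd
  refine maxDist_le_iff.mpr fun s hs t ht => ?_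
  have hjst : ((j s : ℤ) - j t).natAbs ≤ L - 1 := by
    have := hj s hs
    have := hj t ht
    omega
  refine Nat.le_of_mul_le_mul_left ?_ (Int.natAbs_pos.mpr hδ)
  calc ((j y : ℤ) - j x).natAbs * (s - t).natAbs
      = ((j s : ℤ) - j t).natAbs * (y - x).natAbs := habs s hs t ht
    _ ≤ (L - 1) * (((j y : ℤ) - j x).natAbs * diffGcd B) := Nat.mul_le_mul hjst hle
    _ = _ := by ring

/-- A small set of integers that lies, modulo many primes, in progressions of length at most `L`
lies in a progression of length at most `L`. -/
theorem maxDist_le_diffGcd_mul {P : Finset ℕ} (hP : ∀ p ∈ P, p.Prime) {N L : ℕ}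
    {B : Finset ℤ} (hB : ∀ n ∈ B, 0 ≤ n ∧ n ≤ (N : ℤ))
    (hAP : ∀ p ∈ P, ∃ a d : ZMod p, ∀ n ∈ B, ∃ j : ℕ, j < L ∧ (n : ZMod p) = a + (j : ZMod p) * d)
    (hcard : B.card * (2 * L + 1) ^ 2 * Nat.log 2 (2 * L * N) < P.card) :
    maxDist B ≤ diffGcd B * (L - 1) := by
  rcases Nat.lt_or_ge 1 B.card with h1 | h1
  swap
  · simp [maxDist_eq_zero h1]
  obtain ⟨x, hx, y, hy, hxy⟩ := Finset.one_lt_card.mp h1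
  let I : Finset (ℤ × ℤ × ℤ) :=
    B ×ˢ (Finset.Icc (-(L : ℤ)) L ×ˢ Finset.Icc (-(L : ℤ)) L)
  let W : ℤ × ℤ × ℤ → ℤ := fun z => z.2.1 * (y - x) - z.2.2 * (z.1 - x)
  let bad : Finset ℕ := (I.filter fun z => W z ≠ 0).biUnion fun z =>
    P.filter fun p : ℕ => (p : ℤ) ∣ W z
  have hI : I.card = B.card * (2 * L + 1) ^ 2 := by
    simp only [I, Finset.card_product, Int.card_Icc]
    rw [show ((L : ℤ) + 1 - -(L : ℤ)).toNat = 2 * L + 1 by omega]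
    ring
  have hWle : ∀ z ∈ I, (W z).natAbs ≤ 2 * L * N := by
    intro z hz
    simp only [I, Finset.mem_product, Finset.mem_Icc] at hz
    obtain ⟨hz1, ⟨hu1, hu2⟩, hv1, hv2⟩ := hz
    have := hB x hx
    have := hB y hy
    have := hB _ hz1
    have e1 : |z.2.1 * (y - x)| ≤ L * N := by
      rw [abs_mul]
      exact mul_le_mul (abs_le.mpr ⟨hu1, hu2⟩) (abs_le.mpr ⟨by omega, by omega⟩) (abs_nonneg _)
        (by positivity)
    have e2 : |z.2.2 * (z.1 - x)| ≤ L * N := by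
      rw [abs_mul]
      exact mul_le_mul (abs_le.mpr ⟨hv1, hv2⟩) (abs_le.mpr ⟨by omega, by omega⟩) (abs_nonneg _)
        (by positivity)
    have e3 : |W z| ≤ 2 * L * N := (abs_sub _ _).trans (by linarith)
    zify
    exact e3
  have hbad : bad.card ≤ B.card * (2 * L + 1) ^ 2 * Nat.log 2 (2 * L * N) := by
    rw [← hI]
    refine (Finset.card_biUnion_le_card_mul _ _ _ fun z hz => ?_).trans
      (Nat.mul_le_mul_right _ (Finset.card_filter_le _ _))
    rw [Finset.mem_filter] at hz
    exact card_filter_prime_dvd_le_log P hP hz.2 (hWle z hz.1)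
  obtain ⟨p, hpP, hpb⟩ := Finset.exists_mem_notMem_of_card_lt_card (hbad.trans_lt hcard)
  have hgood : ∀ z ∈ I, (p : ℤ) ∣ W z → W z = 0 := by
    intro z hz hd
    by_contra hne
    exact hpb (Finset.mem_biUnion.mpr ⟨z, Finset.mem_filter.mpr ⟨hz, hne⟩,
      Finset.mem_filter.mpr ⟨hpP, hd⟩⟩)
  obtain ⟨a, d, had⟩ := hAP p hpP
  choose! j hjL hj using had
  have hLpos : 0 < L := (Nat.zero_le _).trans_lt (hjL x hx)
  have hjne : j y ≠ j x := by
    intro he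
    have h0 := hgood (y, 1, 0) (by simp [I, hy]; omega) (by
      rw [← ZMod.intCast_zmod_eq_zero_iff_dvd]
      simp only [W]
      push_cast
      rw [hj x hx, hj y hy, he]
      ring)
    simp only [W] at h0
    omega
  refine maxDist_le_diffGcd_mul_of_proportional hjL hx hy hjne fun s hs => ?_
  have h0 := hgood (s, (j s : ℤ) - j x, (j y : ℤ) - j x) (by
    have := hjL x hx
    have := hjL y hy
    have := hjL s hs
    simp only [I, Finset.mem_product, Finset.mem_Icc]
    exact ⟨hs, ⟨by omega, by omega⟩, by omega, by omega⟩) (by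
      rw [← ZMod.intCast_zmod_eq_zero_iff_dvd]
      simp only [W]
      push_cast
      rw [hj x hx, hj y hy, hj s hs]
      ring)
  simp only [W] at h0
  linarith

/-- A measure of the size of the shortest progression containing `B`, on a logarithmic scale. -/
noncomputable def progRank (Q : ℝ) (B : Finset ℤ) : ℝ :=
  if B.card ≤ 1 then B.card else 2 + Real.logb Q (maxDist B / diffGcd B)

theorem two_le_progRank {Q : ℝ} (hQ : 1 < Q) {B : Finset ℤ} (h : 1 < B.card) :
    2 ≤ progRank Q B := by
  rw [progRank, if_neg (by omega)]
  have h1 : (1 : ℝ) ≤ maxDist B / diffGcd B := by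
    rw [one_le_div (by exact_mod_cast diffGcd_pos h)]
    exact_mod_cast diffGcd_le_maxDist h
  linarith [Real.logb_nonneg hQ h1]

theorem progRank_le {Q : ℝ} (hQ : 1 < Q) {B : Finset ℤ} {L : ℕ} (hL : 0 < L)
    (h : maxDist B ≤ diffGcd B * (L - 1)) : progRank Q B ≤ 2 + Real.logb Q L := by
  have h0 : 0 ≤ Real.logb Q L := Real.logb_nonneg hQ (by exact_mod_cast hL)
  rcases Nat.lt_or_ge 1 B.card with h1 | h1
  · rw [progRank, if_neg (by omega)]
    have hg : (0 : ℝ) < diffGcd B := by exact_mod_cast diffGcd_pos h1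
    have hD : (0 : ℝ) < maxDist B := by exact_mod_cast maxDist_pos h1
    have : (maxDist B / diffGcd B : ℝ) ≤ L := by
      rw [div_le_iff₀ hg]
      have : maxDist B ≤ L * diffGcd B :=
        h.trans (by rw [mul_comm]; exact Nat.mul_le_mul_right _ (Nat.sub_le _ _))
      exact_mod_cast this
    linarith [Real.logb_le_logb_of_le hQ (div_pos hD hg) this]
  · rw [progRank, if_pos h1]
    have : (B.card : ℝ) ≤ 1 := by exact_mod_cast h1
    linarith

theorem exists_isIntAPLen_superset (a : ℤ) {h : ℕ} (hh : 0 < h) {x y : ℝ} (hx : 0 ≤ x)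
    (hy : 0 ≤ y) :
    ∃ m : ℕ, (m : ℝ) ≤ (x + y) / h + 1 ∧ ∃ S : Set ℤ, IsIntAPLen S m ∧
      {n : ℤ | (h : ℤ) ∣ n - a ∧ (a : ℝ) - x ≤ n ∧ (n : ℝ) ≤ a + y} ⊆ S := by
  have hh' : (0 : ℝ) < h := by exact_mod_cast hh
  have hfx := Nat.floor_le (div_nonneg hx hh'.le)
  have hfy := Nat.floor_le (div_nonneg hy hh'.le)
  refine ⟨⌊x / h⌋₊ + ⌊y / h⌋₊ + 1, ?_, _, ⟨a - ⌊x / h⌋₊ * h, h, rfl⟩, ?_⟩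
  · push_cast
    rw [add_div]
    linarith
  · rintro n ⟨⟨c, hc⟩, hn1, hn2⟩
    have hnc : (n : ℝ) = a + h * c := by
      have : n = a + h * c := by linarith
      exact_mod_cast this
    have h1 : -(⌊x / h⌋₊ : ℤ) ≤ c := by
      rcases le_or_gt 0 c with h0 | h0
      · omega
      · have : (-c).toNat ≤ ⌊x / h⌋₊ := by
          rw [Nat.le_floor_iff (div_nonneg hx hh'.le), le_div_iff₀ hh']
          have : (((-c).toNat : ℤ) : ℝ) = -c := by
            rw [Int.toNat_of_nonneg (by omega)]; push_cast; rfl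
          rw [Int.cast_natCast] at this
          rw [this]
          nlinarith
        omega
    have h2 : c ≤ ⌊y / h⌋₊ := by
      rcases le_or_gt c 0 with h0 | h0
      · omega
      · have : c.toNat ≤ ⌊y / h⌋₊ := by
          rw [Nat.le_floor_iff (div_nonneg hy hh'.le), le_div_iff₀ hh']
          have : ((c.toNat : ℤ) : ℝ) = c := by
            rw [Int.toNat_of_nonneg (by omega)]
          rw [Int.cast_natCast] at this
          rw [this]
          nlinarith
        omega
    refine ⟨(c + ⌊x / h⌋₊).toNat, ?_, ?_⟩
    · simp only [Set.mem_ofPred_eq]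
      omega
    · simp only
      rw [Int.toNat_of_nonneg (by omega)]
      linarith

/-- The integers whose insertion into `B` does not increase the rank by at least one
lie in a single progression, not much longer than the one containing `B`. -/
theorem exists_isIntAPLen_of_progRank_insert_lt {Q : ℝ} (hQ : 1 < Q) {B : Finset ℤ} {L : ℕ}
    (hL : 0 < L) (h : maxDist B ≤ diffGcd B * (L - 1)) :
    ∃ m : ℕ, (m : ℝ) ≤ (2 * Q - 1) * (⌊Q⌋₊.factorial : ℝ) * L ∧ ∃ S : Set ℤ, IsIntAPLen S m ∧
      {n : ℤ | progRank Q (insert n B) < progRank Q B + 1} ⊆ S := by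
  have hF : (1 : ℝ) ≤ (⌊Q⌋₊.factorial : ℝ) := by
    exact_mod_cast Nat.factorial_pos ⌊Q⌋₊
  have hL1 : (1 : ℝ) ≤ L := by exact_mod_cast hL
  have hQF : 1 ≤ (2 * Q - 1) * (⌊Q⌋₊.factorial : ℝ) := by nlinarith
  have hQFL : 1 ≤ (2 * Q - 1) * (⌊Q⌋₊.factorial : ℝ) * L := by nlinarith
  rcases Nat.lt_or_ge 1 B.card with h1 | h1
  swap
  · rcases B.eq_empty_or_nonempty with rfl | ⟨b, hb⟩
    · refine ⟨0, by push_cast; linarith, _, ⟨0, 0, rfl⟩, fun n hn => ?_⟩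
      simp [progRank] at hn
    · refine ⟨1, by push_cast; linarith, _, ⟨b, 0, rfl⟩, fun n hn => ?_⟩
      by_cases hnb : n = b
      · exact ⟨0, by simp, by simp [hnb]⟩
      · exfalso
        have := two_le_progRank hQ (B := insert n B) (Finset.one_lt_card.mpr
          ⟨n, Finset.mem_insert_self _ _, b, Finset.mem_insert_of_mem hb, hnb⟩)
        simp only [Set.mem_ofPred_eq, progRank.eq_1 Q B, if_pos h1] at hn
        have : (B.card : ℝ) ≤ 1 := by exact_mod_cast h1
        linarith
  have hg : 0 < diffGcd B := diffGcd_pos h1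
  have hne : B.Nonempty := Finset.card_pos.mp (by omega)
  let h' := diffGcd B / (diffGcd B).gcd ⌊Q⌋₊.factorial
  have hgcd : 0 < (diffGcd B).gcd ⌊Q⌋₊.factorial := Nat.gcd_pos_of_pos_left _ hg
  have hh' : h' * (diffGcd B).gcd ⌊Q⌋₊.factorial = diffGcd B :=
    Nat.div_mul_cancel (Nat.gcd_dvd_left _ _)
  have hh0 : 0 < h' := Nat.pos_of_ne_zero fun h0 => by rw [h0] at hh'; omega
  have hhF : diffGcd B ≤ h' * ⌊Q⌋₊.factorial := by
    conv_lhs => rw [← hh']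
    exact Nat.mul_le_mul_left _ (Nat.le_of_dvd (Nat.factorial_pos _) (Nat.gcd_dvd_right _ _))
  have hDh : (maxDist B : ℝ) / h' ≤ ⌊Q⌋₊.factorial * (L - 1) := by
    rw [div_le_iff₀ (by exact_mod_cast hh0)]
    have : maxDist B ≤ ⌊Q⌋₊.factorial * (L - 1) * h' :=
      h.trans ((Nat.mul_le_mul_right _ hhF).trans (le_of_eq (by ring)))
    have hc : ((L - 1 : ℕ) : ℝ) = (L : ℝ) - 1 := by
      rw [Nat.cast_sub (by omega)]; simp
    rw [← hc]
    exact_mod_cast this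
  have hmm : ((B.max' hne - B.min' hne).natAbs) = maxDist B := by
    refine le_antisymm (natAbs_sub_le_maxDist (B.max'_mem _) (B.min'_mem _)) ?_
    refine maxDist_le_iff.mpr fun x hx y hy => ?_
    have := B.le_max' x hx
    have := B.le_max' y hy
    have := B.min'_le x hx
    have := B.min'_le y hy
    omega
  have hD0 : (0 : ℝ) < maxDist B := by exact_mod_cast maxDist_pos h1
  obtain ⟨m, hm, S, hS, hsub⟩ := exists_isIntAPLen_superset (B.min' hne) hh0
    (x := (Q - 1) * maxDist B) (y := Q * maxDist B) (by nlinarith) (by nlinarith)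
  refine ⟨m, hm.trans ?_, S, hS, fun n hn => hsub ?_⟩
  · calc ((Q - 1) * maxDist B + Q * maxDist B) / h' + 1
        = (2 * Q - 1) * (maxDist B / h') + 1 := by ring
      _ ≤ (2 * Q - 1) * (⌊Q⌋₊.factorial * (L - 1)) + 1 := by
        have : 0 ≤ 2 * Q - 1 := by linarith
        gcongr
      _ ≤ _ := by linarith
  · have h2 : 1 < (insert n B).card :=
      h1.trans_le (Finset.card_le_card (Finset.subset_insert _ _))
    have hg' : 0 < diffGcd (insert n B) := diffGcd_pos h2
    have hD' := maxDist_mono (Finset.subset_insert n B)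
    obtain ⟨q, hq⟩ := diffGcd_anti (Finset.subset_insert n B)
    have hq0 : 0 < q := Nat.pos_of_ne_zero fun h0 => by rw [h0] at hq; omega
    have hg'R : (0 : ℝ) < diffGcd (insert n B) := by exact_mod_cast hg'
    have hgR : (0 : ℝ) < diffGcd B := by exact_mod_cast hg
    have hD'R : (maxDist B : ℝ) ≤ maxDist (insert n B) := by exact_mod_cast hD'
    have hlt : (maxDist (insert n B) : ℝ) * q < Q * maxDist B := by
      simp only [Set.mem_ofPred_eq, progRank, if_neg (Nat.not_le.mpr h1),
        if_neg (Nat.not_le.mpr h2)] at hn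
      have hlog : Real.logb Q (maxDist (insert n B) / diffGcd (insert n B)) <
          Real.logb Q (Q * (maxDist B / diffGcd B)) := by
        rw [Real.logb_mul (by linarith) (by positivity), Real.logb_self_eq_one hQ]
        linarith
      rw [Real.logb_lt_logb_iff hQ (div_pos (hD0.trans_le hD'R) hg'R)
        (by positivity)] at hlog
      rw [← mul_div_assoc, div_lt_div_iff₀ hg'R hgR, hq] at hlog
      push_cast at hlog
      nlinarith
    have hqQ : (q : ℝ) ≤ Q := by
      have : (maxDist B : ℝ) * q ≤ maxDist (insert n B) * q := by gcongr
      nlinarith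
    have hqF : q ∣ ⌊Q⌋₊.factorial := Nat.dvd_factorial hq0 (Nat.le_floor hqQ)
    have hDQ : (maxDist (insert n B) : ℝ) ≤ Q * maxDist B := by
      have : (1 : ℝ) ≤ q := by exact_mod_cast hq0
      nlinarith [hD0.trans_le hD'R]
    have hdvd : h' ∣ diffGcd (insert n B) := by
      refine Nat.dvd_of_mul_dvd_mul_right hgcd ?_
      rw [hh', hq]
      exact Nat.mul_dvd_mul_left _ (Nat.dvd_gcd (by exact Dvd.intro_left _ rfl) hqF)
    have hmin := Finset.mem_insert_of_mem (b := n) (B.min'_mem hne)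
    have hmax := Finset.mem_insert_of_mem (b := n) (B.max'_mem hne)
    have hn' := Finset.mem_insert_self n B
    refine ⟨?_, ?_, ?_⟩
    · exact Int.natCast_dvd.mpr (hdvd.trans (diffGcd_dvd_natAbs_sub hn' hmin))
    · have e : ((B.max' hne - n : ℤ) : ℝ) ≤ maxDist (insert n B) := by
        have := natAbs_sub_le_maxDist hmax hn'
        have : B.max' hne - n ≤ (maxDist (insert n B) : ℤ) := by omega
        exact_mod_cast this
      have e2 : (B.max' hne : ℝ) = B.min' hne + maxDist B := by
        have := B.min'_le _ (B.max'_mem hne)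
        have : B.max' hne = B.min' hne + (maxDist B : ℤ) := by omega
        exact_mod_cast this
      push_cast at e
      linarith
    · have e : ((n - B.min' hne : ℤ) : ℝ) ≤ maxDist (insert n B) := by
        have := natAbs_sub_le_maxDist hn' hmin
        have : n - B.min' hne ≤ (maxDist (insert n B) : ℤ) := by omega
        exact_mod_cast this
      push_cast at e
      linarith

/-- Greedy construction: elements of `A` are successively put into a class which is correct for a
large proportion of the remaining indices `p`, as long as each class would see its rank increase. -/
theorem exists_saturated_classes {ι : Type*} [Fintype ι] [Nonempty ι] [DecidableEq ι]
    (φ : Finset ℤ → ℝ) (hφ : φ ∅ = 0) (P : Finset ℕ) (col : ℕ → ι → Set ℤ) (A : Set ℤ)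
    (hcol : ∀ p ∈ P, ∀ n ∈ A, ∃ i, n ∈ col p i) (T : ℕ) :
    ∃ t ≤ T, ∃ B : ι → Finset ℤ, ∃ P' ⊆ P, P.card ≤ Fintype.card ι ^ t * P'.card ∧
      (∀ i, (B i).card ≤ t) ∧ (∀ i, ∀ n ∈ B i, n ∈ A ∧ ∀ p ∈ P', n ∈ col p i) ∧
      ((∀ n ∈ A, ∃ i, φ (insert n (B i)) < φ (B i) + 1) ∨ (T : ℝ) ≤ ∑ i, φ (B i)) := by
  induction T with
  | zero =>
    exact ⟨0, le_rfl, fun _ => ∅, P, subset_rfl, by simp, by simp, by simp, Or.inr (by simp [hφ])⟩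
  | succ T ih =>
    obtain ⟨t, htT, B, P', hP', hcard, hBt, hBA, hor⟩ := ih
    by_cases hsat : ∀ n ∈ A, ∃ i, φ (insert n (B i)) < φ (B i) + 1
    · exact ⟨t, htT.trans (Nat.le_succ _), B, P', hP', hcard, hBt, hBA, Or.inl hsat⟩
    have hT := hor.resolve_left hsat
    push Not at hsat
    obtain ⟨n, hnA, hn⟩ := hsat
    have : ∀ p, ∃ i, p ∈ P' → n ∈ col p i := by
      intro p
      by_cases hp : p ∈ P'
      · obtain ⟨i, hi⟩ := hcol p (hP' hp) n hnA
        exact ⟨i, fun _ => hi⟩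
      · exact ⟨Classical.arbitrary ι, fun h => absurd h hp⟩
    choose f hf using this
    obtain ⟨i, -, hi⟩ : ∃ i ∈ (Finset.univ : Finset ι),
        P'.card ≤ Fintype.card ι * (P'.filter fun p => f p = i).card := by
      refine Finset.exists_le_of_sum_le Finset.univ_nonempty ?_
      rw [← Finset.mul_sum, ← Finset.card_eq_sum_card_fiberwise fun _ _ => Finset.mem_univ _]
      simp
    refine ⟨t + 1, by omega, Function.update B i (insert n (B i)), P'.filter fun p => f p = i,
      (Finset.filter_subset _ _).trans hP', ?_, ?_, ?_, Or.inr ?_⟩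
    · calc P.card ≤ Fintype.card ι ^ t * P'.card := hcard
        _ ≤ Fintype.card ι ^ t * (Fintype.card ι * _) := Nat.mul_le_mul_left _ hi
        _ = _ := by ring
    · intro i'
      rcases eq_or_ne i' i with rfl | hne
      · rw [Function.update_self]
        exact (Finset.card_insert_le _ _).trans (Nat.succ_le_succ (hBt _))
      · rw [Function.update_of_ne hne]
        exact (hBt _).trans (Nat.le_succ _)
    · intro i' n' hn'
      rcases eq_or_ne i' i with rfl | hne
      · rw [Function.update_self, Finset.mem_insert] at hn'
        rcases hn' with rfl | hn'
        · refine ⟨hnA, fun p hp => ?_⟩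
          rw [Finset.mem_filter] at hp
          rw [← hp.2]
          exact hf p hp.1
        · exact ⟨(hBA _ _ hn').1, fun p hp => (hBA _ _ hn').2 p (Finset.mem_filter.mp hp).1⟩
      · rw [Function.update_of_ne hne] at hn'
        exact ⟨(hBA _ _ hn').1, fun p hp => (hBA _ _ hn').2 p (Finset.mem_filter.mp hp).1⟩
    · have hsum : ∑ j, φ (B j) + 1 ≤ ∑ j, φ (Function.update B i (insert n (B i)) j) := by
        rw [← Finset.add_sum_erase _ _ (Finset.mem_univ i),
          ← Finset.add_sum_erase (a := i) _ (fun j => φ (Function.update B i _ j))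
            (Finset.mem_univ i), Function.update_self]
        have : ∑ j ∈ Finset.univ.erase i, φ (Function.update B i (insert n (B i)) j) =
            ∑ j ∈ Finset.univ.erase i, φ (B j) := by
          refine Finset.sum_congr rfl fun j hj => ?_
          rw [Function.update_of_ne (Finset.ne_of_mem_erase hj)]
        rw [this]
        linarith [hn i]
      push_cast
      linarith

/-- Integers lying in `k` short progressions modulo sufficiently many primes are covered by `k`
progressions of integers. -/
theorem exists_cover_of_mod_primes {k N L T : ℕ} (hk : 0 < k) (hL : 0 < L) {Q : ℝ} (hQ : 1 < Q)
    {P : Finset ℕ} (hP : ∀ p ∈ P, p.Prime) {R : (p : ℕ) → Fin k → Set (ZMod p)}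
    (hR : ∀ p ∈ P, ∀ i, ∃ m ≤ L, IsAPZModLen p (R p i) m)
    {A : Set ℤ} (hA : ∀ n ∈ A, 0 ≤ n ∧ n ≤ (N : ℤ))
    (hAR : ∀ p ∈ P, ∀ n ∈ A, ∃ i, (n : ZMod p) ∈ R p i)
    (hT : k * (2 + Real.logb Q L) < T)
    (hcard : k ^ T * (T * (2 * L + 1) ^ 2 * Nat.log 2 (2 * L * N)) < P.card) :
    ∃ S : Fin k → Set ℤ, (∀ i, ∃ m : ℕ, (m : ℝ) ≤ (2 * Q - 1) * (⌊Q⌋₊.factorial : ℝ) * L ∧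
      IsIntAPLen (S i) m) ∧ A ⊆ ⋃ i, S i := by
  have : Nonempty (Fin k) := ⟨⟨0, hk⟩⟩
  obtain ⟨t, htT, B, P', hP', hPP', hBt, hBA, hor⟩ := exists_saturated_classes (progRank Q)
    (by simp [progRank]) P (fun p i => {n : ℤ | (n : ZMod p) ∈ R p i}) A hAR T
  rw [Fintype.card_fin] at hPP'
  have hB : ∀ i, maxDist (B i) ≤ diffGcd (B i) * (L - 1) := by
    intro i
    refine maxDist_le_diffGcd_mul (P := P') (N := N) (fun p hp => hP p (hP' hp))
      (fun n hn => hA n (hBA i n hn).1) ?_ ?_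
    · intro p hp
      obtain ⟨m, hm, a, d, had⟩ := hR p (hP' hp) i
      refine ⟨a, d, fun n hn => ?_⟩
      have h1 : (n : ZMod p) ∈ R p i := (hBA i n hn).2 p hp
      rw [had] at h1
      obtain ⟨j, hj, hj'⟩ := h1
      exact ⟨j, lt_of_lt_of_le hj hm, hj'.symm⟩
    · refine Nat.lt_of_mul_lt_mul_left (a := k ^ T) ?_
      calc k ^ T * ((B i).card * (2 * L + 1) ^ 2 * Nat.log 2 (2 * L * N))
          ≤ k ^ T * (T * (2 * L + 1) ^ 2 * Nat.log 2 (2 * L * N)) := by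
            gcongr
            exact (hBt i).trans htT
        _ < P.card := hcard
        _ ≤ k ^ t * P'.card := hPP'
        _ ≤ k ^ T * P'.card := Nat.mul_le_mul_right _ (Nat.pow_le_pow_right hk htT)
  have hsat : ∀ n ∈ A, ∃ i, progRank Q (insert n (B i)) < progRank Q (B i) + 1 := by
    refine hor.resolve_right fun hle => ?_
    have : ∑ i, progRank Q (B i) ≤ ∑ _i : Fin k, (2 + Real.logb Q L) :=
      Finset.sum_le_sum fun i _ => progRank_le hQ hL (hB i)
    rw [Finset.sum_const, Finset.card_univ, Fintype.card_fin, nsmul_eq_mul] at this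
    linarith
  choose m hm S hS hsub using fun i => exists_isIntAPLen_of_progRank_insert_lt hQ hL (hB i)
  refine ⟨S, fun i => ⟨m i, hm i, hS i⟩, fun n hn => ?_⟩
  obtain ⟨i, hi⟩ := hsat n hn
  exact Set.mem_iUnion.mpr ⟨i, hsub i hi⟩

theorem centralBinom_le_mul_pow_card_primes {n : ℕ} (hn : 2 < n) :
    n.centralBinom ≤ (2 * n) ^ Nat.sqrt (2 * n) * 4 ^ (2 * n / 3) *
      (2 * n) ^ ((Finset.Ioc n (2 * n)).filter Nat.Prime).card := by
  have n2_pos : 1 ≤ 2 * n := by omega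
  let f : ℕ → ℕ := fun x => x ^ n.centralBinom.factorization x
  let small := (Finset.Icc 1 (Nat.sqrt (2 * n))).filter Nat.Prime
  let mid := (Finset.range (2 * n / 3 + 1)).filter fun p => p.Prime ∧ Nat.sqrt (2 * n) < p
  let large := (Finset.Ioc n (2 * n)).filter Nat.Prime
  have hone : ∀ p, f p ≤ 2 * n := fun p => Nat.pow_factorization_choose_le (by omega)
  have hpos : ∀ p, p.Prime → 1 ≤ f p := fun p hp => Nat.one_le_pow _ _ hp.pos
  have hprod : n.centralBinom = ∏ p ∈ (Finset.range (2 * n + 1)).filter Nat.Prime, f p := by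
    rw [Finset.prod_filter_of_ne fun p _ h => ?_]
    · exact n.prod_pow_factorization_centralBinom.symm
    · contrapose! h
      simp only [f]
      rw [Nat.factorization_eq_zero_of_not_prime n.centralBinom h, pow_zero]
  have hsplit : ∏ p ∈ (Finset.range (2 * n + 1)).filter Nat.Prime, f p ≤
      ∏ p ∈ (small ∪ mid) ∪ large, f p := by
    refine le_of_eq_of_le
      (Finset.prod_filter_ne_one (f := f) ((Finset.range (2 * n + 1)).filter Nat.Prime)).symm ?_
    refine Finset.prod_le_prod_of_subset_of_one_le' ?_ ?_
    · intro p hp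
      simp only [Finset.mem_filter, Finset.mem_range] at hp
      obtain ⟨⟨hp2, hpp⟩, hp1⟩ := hp
      simp only [small, mid, large, Finset.mem_union, Finset.mem_filter, Finset.mem_Icc,
        Finset.mem_range, Finset.mem_Ioc]
      have := hpp.pos
      by_cases h1 : p ≤ n
      · by_cases h2 : 2 * n < 3 * p
        · exfalso
          apply hp1
          simp only [f]
          rw [Nat.factorization_centralBinom_of_two_mul_self_lt_three_mul hn h1 h2, pow_zero]
        · left
          by_cases h3 : p ≤ Nat.sqrt (2 * n)
          · exact Or.inl ⟨⟨by omega, h3⟩, hpp⟩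
          · exact Or.inr ⟨by omega, hpp, by omega⟩
      · exact Or.inr ⟨⟨by omega, by omega⟩, hpp⟩
    · intro p hp _
      refine hpos p ?_
      simp only [small, mid, large, Finset.mem_union, Finset.mem_filter] at hp
      tauto
  have hunion : ∀ s t : Finset ℕ, (∀ p ∈ s ∩ t, 1 ≤ f p) →
      ∏ p ∈ s ∪ t, f p ≤ (∏ p ∈ s, f p) * ∏ p ∈ t, f p := by
    intro s t h
    rw [← Finset.prod_union_inter]
    exact Nat.le_mul_of_pos_right _ (Finset.prod_pos h)
  have hsmall : ∏ p ∈ small, f p ≤ (2 * n) ^ Nat.sqrt (2 * n) := by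
    refine (Finset.prod_le_pow_card _ _ _ fun p _ => hone p).trans ?_
    refine Nat.pow_le_pow_right n2_pos ((Finset.card_filter_le _ _).trans ?_)
    simp
  have hmid : ∏ p ∈ mid, f p ≤ 4 ^ (2 * n / 3) := by
    refine le_trans ?_ (primorial_le_four_pow (2 * n / 3))
    calc ∏ p ∈ mid, f p ≤ ∏ p ∈ mid, p := by
          refine Finset.prod_le_prod' fun p hp => ?_
          simp only [mid, Finset.mem_filter] at hp
          exact (Nat.pow_le_pow_right hp.2.1.pos
            (Nat.factorization_choose_le_one (Nat.sqrt_lt'.mp hp.2.2))).trans (pow_one p).le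
      _ ≤ _ := by
          refine Finset.prod_le_prod_of_subset_of_one_le' ?_ ?_
          · intro p hp
            simp only [mid, Finset.mem_filter] at hp ⊢
            exact ⟨hp.1, hp.2.1⟩
          · exact fun p hp _ => (Finset.mem_filter.1 hp).2.one_lt.le
  have hlarge : ∏ p ∈ large, f p ≤ (2 * n) ^ large.card :=
    Finset.prod_le_pow_card _ _ _ fun p _ => hone p
  calc n.centralBinom ≤ ∏ p ∈ (small ∪ mid) ∪ large, f p := hprod.trans_le hsplit
    _ ≤ (∏ p ∈ small ∪ mid, f p) * ∏ p ∈ large, f p := hunion _ _ fun p hp =>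
        hpos p (Finset.mem_filter.mp (Finset.mem_inter.mp hp).2).2
    _ ≤ ((∏ p ∈ small, f p) * ∏ p ∈ mid, f p) * ∏ p ∈ large, f p :=
        Nat.mul_le_mul_right _ (hunion _ _ fun p hp =>
          hpos p (Finset.mem_filter.mp (Finset.mem_inter.mp hp).1).2)
    _ ≤ _ := Nat.mul_le_mul (Nat.mul_le_mul hsmall hmid) hlarge

theorem log_four_mul_le_card_primes {n : ℕ} (hn : 4 ≤ n) :
    (n : ℝ) / 3 * Real.log 4 ≤ (Real.sqrt (2 * n) + 1 +
      (((Finset.Ioc n (2 * n)).filter Nat.Prime).card : ℝ)) * Real.log (2 * n) := by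
  have h := (Nat.four_pow_lt_mul_centralBinom n hn).le.trans
    (Nat.mul_le_mul_left n (centralBinom_le_mul_pow_card_primes (n := n) (by omega)))
  set c := ((Finset.Ioc n (2 * n)).filter Nat.Prime).card
  have hn0 : (0 : ℝ) < n := by
    have : 0 < n := by omega
    exact_mod_cast this
  have h' : (4 : ℝ) ^ n ≤ n * ((2 * n) ^ Nat.sqrt (2 * n) * 4 ^ (2 * n / 3) * (2 * n) ^ c) := by
    exact_mod_cast h
  have hl := Real.log_le_log (by positivity) h'
  rw [Real.log_mul (by positivity) (by positivity), Real.log_mul (by positivity) (by positivity),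
    Real.log_mul (by positivity) (by positivity), Real.log_pow, Real.log_pow, Real.log_pow,
    Real.log_pow] at hl
  have h1 : Real.log n ≤ Real.log (2 * n) := Real.log_le_log hn0 (by linarith)
  have h2 : ((2 * n / 3 : ℕ) : ℝ) ≤ 2 * n / 3 := by
    exact Nat.cast_div_le.trans (by push_cast; exact le_rfl)
  have h3 : (Nat.sqrt (2 * n) : ℝ) ≤ Real.sqrt (2 * n) := by
    have := Real.nat_sqrt_le_real_sqrt (a := 2 * n)
    push_cast at this
    exact this
  have h4 : 0 < Real.log 4 := Real.log_pos (by norm_num)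
  have h5 : 0 ≤ Real.log (2 * n) := by
    apply Real.log_nonneg
    have : (4 : ℝ) ≤ n := by exact_mod_cast hn
    linarith
  have h6 := mul_le_mul_of_nonneg_right h2 h4.le
  have h7 := mul_le_mul_of_nonneg_right h3 h5
  nlinarith

theorem eventually_rpow_le_card_primes {δ : ℝ} (hδ : 0 < δ) :
    ∀ᶠ y : ℝ in Filter.atTop, ∀ P : Finset ℕ,
      (∀ p : ℕ, p.Prime → y ≤ p → (p : ℝ) ≤ 2 * y → p ∈ P) → y ^ (1 - δ) ≤ P.card := by
  have e1 := (isLittleO_log_rpow_atTop (show (0 : ℝ) < min δ (1 / 2) / 2 by positivity)).bound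
    (show (0 : ℝ) < 1 / 32 by norm_num)
  have e2 := (tendsto_rpow_atTop
    (show (0 : ℝ) < min δ (1 / 2) / 2 by positivity)).eventually_ge_atTop 2
  filter_upwards [e1, e2, Filter.eventually_ge_atTop 16] with y hlog hpow hy P hP
  set η := min δ (1 / 2) with hη
  have hη0 : 0 < η := by positivity
  have hη1 : η ≤ 1 / 2 := min_le_right _ _
  have hy0 : 0 < y := by linarith
  set n := ⌊y⌋₊ with hnd
  have hny : (n : ℝ) ≤ y := Nat.floor_le hy0.le
  have hyn : y < n + 1 := Nat.lt_floor_add_one y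
  have hn4 : 4 ≤ n := Nat.le_floor (by push_cast; linarith)
  have hsub : (Finset.Ioc n (2 * n)).filter Nat.Prime ⊆ P := by
    intro p hp
    rw [Finset.mem_filter, Finset.mem_Ioc] at hp
    have a1 : ((n + 1 : ℕ) : ℝ) ≤ p := by exact_mod_cast hp.1.1
    have a2 : (p : ℝ) ≤ ((2 * n : ℕ) : ℝ) := by exact_mod_cast hp.1.2
    push_cast at a1 a2
    exact hP p hp.2 (by linarith) (by linarith)
  have hc : (((Finset.Ioc n (2 * n)).filter Nat.Prime).card : ℝ) ≤ P.card := by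
    exact_mod_cast Finset.card_le_card hsub
  have hmain := log_four_mul_le_card_primes hn4
  have h4 : 1 ≤ Real.log 4 := by
    have : Real.log 4 = 2 * Real.log 2 := by
      rw [show (4 : ℝ) = 2 ^ 2 by norm_num, Real.log_pow]; norm_num
    have := Real.log_two_gt_d9
    linarith
  have hlogy : Real.log (2 * n) ≤ 2 * Real.log y := by
    rw [← Real.log_rpow hy0]
    apply Real.log_le_log
    · have : (4 : ℝ) ≤ n := by exact_mod_cast hn4
      linarith
    · have : y ^ (2 : ℝ) = y * y := by rw [Real.rpow_two]; ring
      rw [this]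
      nlinarith
  have hlog0 : 0 ≤ Real.log y := Real.log_nonneg (by linarith)
  rw [Real.norm_of_nonneg hlog0, Real.norm_of_nonneg (by positivity)] at hlog
  have hsq : Real.sqrt (2 * n) ≤ 2 * y ^ (1 - η) := by
    have b1 : Real.sqrt (2 * n) ≤ Real.sqrt (4 * y) := Real.sqrt_le_sqrt (by linarith)
    have b2 : Real.sqrt (4 * y) = 2 * Real.sqrt y := by
      rw [Real.sqrt_mul (by norm_num), show (4 : ℝ) = 2 ^ 2 by norm_num,
        Real.sqrt_sq (by norm_num)]
    have b3 : Real.sqrt y ≤ y ^ (1 - η) := by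
      rw [Real.sqrt_eq_rpow]
      exact Real.rpow_le_rpow_of_exponent_le (by linarith) (by linarith)
    linarith
  have h1 : 1 ≤ y ^ (1 - η) := Real.one_le_rpow (by linarith) (by linarith)
  have hδη : y ^ (1 - δ) ≤ y ^ (1 - η) :=
    Real.rpow_le_rpow_of_exponent_le (by linarith) (by linarith [min_le_left δ (1 / 2)])
  by_contra hlt
  push Not at hlt
  have hX : Real.sqrt (2 * n) + 1 + (((Finset.Ioc n (2 * n)).filter Nat.Prime).card : ℝ) ≤
      4 * y ^ (1 - η) := by linarith
  have hZ : y ^ (1 - η) * y ^ (η / 2) * y ^ (η / 2) = y := by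
    rw [← Real.rpow_add hy0, ← Real.rpow_add hy0]
    ring_nf
    rw [Real.rpow_one]
  have hfin : (n : ℝ) / 3 ≤ 4 * y ^ (1 - η) * (2 * (1 / 32 * y ^ (η / 2))) := by
    calc (n : ℝ) / 3 ≤ n / 3 * Real.log 4 := le_mul_of_one_le_right (by positivity) h4
      _ ≤ _ := hmain
      _ ≤ 4 * y ^ (1 - η) * (2 * (1 / 32 * y ^ (η / 2))) := by
        apply mul_le_mul hX (hlogy.trans (by linarith)) _ (by positivity)
        apply Real.log_nonneg
        have : (4 : ℝ) ≤ n := by exact_mod_cast hn4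
        linarith
  have hX0 : 0 ≤ y ^ (1 - η) * y ^ (η / 2) := by positivity
  nlinarith

theorem two_mul_rpow_le {ε y : ℝ} (hε : 0 < ε) (hy : 0 < y) :
    (2 * y) ^ ((1 : ℝ) / 2 - ε) ≤ 3 / 2 * y ^ ((1 : ℝ) / 2 - ε) := by
  rw [Real.mul_rpow (by norm_num) hy.le]
  have h : (2 : ℝ) ^ ((1 : ℝ) / 2 - ε) ≤ 3 / 2 := by
    calc (2 : ℝ) ^ ((1 : ℝ) / 2 - ε) ≤ 2 ^ ((1 : ℝ) / 2) :=
          Real.rpow_le_rpow_of_exponent_le (by norm_num) (by linarith)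
      _ = Real.sqrt 2 := (Real.sqrt_eq_rpow 2).symm
      _ ≤ 3 / 2 := Real.sqrt_le_iff.mpr ⟨by norm_num, by norm_num⟩
  gcongr

theorem sieve_count_lt {ε y : ℝ} {N k T c : ℕ} (hε : 0 < ε) (hε' : ε < 1 / 2) (hy : 16 ≤ y)
    (hyN : y ≤ N) (hlog : Real.log N ≤ y ^ ε)
    (hT : (T : ℝ) * (k : ℝ) ^ T ≤ 2 * y ^ (3 / 4 * ε)) (hbig : 243 < y ^ (ε / 8))
    (hc : y ^ (1 - ε / 8) ≤ c) :
    k ^ T * (T * (2 * ⌊(2 * y) ^ ((1 : ℝ) / 2 - ε)⌋₊ + 1) ^ 2 *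
      Nat.log 2 (2 * ⌊(2 * y) ^ ((1 : ℝ) / 2 - ε)⌋₊ * N)) < c := by
  have hy0 : 0 < y := by linarith
  set L := ⌊(2 * y) ^ ((1 : ℝ) / 2 - ε)⌋₊ with hLd
  have hL1 : 1 ≤ L := Nat.le_floor (by
    push_cast
    exact Real.one_le_rpow (by linarith) (by linarith))
  have hL1' : (1 : ℝ) ≤ L := by exact_mod_cast hL1
  have hL : (L : ℝ) ≤ 3 / 2 * y ^ ((1 : ℝ) / 2 - ε) :=
    (Nat.floor_le (by positivity)).trans (two_mul_rpow_le hε hy0)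
  have hLsq : (2 * (L : ℝ) + 1) ^ 2 ≤ 81 / 4 * y ^ (1 - 2 * ε) := by
    calc (2 * (L : ℝ) + 1) ^ 2 ≤ (3 * (3 / 2 * y ^ ((1 : ℝ) / 2 - ε))) ^ 2 := by
          gcongr
          linarith
      _ = 81 / 4 * (y ^ ((1 : ℝ) / 2 - ε) * y ^ ((1 : ℝ) / 2 - ε)) := by ring
      _ = 81 / 4 * y ^ (1 - 2 * ε) := by
          rw [← Real.rpow_add hy0]
          ring_nf
  have hN1 : (1 : ℝ) ≤ N := by linarith
  have hLN : 2 * (L : ℝ) ≤ N := by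
    have : y ^ ((1 : ℝ) / 2 - ε) ≤ y / 4 := by
      calc y ^ ((1 : ℝ) / 2 - ε) ≤ y ^ ((1 : ℝ) / 2) :=
            Real.rpow_le_rpow_of_exponent_le (by linarith) (by linarith)
        _ = Real.sqrt y := (Real.sqrt_eq_rpow y).symm
        _ ≤ y / 4 := Real.sqrt_le_iff.mpr ⟨by linarith, by nlinarith⟩
    linarith
  have hlogN0 : 0 ≤ Real.log N := Real.log_nonneg hN1
  have hlog2 : (Nat.log 2 (2 * L * N) : ℝ) ≤ 3 * y ^ ε := by
    have h1 : (Nat.log 2 (2 * L * N) : ℝ) ≤ Real.logb 2 (2 * L * N) := by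
      have := Real.natLog_le_logb (2 * L * N) 2
      push_cast at this
      exact this
    have h2 : Real.log (2 * L * N) ≤ 2 * Real.log N := by
      rw [Real.log_mul (by positivity) (by positivity)]
      linarith [Real.log_le_log (by positivity) hLN]
    have h3 : Real.logb 2 (2 * L * N) ≤ 3 * Real.log N := by
      rw [Real.logb, div_le_iff₀ (Real.log_pos (by norm_num))]
      nlinarith [Real.log_two_gt_d9]
    linarith
  have hreal : (k : ℝ) ^ T * (T * (2 * (L : ℝ) + 1) ^ 2 * (Nat.log 2 (2 * L * N) : ℝ)) < c := by
    calc (k : ℝ) ^ T * (T * (2 * (L : ℝ) + 1) ^ 2 * (Nat.log 2 (2 * L * N) : ℝ))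
        = (T * (k : ℝ) ^ T) * (2 * (L : ℝ) + 1) ^ 2 * (Nat.log 2 (2 * L * N) : ℝ) := by ring
      _ ≤ (2 * y ^ (3 / 4 * ε)) * (81 / 4 * y ^ (1 - 2 * ε)) * (3 * y ^ ε) := by gcongr
      _ = 243 / 2 * (y ^ (3 / 4 * ε) * y ^ (1 - 2 * ε) * y ^ ε) := by ring
      _ = 243 / 2 * y ^ (1 - ε / 4) := by
          rw [← Real.rpow_add hy0, ← Real.rpow_add hy0]
          ring_nf
      _ < y ^ (ε / 8) * y ^ (1 - ε / 4) := by
          have : 0 < y ^ (1 - ε / 4) := by positivity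
          gcongr
          linarith
      _ = y ^ (1 - ε / 8) := by
          rw [← Real.rpow_add hy0]
          ring_nf
      _ ≤ c := hc
  exact_mod_cast hreal

theorem two_mul_factorial_le_exp {Q : ℝ} (hQ : 3 ≤ Q) :
    (2 * Q - 1) * (⌊Q⌋₊.factorial : ℝ) * (3 / 2) ≤ Real.exp (Q ^ 3) := by
  have hlogQ : Q ≤ Real.exp Q := by linarith [Real.add_one_le_exp Q]
  have hfac : (⌊Q⌋₊.factorial : ℝ) ≤ Real.exp (Q * Q) := by
    calc (⌊Q⌋₊.factorial : ℝ) ≤ (⌊Q⌋₊ : ℝ) ^ ⌊Q⌋₊ := by exact_mod_cast Nat.factorial_le_pow _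
      _ ≤ (Real.exp Q) ^ ⌊Q⌋₊ := by
          gcongr
          exact (Nat.floor_le (by linarith)).trans hlogQ
      _ = Real.exp (⌊Q⌋₊ * Q) := by rw [← Real.exp_nat_mul]
      _ ≤ Real.exp (Q * Q) := by
          gcongr
          exact Nat.floor_le (by linarith)
  have hlin : (2 * Q - 1) * (3 / 2) ≤ Real.exp (3 * Q) := by
    linarith [Real.add_one_le_exp (3 * Q)]
  calc (2 * Q - 1) * (⌊Q⌋₊.factorial : ℝ) * (3 / 2)
      = ((2 * Q - 1) * (3 / 2)) * ⌊Q⌋₊.factorial := by ring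
    _ ≤ Real.exp (3 * Q) * Real.exp (Q * Q) := by gcongr
    _ = Real.exp (3 * Q + Q * Q) := (Real.exp_add _ _).symm
    _ ≤ Real.exp (Q ^ 3) := by
        gcongr
        nlinarith [mul_nonneg (show (0 : ℝ) ≤ Q by linarith) (show (0 : ℝ) ≤ Q - 3 by linarith)]

theorem mul_pow_le_of_nontrivial {ε y x : ℝ} {k T : ℕ} (hk : 2 ≤ k) (hε : 0 < ε) (hε' : ε < 1 / 2)
    (hy : 1 ≤ y) (hx : 0 ≤ x) (hxy : x ≤ Real.log y)
    (hnt : Real.exp (24 * k * Real.log k / ε) ≤ 2 * y ^ ε)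
    (hT : (T : ℝ) ≤ k * (2 + x / (8 * k * Real.log k / ε)) + 1) :
    (T : ℝ) * (k : ℝ) ^ T ≤ 2 * y ^ (3 / 4 * ε) := by
  have hy0 : 0 < y := by linarith
  have hk2 : (2 : ℝ) ≤ k := by exact_mod_cast hk
  have hlk : 0 < Real.log k := Real.log_pos (by linarith)
  have hly : 0 ≤ Real.log y := hx.trans hxy
  have hTk : (T : ℝ) ≤ (k : ℝ) ^ T := by
    exact_mod_cast (Nat.lt_pow_self (show 1 < k by omega)).le
  have hnt' : 24 * k * Real.log k ≤ ε * (Real.log 2 + ε * Real.log y) := by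
    have := Real.log_le_log (Real.exp_pos _) hnt
    rw [Real.log_exp, Real.log_mul (by norm_num) (by positivity), Real.log_rpow hy0,
      div_le_iff₀ hε] at this
    linarith
  have hTl : T * Real.log k ≤ 3 * k * Real.log k + ε * Real.log y / 8 := by
    calc T * Real.log k ≤ (k * (2 + x / (8 * k * Real.log k / ε)) + 1) * Real.log k := by gcongr
      _ = (2 * k + 1) * Real.log k + ε * x / 8 := by
          field_simp
          ring
      _ ≤ _ := by
          have : (2 * k + 1) * Real.log k ≤ 3 * k * Real.log k := by
            gcongr
            linarith
          have : ε * x ≤ ε * Real.log y := by gcongr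
          linarith
  have hl2 : 0 < Real.log 2 := Real.log_pos (by norm_num)
  calc (T : ℝ) * (k : ℝ) ^ T ≤ (k : ℝ) ^ T * (k : ℝ) ^ T := by gcongr
    _ = Real.exp (2 * (T * Real.log k)) := by
        rw [two_mul, Real.exp_add, Real.exp_nat_mul, Real.exp_log (by linarith)]
    _ ≤ Real.exp (Real.log 2 + Real.log y * (3 / 4 * ε)) := by
        rw [Real.exp_le_exp]
        have h1 : ε * Real.log 2 ≤ Real.log 2 := by nlinarith
        have h0 := mul_nonneg hε.le hly
        have h2 : ε * (ε * Real.log y) ≤ ε * Real.log y := by nlinarith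
        linarith
    _ = 2 * y ^ (3 / 4 * ε) := by
        rw [Real.exp_add, Real.exp_log (by norm_num), Real.rpow_def_of_pos hy0]

theorem isIntAPLen_Icc (N : ℕ) : IsIntAPLen {n : ℤ | 0 ≤ n ∧ n ≤ N} (N + 1) := by
  refine ⟨0, 1, Set.ext fun n => ⟨fun hn => ⟨n.toNat, ?_, ?_⟩, ?_⟩⟩
  · have := hn.1
    have := hn.2
    simp only [Set.mem_ofPred_eq]
    omega
  · have := hn.1
    simp only
    omega
  · rintro ⟨j, hj, rfl⟩
    simp only [Set.mem_ofPred_eq] at hj ⊢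
    omega

theorem stmt3 :
    ∃ c : ℝ, 0 < c ∧ ∀ ε : ℝ, ε ∈ Set.Ioo (0 : ℝ) (1/2) → ∃ N₀ : ℕ,
      ∀ k : ℕ, 0 < k → ∀ N : ℕ, N₀ < N → ∀ y : ℝ,
        (Real.log N) ^ (1 / ε) ≤ y → y ≤ N →
        ∀ R : (p : ℕ) → Fin k → Set (ZMod p),
          (∀ p : ℕ, Nat.Prime p → y ≤ (p : ℝ) → (p : ℝ) ≤ 2 * y → ∀ i : Fin k,
            ∃ m : ℕ, (m : ℝ) ≤ (p : ℝ) ^ ((1 : ℝ)/2 - ε) ∧ IsAPZModLen p (R p i) m) →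
          ∀ A : Set ℤ,
            A = {n : ℤ | 0 ≤ n ∧ n ≤ (N : ℤ) ∧
                  ∀ p : ℕ, Nat.Prime p → y ≤ (p : ℝ) → (p : ℝ) ≤ 2 * y →
                    ∃ i : Fin k, (n : ZMod p) ∈ R p i} →
            ∃ Q : Fin k → Set ℤ,
              (∀ i : Fin k, ∃ m : ℕ,
                (m : ℝ) ≤ Real.exp (Real.exp (c * k * Real.log k / ε)) * y ^ ((1 : ℝ)/2 - ε) ∧
                IsIntAPLen (Q i) m) ∧
              A ⊆ ⋃ i : Fin k, Q i := by
  refine ⟨24, by norm_num, fun ε ⟨hε, hε'⟩ => ?_⟩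
  have hlogT : ∀ᶠ y : ℝ in Filter.atTop,
      3 + Real.log y / Real.log (6 / 5) ≤ 2 * y ^ (3 / 4 * ε) := by
    have hl : 0 < Real.log (6 / 5 : ℝ) := Real.log_pos (by norm_num)
    filter_upwards [(isLittleO_log_rpow_atTop (show (0 : ℝ) < 3 / 4 * ε by positivity)).bound hl,
      (tendsto_rpow_atTop (show (0 : ℝ) < 3 / 4 * ε by positivity)).eventually_ge_atTop 3,
      Filter.eventually_ge_atTop 1] with y h1 h2 h3
    rw [Real.norm_of_nonneg (Real.log_nonneg h3), Real.norm_of_nonneg (by positivity)] at h1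
    have : Real.log y / Real.log (6 / 5) ≤ y ^ (3 / 4 * ε) := by
      rw [div_le_iff₀ hl]
      linarith
    linarith
  obtain ⟨Y, hY⟩ := Filter.eventually_atTop.mp (hlogT.and
    ((eventually_rpow_le_card_primes (show 0 < ε / 8 by positivity)).and
    (((tendsto_rpow_atTop (show (0 : ℝ) < ε / 8 by positivity)).eventually_gt_atTop 243).and
    (Filter.eventually_ge_atTop 16))))
  have htend : Filter.Tendsto (fun N : ℕ => Real.log N ^ (1 / ε)) Filter.atTop Filter.atTop :=
    (tendsto_rpow_atTop (by positivity)).comp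
      (Real.tendsto_log_atTop.comp tendsto_natCast_atTop_atTop)
  obtain ⟨N₀, hN₀⟩ := Filter.eventually_atTop.mp (htend.eventually_ge_atTop Y)
  refine ⟨N₀, fun k hk N hN y hNy hyN R hR A hA => ?_⟩
  obtain ⟨hlT, hprimes, hbig, hy16⟩ := hY y ((hN₀ N hN.le).trans hNy)
  have hy0 : 0 < y := by linarith
  have hN1 : (1 : ℝ) ≤ N := by linarith
  have hlogN0 : 0 ≤ Real.log N := Real.log_nonneg hN1
  have hlogN : Real.log N ≤ y ^ ε := by
    have := Real.rpow_le_rpow (by positivity) hNy hε.le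
    rwa [← Real.rpow_mul hlogN0, one_div_mul_cancel hε.ne', Real.rpow_one] at this
  have hypow : 1 ≤ y ^ ((1 : ℝ) / 2 - ε) := Real.one_le_rpow (by linarith) (by linarith)
  by_cases htriv : ((N + 1 : ℕ) : ℝ) ≤
      Real.exp (Real.exp (24 * k * Real.log k / ε)) * y ^ ((1 : ℝ) / 2 - ε)
  · refine ⟨fun _ => {n : ℤ | 0 ≤ n ∧ n ≤ N}, fun _ => ⟨N + 1, htriv, isIntAPLen_Icc N⟩, ?_⟩
    intro n hn
    rw [hA] at hn
    exact Set.mem_iUnion.mpr ⟨⟨0, hk⟩, hn.1, hn.2.1⟩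
  push Not at htriv
  have hnt : Real.exp (24 * k * Real.log k / ε) ≤ 2 * y ^ ε := by
    have h1 : Real.exp (Real.exp (24 * k * Real.log k / ε)) ≤ (N : ℝ) ^ 2 := by
      push_cast at htriv
      nlinarith [Real.exp_pos (Real.exp (24 * k * Real.log k / ε))]
    have h2 := Real.log_le_log (Real.exp_pos _) h1
    rw [Real.log_exp, Real.log_pow] at h2
    push_cast at h2
    linarith
  let P := (Finset.range (⌊2 * y⌋₊ + 1)).filter fun p : ℕ => p.Prime ∧ y ≤ p ∧ (p : ℝ) ≤ 2 * y
  have hP : ∀ p ∈ P, p.Prime ∧ y ≤ p ∧ (p : ℝ) ≤ 2 * y := fun p hp => (Finset.mem_filter.mp hp).2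
  have hPcard := hprimes P fun p h1 h2 h3 => Finset.mem_filter.mpr
    ⟨Finset.mem_range.mpr (Nat.lt_succ_of_le (Nat.le_floor h3)), h1, h2, h3⟩
  set L := ⌊(2 * y) ^ ((1 : ℝ) / 2 - ε)⌋₊ with hLd
  have hL1 : 1 ≤ L := Nat.le_floor (by
    push_cast
    exact Real.one_le_rpow (by linarith) (by linarith))
  have hL1' : (1 : ℝ) ≤ L := by exact_mod_cast hL1
  have hL : (L : ℝ) ≤ 3 / 2 * y ^ ((1 : ℝ) / 2 - ε) :=
    (Nat.floor_le (by positivity)).trans (two_mul_rpow_le hε hy0)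
  have hlogL0 : 0 ≤ Real.log L := Real.log_nonneg hL1'
  have hlogL : Real.log L ≤ Real.log y := by
    refine Real.log_le_log (by linarith) (hL.trans ?_)
    have : y ^ ((1 : ℝ) / 2 - ε) ≤ y / 4 := by
      calc y ^ ((1 : ℝ) / 2 - ε) ≤ y ^ ((1 : ℝ) / 2) :=
            Real.rpow_le_rpow_of_exponent_le (by linarith) (by linarith)
        _ = Real.sqrt y := (Real.sqrt_eq_rpow y).symm
        _ ≤ y / 4 := Real.sqrt_le_iff.mpr ⟨by linarith, by nlinarith⟩
    linarith
  have key : ∀ Q : ℝ, 1 < Q → (∀ T : ℕ, (T : ℝ) ≤ k * (2 + Real.log L / Real.log Q) + 1 →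
      (T : ℝ) * (k : ℝ) ^ T ≤ 2 * y ^ (3 / 4 * ε)) →
      (2 * Q - 1) * (⌊Q⌋₊.factorial : ℝ) * (3 / 2) ≤
        Real.exp (Real.exp (24 * k * Real.log k / ε)) →
      ∃ S : Fin k → Set ℤ, (∀ i : Fin k, ∃ m : ℕ,
        (m : ℝ) ≤ Real.exp (Real.exp (24 * k * Real.log k / ε)) * y ^ ((1 : ℝ)/2 - ε) ∧
          IsIntAPLen (S i) m) ∧ A ⊆ ⋃ i : Fin k, S i := by
    intro Q hQ hT hQexp
    have hx0 : 0 ≤ k * (2 + Real.log L / Real.log Q) := by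
      have := Real.log_pos hQ
      positivity
    have hT1 := hT (⌊k * (2 + Real.log L / Real.log Q)⌋₊ + 1) (by
      push_cast
      linarith [Nat.floor_le hx0])
    have hRL : ∀ p ∈ P, ∀ i, ∃ m ≤ L, IsAPZModLen p (R p i) m := by
      intro p hp i
      obtain ⟨hp1, hp2, hp3⟩ := hP p hp
      obtain ⟨m, hm, hRm⟩ := hR p hp1 hp2 hp3 i
      refine ⟨m, Nat.le_floor (hm.trans ?_), hRm⟩
      exact Real.rpow_le_rpow (Nat.cast_nonneg _) hp3 (by linarith)
    have hAN : ∀ n ∈ A, 0 ≤ n ∧ n ≤ (N : ℤ) := by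
      intro n hn
      rw [hA] at hn
      exact ⟨hn.1, hn.2.1⟩
    have hAR : ∀ p ∈ P, ∀ n ∈ A, ∃ i, (n : ZMod p) ∈ R p i := by
      intro p hp n hn
      rw [hA] at hn
      obtain ⟨hp1, hp2, hp3⟩ := hP p hp
      exact hn.2.2 p hp1 hp2 hp3
    have hTlt : k * (2 + Real.logb Q L) <
        ((⌊k * (2 + Real.log L / Real.log Q)⌋₊ + 1 : ℕ) : ℝ) := by
      push_cast
      exact Nat.lt_floor_add_one _
    obtain ⟨S, hS, hAS⟩ := exists_cover_of_mod_primes hk hL1 hQ (fun p hp => (hP p hp).1)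
      hRL hAN hAR hTlt (sieve_count_lt hε hε' hy16 hyN hlogN hT1 hbig hPcard)
    refine ⟨S, fun i => ?_, hAS⟩
    obtain ⟨m, hm, hSm⟩ := hS i
    refine ⟨m, hm.trans ?_, hSm⟩
    have h0 : 0 ≤ (2 * Q - 1) * (⌊Q⌋₊.factorial : ℝ) :=
      mul_nonneg (by linarith) (Nat.cast_nonneg _)
    calc (2 * Q - 1) * (⌊Q⌋₊.factorial : ℝ) * L
        ≤ (2 * Q - 1) * (⌊Q⌋₊.factorial : ℝ) * (3 / 2 * y ^ ((1 : ℝ) / 2 - ε)) := by gcongr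
      _ = (2 * Q - 1) * (⌊Q⌋₊.factorial : ℝ) * (3 / 2) * y ^ ((1 : ℝ) / 2 - ε) := by ring
      _ ≤ _ := by gcongr
  rcases Nat.lt_or_ge 1 k with hk2 | hk1
  · have hk2' : (2 : ℝ) ≤ k := by exact_mod_cast hk2
    have hlk : Real.log 2 ≤ Real.log k := Real.log_le_log (by norm_num) hk2'
    have hexp : 2 ≤ 8 * k * Real.log k / ε := by
      rw [le_div_iff₀ hε]
      nlinarith [Real.log_two_gt_d9]
    have hQ3 : 3 ≤ Real.exp (8 * k * Real.log k / ε) := by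
      linarith [Real.add_one_le_exp (8 * k * Real.log k / ε)]
    refine key (Real.exp (8 * k * Real.log k / ε)) (by linarith) (fun T hT => ?_) ?_
    · rw [Real.log_exp] at hT
      exact mul_pow_le_of_nontrivial hk2 hε hε' (by linarith) hlogL0 hlogL hnt hT
    · refine (two_mul_factorial_le_exp hQ3).trans (le_of_eq ?_)
      rw [← Real.exp_nat_mul]
      congr 2
      push_cast
      ring
  · obtain rfl : k = 1 := by omega
    refine key (6 / 5) (by norm_num) (fun T hT => ?_) ?_
    · have hl : 0 < Real.log (6 / 5 : ℝ) := Real.log_pos (by norm_num)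
      have := div_le_div_of_nonneg_right hlogL hl.le
      push_cast at hT ⊢
      rw [one_pow, mul_one]
      linarith
    · have hf : ⌊(6 / 5 : ℝ)⌋₊ = 1 := by
        rw [Nat.floor_eq_iff (by norm_num)]
        norm_num
      rw [hf]
      have := Real.exp_one_gt_d9
      simp only [Nat.cast_one, Real.log_one, mul_zero, zero_div, Real.exp_zero,
        Nat.factorial_one]
      linarith
end

section
/- For each ε ∈ (0, 1) there is a threshold N₀(ε) such that the following holds. Let N > N₀(ε) be an integer and let p₀ be a prime with p₀ ≤ (16·log N)^{1/ε}. For each prime p with p₀ ≤ p ≤ 2·(16·log N)^{1/ε}, let I_p ⊆ ℤ/pℤ be an interval with |I_p| ≤ p^{1−ε} + 1. Let A be the set of all integers n ∈ {0, 1, …, N} such that for every prime p with p₀ ≤ p ≤ 2·(16·log N)^{1/ε} the residue of n mod p lies in I_p. Then A is contained in an interval of integers of cardinality at most max(p₀^{1−ε} + 1, N₀(ε)). -/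
open Filter in
lemma eventually_log_add_sqrt_mul_log_le : ∀ᶠ x : ℝ in atTop,
    Real.log x + √(2 * x) * Real.log (2 * x) ≤ 1 / 20 * x := by
  have h2 : Tendsto (fun x : ℝ => 2 * x) atTop atTop := tendsto_id.const_mul_atTop two_pos
  have h1 := Real.isLittleO_log_id_atTop.bound (show (0 : ℝ) < 1 / 40 by norm_num)
  have h3 := (h2.eventually
    ((isLittleO_log_rpow_atTop (show (0 : ℝ) < 1 / 2 by norm_num)).bound
      (show (0 : ℝ) < 1 / 80 by norm_num)))
  filter_upwards [h1, h3, eventually_ge_atTop 0] with x h1 h3 hx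
  rw [← Real.sqrt_eq_rpow, Real.norm_of_nonneg (Real.sqrt_nonneg _)] at h3
  rw [id, Real.norm_of_nonneg hx] at h1
  have h4 := (le_abs_self _).trans h3
  have h5 := (le_abs_self _).trans h1
  have h6 := Real.mul_self_sqrt (show 0 ≤ 2 * x by positivity)
  nlinarith [mul_le_mul_of_nonneg_left h4 (Real.sqrt_nonneg (2 * x))]

/-- The upper bound on the central binomial coefficient behind Bertrand's postulate, keeping the
contribution of the primes in `(n, 2n]`. -/
lemma centralBinom_le_mul_prod_primes (n : ℕ) (hn : 2 < n) :
    n.centralBinom ≤ (2 * n) ^ Nat.sqrt (2 * n) * 4 ^ (2 * n / 3) *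
      ∏ p ∈ Finset.Ioc n (2 * n) with p.Prime, p := by
  have hterm : ∀ p ∈ Finset.range (2 * n + 1), p ^ n.centralBinom.factorization p ≤
      (if p ∈ Finset.Icc 1 (Nat.sqrt (2 * n)) then 2 * n else 1) *
      (if p.Prime ∧ p ≤ 2 * n / 3 then p else 1) * (if p.Prime ∧ n < p then p else 1) := by
    intro p _
    by_cases hp : p.Prime
    swap
    · rw [Nat.factorization_eq_zero_of_not_prime _ hp, pow_zero]
      split_ifs <;> first | omega | tauto
    have hp1 := hp.one_lt
    by_cases hs : p ≤ Nat.sqrt (2 * n)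
    · have h : p ^ n.centralBinom.factorization p ≤ 2 * n :=
        Nat.pow_factorization_choose_le (by omega)
      rw [if_pos (Finset.mem_Icc.2 ⟨hp1.le, hs⟩)]
      calc _ ≤ 2 * n := h
        _ ≤ _ := by
          rw [mul_assoc]
          apply Nat.le_mul_of_pos_right
          apply Nat.mul_pos <;> split_ifs <;> omega
    have h1 : n.centralBinom.factorization p ≤ 1 :=
      Nat.factorization_choose_le_one (Nat.sqrt_lt'.1 (not_le.1 hs))
    have hle : p ^ n.centralBinom.factorization p ≤ p := by
      simpa using Nat.pow_le_pow_right hp.pos h1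
    by_cases h3 : p ≤ 2 * n / 3
    · simp [hp, hs, h3]; split_ifs <;> nlinarith
    by_cases h4 : n < p
    · simp [hp, hs, h3, h4]; simpa using hle
    · rw [Nat.factorization_centralBinom_of_two_mul_self_lt_three_mul hn (by omega) (by omega)]
      simp [hs, h3, h4]
  rw [← Nat.prod_pow_factorization_centralBinom]
  refine (Finset.prod_le_prod' hterm).trans ?_
  rw [Finset.prod_mul_distrib, Finset.prod_mul_distrib, ← Finset.prod_filter,
    ← Finset.prod_filter, ← Finset.prod_filter]
  refine Nat.mul_le_mul (Nat.mul_le_mul ?_ ?_) (le_of_eq ?_)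
  · rw [Finset.prod_const]
    refine Nat.pow_le_pow_right (by omega) ?_
    refine (Finset.card_le_card (t := Finset.Icc 1 (Nat.sqrt (2 * n))) ?_).trans (by simp)
    intro p hp
    exact (Finset.mem_filter.1 hp).2
  · refine le_trans (le_of_eq ?_) (primorial_le_four_pow (2 * n / 3))
    refine Finset.prod_congr ?_ fun _ _ => rfl
    ext p
    simp
    grind
  · refine Finset.prod_congr ?_ fun _ _ => rfl
    ext p
    simp
    grind

open Filter in
/-- A Chebyshev-type lower bound for the product of the primes in `(n, 2n]`. -/
lemma eventually_le_log_prod_primes : ∀ᶠ n : ℕ in atTop,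
    (41 / 100 : ℝ) * n ≤
      Real.log ((∏ p ∈ Finset.Ioc n (2 * n) with p.Prime, p : ℕ) : ℝ) := by
  filter_upwards [tendsto_natCast_atTop_atTop.eventually eventually_log_add_sqrt_mul_log_le,
    eventually_ge_atTop 4] with n hn h4
  set P := ∏ p ∈ Finset.Ioc n (2 * n) with p.Prime, p
  have hP : 0 < P := Finset.prod_pos fun p hp => (Finset.mem_filter.1 hp).2.pos
  have hn0 : (0 : ℝ) < n := by positivity
  have hP0 : (0 : ℝ) < P := by positivity
  have h : 4 ^ n ≤ n * ((2 * n) ^ Nat.sqrt (2 * n) * 4 ^ (2 * n / 3) * P) :=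
    (Nat.four_pow_lt_mul_centralBinom n h4).le.trans
      (Nat.mul_le_mul_left _ (centralBinom_le_mul_prod_primes n (by omega)))
  have h' : (4 : ℝ) ^ n ≤ n * ((2 * n) ^ Nat.sqrt (2 * n) * 4 ^ (2 * n / 3) * P) := by
    exact_mod_cast h
  have hl := Real.log_le_log (by positivity) h'
  rw [Real.log_mul (by positivity) (by positivity), Real.log_mul (by positivity) (by positivity),
    Real.log_mul (by positivity) (by positivity), Real.log_pow, Real.log_pow, Real.log_pow,
    show (4 : ℝ) = 2 ^ 2 by norm_num, Real.log_pow] at hl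
  have h2 := Real.log_two_gt_d9
  have hdiv : ((2 * n / 3 : ℕ) : ℝ) ≤ 2 * n / 3 := by
    exact_mod_cast Nat.cast_div_le (α := ℝ) (m := 2 * n) (n := 3)
  have hsq : (Nat.sqrt (2 * n) : ℝ) ≤ √(2 * n) := by
    exact_mod_cast Real.nat_sqrt_le_real_sqrt (a := 2 * n)
  have hlog : 0 ≤ Real.log (2 * n) := Real.log_nonneg (by norm_cast; omega)
  have h5 := mul_le_mul_of_nonneg_right hsq hlog
  have h6 := mul_le_mul_of_nonneg_right hdiv (show 0 ≤ Real.log 2 by linarith)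
  have h7 := mul_le_mul_of_nonneg_left h2.le hn0.le
  push_cast at hl
  linarith

/-- If every prime in `S` divides `d - r` for some `|r| ≤ R < d`, the primes in `S` divide the
nonzero integer `∏ (d - r)`, which bounds their product. -/
lemma prod_primes_le_pow {S : Finset ℕ} (hS : ∀ p ∈ S, p.Prime) {d R : ℕ} (hRd : R < d)
    (h : ∀ p ∈ S, ∃ r : ℤ, |r| ≤ R ∧ (p : ℤ) ∣ d - r) :
    ∏ p ∈ S, p ≤ (2 * d) ^ (2 * R + 1) := by
  have hdvd : ∏ p ∈ S, p ∣ ∏ i ∈ Finset.range (2 * R + 1), (d + R - i) := by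
    refine Finset.prod_primes_dvd _ (fun p hp => (hS p hp).prime) fun p hp => ?_
    obtain ⟨r, hr, hpr⟩ := h p hp
    rw [abs_le] at hr
    have hi : (r + R).toNat ∈ Finset.range (2 * R + 1) := by
      rw [Finset.mem_range]; omega
    refine dvd_trans ?_ (Finset.dvd_prod_of_mem _ hi)
    rw [← Int.natCast_dvd_natCast]
    convert! hpr using 1
    omega
  refine (Nat.le_of_dvd (Finset.prod_pos fun i hi => ?_) hdvd).trans ?_
  · rw [Finset.mem_range] at hi; omega
  · calc _ ≤ ∏ i ∈ Finset.range (2 * R + 1), (2 * d) :=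
        Finset.prod_le_prod' fun i _ => by omega
      _ = _ := by simp

open Filter in
/-- A large `d ≤ N` whose residues modulo all primes in the range are at most `p ^ (1 - ε)` in
absolute value is itself at most `p₀ ^ (1 - ε)`. -/
lemma le_rpow_of_abs_mod_primes_le {ε : ℝ} (hε : ε ∈ Set.Ioo (0 : ℝ) 1) :
    ∃ D : ℕ, ∀ d N p₀ : ℕ, D ≤ d → d ≤ N → p₀.Prime →
      (p₀ : ℝ) ≤ (16 * Real.log N) ^ (1 / ε) →
      (∀ p : ℕ, p.Prime → p₀ ≤ p → (p : ℝ) ≤ 2 * (16 * Real.log N) ^ (1 / ε) →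
        ∃ r : ℤ, (|r| : ℝ) ≤ (p : ℝ) ^ (1 - ε) ∧ (p : ℤ) ∣ d - r) →
      (d : ℝ) ≤ (p₀ : ℝ) ^ (1 - ε) := by
  obtain ⟨hε0, hε1⟩ := hε
  obtain ⟨n₀, hn₀⟩ := eventually_atTop.1 eventually_le_log_prod_primes
  have hlarge : ∀ᶠ x : ℝ in atTop,
      1 ≤ Real.log x ∧ n₀ + 20 ≤ Real.log x ∧ 2 * (16 * Real.log x) ^ (1 / ε) < x := by
    have hc : (0 : ℝ) < 1 / (4 * 16 ^ (1 / ε)) := by positivity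
    filter_upwards [Real.tendsto_log_atTop.eventually_ge_atTop 1,
      Real.tendsto_log_atTop.eventually_ge_atTop ((n₀ : ℝ) + 20),
      (isLittleO_log_rpow_rpow_atTop (1 / ε) one_pos).bound hc,
      eventually_gt_atTop 0] with x h1 h2 h3 h0
    refine ⟨h1, h2, ?_⟩
    rw [Real.rpow_one, Real.norm_of_nonneg h0.le, Real.norm_of_nonneg (by positivity)] at h3
    rw [Real.mul_rpow (by norm_num) (by positivity)]
    have hk : (0 : ℝ) < 16 ^ (1 / ε) := by positivity
    rw [div_mul_eq_mul_div, le_div_iff₀ (by positivity)] at h3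
    linarith
  obtain ⟨D, hD⟩ := eventually_atTop.1 (tendsto_natCast_atTop_atTop.eventually hlarge)
  refine ⟨D, fun d N p₀ hDd hdN hp₀ hp₀N h => ?_⟩
  obtain ⟨hl1, hln, hlt⟩ := hD d hDd
  set z : ℝ := (16 * Real.log d) ^ (1 / ε) with hz
  set Z : ℝ := (16 * Real.log N) ^ (1 / ε)
  have hd0 : (0 : ℝ) < d := by
    rcases Nat.eq_zero_or_pos d with rfl | h
    · norm_num at hl1
    · exact_mod_cast h
  have hzZ : z ≤ Z := by
    have : (d : ℝ) ≤ N := by exact_mod_cast hdN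
    apply Real.rpow_le_rpow (by positivity) _ (by positivity)
    have := Real.log_le_log hd0 this
    linarith
  have hzε : z ^ ε = 16 * Real.log d := by
    rw [hz, ← Real.rpow_mul (by positivity), one_div_mul_cancel hε0.ne', Real.rpow_one]
  have hz_large : 16 * Real.log d ≤ z :=
    Real.self_le_rpow_of_one_le (by linarith) (by rw [one_le_div hε0]; exact hε1.le)
  obtain ⟨y, hy⟩ : ∃ y, y = max (p₀ : ℝ) z := ⟨_, rfl⟩
  have hzy : z ≤ y := hy ▸ le_max_right _ _
  have hpy : (p₀ : ℝ) ≤ y := hy ▸ le_max_left _ _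
  have hyZ : y ≤ Z := hy ▸ max_le hp₀N hzZ
  have hy0 : 0 < y := by linarith
  have hyε : 16 * Real.log d ≤ y ^ ε := hzε ▸ Real.rpow_le_rpow (by linarith) hzy hε0.le
  have hymul : y ^ (1 - ε) * y ^ ε = y := by
    rw [← Real.rpow_add hy0]; simp
  have hy1 : 1 ≤ y ^ (1 - ε) := Real.one_le_rpow (by linarith) (by linarith)
  have h2y : (2 * y) ^ (1 - ε) ≤ 2 * y ^ (1 - ε) := by
    rw [Real.mul_rpow (by norm_num) hy0.le]
    gcongr
    calc (2 : ℝ) ^ (1 - ε) ≤ 2 ^ (1 : ℝ) :=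
          Real.rpow_le_rpow_of_exponent_le (by norm_num) (by linarith)
      _ = 2 := Real.rpow_one 2
  obtain ⟨n, hn⟩ : ∃ n, n = ⌊y⌋₊ := ⟨_, rfl⟩
  obtain ⟨R, hR⟩ : ∃ R, R = ⌊(2 * y) ^ (1 - ε)⌋₊ := ⟨_, rfl⟩
  have hny : (n : ℝ) ≤ y := hn ▸ Nat.floor_le hy0.le
  have hyn : y < n + 1 := hn ▸ Nat.lt_floor_add_one y
  have hRy : (R : ℝ) ≤ (2 * y) ^ (1 - ε) := hR ▸ Nat.floor_le (by positivity)
  have hRd : d ≤ R := by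
    by_contra! hRd
    have hP := prod_primes_le_pow (S := {p ∈ Finset.Ioc n (2 * n) | p.Prime})
      (fun p hp => (Finset.mem_filter.1 hp).2) hRd (by
        intro p hp
        simp only [Finset.mem_filter, Finset.mem_Ioc] at hp
        obtain ⟨⟨h1, h2⟩, hp⟩ := hp
        have h1' : (n : ℝ) + 1 ≤ p := by exact_mod_cast h1
        have h2' : (p : ℝ) ≤ 2 * n := by exact_mod_cast h2
        obtain ⟨r, hr, hpr⟩ := h p hp (by exact_mod_cast (show (p₀ : ℝ) ≤ p by linarith))
          (by linarith)
        refine ⟨r, ?_, hpr⟩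
        have h3 : (r.natAbs : ℝ) ≤ (2 * y) ^ (1 - ε) := by
          rw [Nat.cast_natAbs, Int.cast_abs]
          exact hr.trans (Real.rpow_le_rpow (by positivity) (by linarith) (by linarith))
        have h4 := Nat.le_floor h3
        rw [← hR] at h4
        rw [Int.abs_eq_natAbs]
        exact_mod_cast h4)
    have hS := hn₀ n (by
      have : (n₀ : ℝ) ≤ n := by linarith
      exact_mod_cast this)
    have hP0 : 0 < ∏ p ∈ Finset.Ioc n (2 * n) with p.Prime, p :=
      Finset.prod_pos fun p hp => (Finset.mem_filter.1 hp).2.pos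
    have hlog := Real.log_le_log (by exact_mod_cast hP0) (Nat.cast_le (α := ℝ).2 hP)
    push_cast at hlog hS
    rw [Real.log_pow, Real.log_mul (by norm_num) hd0.ne'] at hlog
    have hl2 := Real.log_two_lt_d9
    push_cast at hlog
    have hb : (2 * (R : ℝ) + 1) * (Real.log 2 + Real.log d) ≤
        (5 * y ^ (1 - ε)) * (6 / 5 * (y ^ ε / 16)) := by
      gcongr <;> linarith
    have hb' : (5 * y ^ (1 - ε)) * (6 / 5 * (y ^ ε / 16)) = 3 / 8 * y := by
      linear_combination (3 / 8 : ℝ) * hymul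
    linarith
  have hRd' : (d : ℝ) ≤ R := by exact_mod_cast hRd
  rcases le_total z p₀ with hc | hc
  · rw [max_eq_left hc] at hy
    subst hy
    obtain ⟨r, hr, hpr⟩ := h p₀ hp₀ le_rfl (by linarith)
    have hlt : |(d : ℝ) - r| < p₀ := by
      refine (abs_sub _ _).trans_lt ?_
      rw [abs_of_pos hd0]
      nlinarith
    have h0 : (d : ℤ) - r = 0 := Int.eq_zero_of_abs_lt_dvd hpr (by exact_mod_cast hlt)
    have : (d : ℝ) = r := by exact_mod_cast sub_eq_zero.1 h0
    rw [this]
    exact (le_abs_self _).trans hr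
  · rw [max_eq_right hc] at hy
    have : y ^ (1 - ε) ≤ y ^ (1 : ℝ) :=
      Real.rpow_le_rpow_of_exponent_le (by linarith) (by linarith)
    rw [Real.rpow_one] at this
    linarith

/-- Two elements of an interval of length `k` in `ℤ/pℤ` differ by less than `k` modulo `p`. -/
lemma IsZModIntervalLen.exists_dvd_sub {p k : ℕ} {I : Set (ZMod p)}
    (hI : IsZModIntervalLen p I k) {a b : ℤ} (ha : (a : ZMod p) ∈ I) (hb : (b : ZMod p) ∈ I) :
    ∃ r : ℤ, |r| + 1 ≤ k ∧ (p : ℤ) ∣ b - a - r := by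
  obtain ⟨c, rfl⟩ := hI
  obtain ⟨i, hi, hia⟩ := ha
  obtain ⟨j, hj, hjb⟩ := hb
  simp only [Set.mem_ofPred_eq] at hi hj
  refine ⟨j - i, ?_, ?_⟩
  · rcases abs_cases ((j : ℤ) - i) with h | h <;> omega
  · rw [← ZMod.intCast_zmod_eq_zero_iff_dvd]
    push_cast at hia hjb ⊢
    rw [← hia, ← hjb]
    ring

theorem stmt4 :
    ∀ ε : ℝ, ε ∈ Set.Ioo (0 : ℝ) 1 → ∃ N₀ : ℕ,
      ∀ N : ℕ, N₀ < N → ∀ p₀ : ℕ, Nat.Prime p₀ →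
        (p₀ : ℝ) ≤ (16 * Real.log N) ^ (1 / ε) →
        ∀ I : (p : ℕ) → Set (ZMod p),
          (∀ p : ℕ, Nat.Prime p → p₀ ≤ p → (p : ℝ) ≤ 2 * (16 * Real.log N) ^ (1 / ε) →
            ∃ k : ℕ, (k : ℝ) ≤ (p : ℝ) ^ (1 - ε) + 1 ∧ IsZModIntervalLen p (I p) k) →
          ∀ A : Set ℤ,
            A = {n : ℤ | 0 ≤ n ∧ n ≤ (N : ℤ) ∧
                  ∀ p : ℕ, Nat.Prime p → p₀ ≤ p →
                    (p : ℝ) ≤ 2 * (16 * Real.log N) ^ (1 / ε) → (n : ZMod p) ∈ I p} →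
            ∃ a : ℤ, ∃ k : ℕ, (k : ℝ) ≤ max ((p₀ : ℝ) ^ (1 - ε) + 1) (N₀ : ℝ) ∧
              A ⊆ {n : ℤ | a ≤ n ∧ n < a + k} := by
  intro ε hε
  obtain ⟨D, hD⟩ := le_rpow_of_abs_mod_primes_le hε
  refine ⟨D, fun N _ p₀ hp₀ hp₀N I hI A hA => ?_⟩
  rcases A.eq_empty_or_nonempty with rfl | hne
  · exact ⟨0, 0, by push_cast; exact le_max_of_le_right (Nat.cast_nonneg D), by simp⟩
  have hbelow : BddBelow A := ⟨0, fun n hn => by rw [hA] at hn; exact hn.1⟩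
  have habove : BddAbove A := ⟨N, fun n hn => by rw [hA] at hn; exact hn.2.1⟩
  have ha := Int.csInf_mem hne hbelow
  have hb := Int.csSup_mem hne habove
  have hsub : ∀ n ∈ A, sInf A ≤ n ∧ n ≤ sSup A := fun n hn =>
    ⟨csInf_le hbelow hn, le_csSup habove hn⟩
  generalize sInf A = a at *
  generalize sSup A = b at *
  obtain ⟨d, hd⟩ : ∃ d : ℕ, (d : ℤ) = b - a :=
    ⟨(b - a).toNat, Int.toNat_of_nonneg (by linarith [(hsub b hb).1])⟩
  refine ⟨a, d + 1, ?_, fun n hn => ⟨(hsub n hn).1, by have := (hsub n hn).2; push_cast; omega⟩⟩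
  rw [hA] at ha hb
  rcases lt_or_ge d D with hlt | hge
  · exact le_max_of_le_right (by exact_mod_cast hlt)
  · refine le_max_of_le_left ?_
    push_cast
    gcongr
    refine hD d N p₀ hge (by have := ha.1; have := hb.2.1; omega) hp₀ hp₀N ?_
    intro p hp hpp hpN
    obtain ⟨k, hk, hIk⟩ := hI p hp hpp hpN
    obtain ⟨r, hr, hpr⟩ := hIk.exists_dvd_sub (ha.2.2 p hp hpp hpN) (hb.2.2 p hp hpp hpN)
    refine ⟨r, ?_, hd ▸ hpr⟩
    have : (|r| : ℝ) + 1 ≤ k := by exact_mod_cast hr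
    linarith
end
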